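/- Let L = {4^m·25^n − 1 : m ≥ 1, n ≥ 0} ∪ {4·7^n − 1 : n ≥ 0} ∪ {2q^n + 1 : n ≥ 0, q a prime power with q ≡ 7 (mod 12)}. For every integer v that is the product of a nonempty finite multiset of elements of L, there exist an RDSQS(v + 1) and an LKTS(3v). -/

import Mathlib

open Finset

/-- A parallel class on point set `Y`: a collection of blocks that partitions `Y`. -/
def IsParallelClass (Y : Finset ℕ) (P : Finset (Finset ℕ)) : Prop :=
  (∀ b ∈ P, b ⊆ Y) ∧ ∀ y ∈ Y, ∃! b, b ∈ P ∧ y ∈ b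

/-- A block collection `B` on point set `Y` is resolvable if it can be partitioned
into parallel classes of `Y`. -/
def Resolvable (Y : Finset ℕ) (B : Finset (Finset ℕ)) : Prop :=
  ∃ (r : ℕ) (P : Fin r → Finset (Finset ℕ)),
    (∀ i, IsParallelClass Y (P i)) ∧ (∀ i, P i ⊆ B) ∧ ∀ b ∈ B, ∃! i, b ∈ P i

/-- The blocks of the derived design at a point `x`:
`{B \ {x} : x ∈ B, B ∈ B}`. -/
def derivedBlocks (B : Finset (Finset ℕ)) (x : ℕ) : Finset (Finset ℕ) :=
  (B.filter fun b => x ∈ b).image fun b => b.erase x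

/-- A Steiner system S(t, k, v) on point set `X` with block collection `B`. -/
def IsSteiner (t k v : ℕ) (X : Finset ℕ) (B : Finset (Finset ℕ)) : Prop :=
  X.card = v ∧ (∀ b ∈ B, b ⊆ X ∧ b.card = k) ∧
  ∀ T ⊆ X, T.card = t → ∃! b, b ∈ B ∧ T ⊆ b

/-- An RDS(t, k, v): a Steiner system S(t, k, v) whose derived design at every
point is resolvable. -/
def IsRDS (t k v : ℕ) (X : Finset ℕ) (B : Finset (Finset ℕ)) : Prop :=
  IsSteiner t k v X B ∧ ∀ x ∈ X, Resolvable (X.erase x) (derivedBlocks B x)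

/-- Existence of an RDS(t, k, v). -/
def ExistsRDS (t k v : ℕ) : Prop := ∃ X B, IsRDS t k v X B

/-- Existence of an RDSQS(v), i.e. an RDS(3, 4, v). -/
def ExistsRDSQS (v : ℕ) : Prop := ExistsRDS 3 4 v

/-- A Kirkman triple system KTS(v): a resolvable Steiner triple system. -/
def IsKTS (v : ℕ) (X : Finset ℕ) (B : Finset (Finset ℕ)) : Prop :=
  IsSteiner 2 3 v X B ∧ Resolvable X B

/-- Existence of a large set of Kirkman triple systems LKTS(v): a partition of
all 3-element subsets of a v-element set into v - 2 classes, each a KTS(v). -/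
def ExistsLKTS (v : ℕ) : Prop :=
  ∃ (X : Finset ℕ) (C : Fin (v - 2) → Finset (Finset ℕ)),
    X.card = v ∧ (∀ i, IsKTS v X (C i)) ∧
    (∀ T : Finset ℕ, (T ⊆ X ∧ T.card = 3) ↔ ∃ i, T ∈ C i) ∧
    ∀ (T : Finset ℕ) (i j : Fin (v - 2)), T ∈ C i → T ∈ C j → i = j

/-- A t-wise balanced design S(t, K, v) with block sizes from the set `K`. -/
def IsTBD (t : ℕ) (K : Set ℕ) (v : ℕ) (X : Finset ℕ) (B : Finset (Finset ℕ)) : Prop :=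
  X.card = v ∧ (∀ b ∈ B, b ⊆ X ∧ b.card ∈ K) ∧
  ∀ T ⊆ X, T.card = t → ∃! b, b ∈ B ∧ T ⊆ b

/-- A group divisible design GDD(t, K, g*n) of type g^n: `Gs` is a partition of
`X` into `n` groups of size `g`; blocks have sizes in `K`, meet every group in
at most one point, and every t-subset of `X` meeting every group in at most one
point lies in exactly one block. -/
def IsGDD (t : ℕ) (K : Set ℕ) (g n : ℕ) (X : Finset ℕ)
    (Gs Bs : Finset (Finset ℕ)) : Prop :=
  X.card = g * n ∧ Gs.card = n ∧
  (∀ G ∈ Gs, G ⊆ X ∧ G.card = g) ∧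
  (∀ x ∈ X, ∃! G, G ∈ Gs ∧ x ∈ G) ∧
  (∀ b ∈ Bs, b ⊆ X ∧ b.card ∈ K) ∧
  (∀ b ∈ Bs, ∀ G ∈ Gs, (b ∩ G).card ≤ 1) ∧
  ∀ T ⊆ X, T.card = t → (∀ G ∈ Gs, (T ∩ G).card ≤ 1) → ∃! b, b ∈ Bs ∧ T ⊆ b

/-- An RDGDD(t, K, g*n) of type g^n: a GDD whose derived design at every point
(on point set `X \ G`, where `G` is the group of the point) is resolvable. -/
def IsRDGDD (t : ℕ) (K : Set ℕ) (g n : ℕ) (X : Finset ℕ)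
    (Gs Bs : Finset (Finset ℕ)) : Prop :=
  IsGDD t K g n X Gs Bs ∧
  ∀ x ∈ X, ∀ G ∈ Gs, x ∈ G → Resolvable (X \ G) (derivedBlocks Bs x)

/-- An RDSQS*(v): an SQS(v) with v ≡ 1 (mod 3) such that, for every point `x`,
the derived blocks at `x` contain a parallel class `P'` (enumerated by `Bk`);
the multiset consisting of each triple of `P'` three times and each remaining
derived triple twice can be partitioned into (v-1) parallel classes
`P k l` (k ranging over Fin ((v-1)/3), l over Fin 3); and for each `k` the three
parallel classes `P k l` share the common triple `Bk k`. -/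
def IsRDSQSstar (v : ℕ) (X : Finset ℕ) (B : Finset (Finset ℕ)) : Prop :=
  IsSteiner 3 4 v X B ∧ v % 3 = 1 ∧
  ∀ x ∈ X, ∃ (P' : Finset (Finset ℕ)) (Bk : Fin ((v - 1) / 3) → Finset ℕ)
    (P : Fin ((v - 1) / 3) → Fin 3 → Finset (Finset ℕ)),
    P' ⊆ derivedBlocks B x ∧
    IsParallelClass (X.erase x) P' ∧
    (∀ k, Bk k ∈ P') ∧
    (∀ b ∈ P', ∃ k, Bk k = b) ∧
    Function.Injective Bk ∧
    (∀ k l, IsParallelClass (X.erase x) (P k l)) ∧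
    ((∑ k, ∑ l, (P k l).val) =
        3 • P'.val + 2 • ((derivedBlocks B x) \ P').val) ∧
    ∀ k l, Bk k ∈ P k l

/-- The set L = {4^m·25^n − 1 : m ≥ 1, n ≥ 0} ∪ {4·7^n − 1 : n ≥ 0} ∪
{2q^n + 1 : n ≥ 0, q a prime power, q ≡ 7 (mod 12)}. -/
def Lzhou : Set ℕ :=
  {x | ∃ m n : ℕ, 1 ≤ m ∧ x = 4 ^ m * 25 ^ n - 1} ∪
  {x | ∃ n : ℕ, x = 4 * 7 ^ n - 1} ∪
  {x | ∃ q n : ℕ, IsPrimePow q ∧ q % 12 = 7 ∧ x = 2 * q ^ n + 1}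


theorem count_lemma {α P H : Type*} [DecidableEq P] [Fintype H] (S : Finset α) (p : α → Finset P)
    (Z : Finset P) (f : α → H) (hf : ∀ s ∈ S, ∀ s' ∈ S, f s = f s' → s = s')
    (hp : ∀ s ∈ S, (p s).card ≤ 2) (hZ : Z ⊆ S.biUnion p) (hc : Z.card = 2 * Fintype.card H) :
    (∀ h, ∃ s ∈ S, f s = h) ∧ ∀ s ∈ S, ∀ s' ∈ S, ∀ z ∈ Z, z ∈ p s → z ∈ p s' → s = s' := by
  classical
  have hle : S.card ≤ Fintype.card H := by
    rw [← Finset.card_image_of_injOn (f := f) (s := S) (fun a ha b hb h => hf a ha b hb h)]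
    exact Finset.card_le_univ _
  have h1 : Z.card ≤ 2 * S.card := by
    calc Z.card ≤ (S.biUnion p).card := Finset.card_le_card hZ
      _ ≤ ∑ s ∈ S, (p s).card := Finset.card_biUnion_le
      _ ≤ ∑ s ∈ S, 2 := Finset.sum_le_sum hp
      _ = 2 * S.card := by simp [mul_comm]
  have hS : S.card = Fintype.card H := by omega
  constructor
  · intro h
    have : S.image f = Finset.univ := by
      apply Finset.eq_univ_of_card
      rw [Finset.card_image_of_injOn (fun a ha b hb h => hf a ha b hb h), hS]
    have h2 : h ∈ S.image f := by rw [this]; simp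
    simpa using h2
  · intro s hs s' hs' z hz hzs hzs'
    by_contra hne
    have hsub : Z ⊆ (S.erase s).biUnion p ∪ (p s).erase z := by
      intro y hy
      obtain ⟨t, ht, hyt⟩ := Finset.mem_biUnion.1 (hZ hy)
      by_cases hts : t = s
      · subst hts
        by_cases hyz : y = z
        · subst hyz
          exact Finset.mem_union_left _ (Finset.mem_biUnion.2 ⟨s', by simp [hs', Ne.symm hne], hzs'⟩)
        · exact Finset.mem_union_right _ (by simp [hyz, hyt])
      · exact Finset.mem_union_left _ (Finset.mem_biUnion.2 ⟨t, by simp [hts, ht], hyt⟩)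
    have h3 : ((S.erase s).biUnion p).card ≤ 2 * (S.card - 1) := by
      calc ((S.erase s).biUnion p).card ≤ ∑ s ∈ S.erase s, (p s).card := Finset.card_biUnion_le
        _ ≤ ∑ t ∈ S.erase s, 2 := Finset.sum_le_sum (fun t ht => hp t (Finset.mem_of_mem_erase ht))
        _ = 2 * (S.card - 1) := by simp [mul_comm, Finset.card_erase_of_mem hs]
    have h4 : ((p s).erase z).card ≤ 1 := by
      rw [Finset.card_erase_of_mem hzs]; have := hp s hs; omega
    have h5 := Finset.card_le_card hsub
    have h6 := Finset.card_union_le ((S.erase s).biUnion p) ((p s).erase z)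
    have : 0 < S.card := Finset.card_pos.2 ⟨s, hs⟩
    omega

/-- Colored SQS. -/
structure RDS (X H : Type) where
  B : Set (Finset X)
  κ : X → Finset X → H
  c4 : ∀ b ∈ B, b.card = 4
  ex : ∀ x y z, x ≠ y → x ≠ z → y ≠ z → ∃ b ∈ B, x ∈ b ∧ y ∈ b ∧ z ∈ b
  un : ∀ x y z, x ≠ y → x ≠ z → y ≠ z → ∀ b ∈ B, ∀ b' ∈ B, x ∈ b → y ∈ b → z ∈ b →
    x ∈ b' → y ∈ b' → z ∈ b' → b = b'
  inj : ∀ b ∈ B, ∀ b' ∈ B, ∀ x y, x ≠ y → x ∈ b → y ∈ b → x ∈ b' → y ∈ b' →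
    κ x b = κ x b' → b = b'
  sur : ∀ x y, x ≠ y → ∀ h, ∃ b ∈ B, x ∈ b ∧ y ∈ b ∧ κ x b = h

theorem RDS.mk' {X H : Type} [Fintype X] [Fintype H] [Nonempty H]
    (hc : Fintype.card X = 2 * Fintype.card H + 2)
    (B : Set (Finset X)) (K : X → H → Finset X → Prop)
    (c4 : ∀ b ∈ B, b.card = 4)
    (ex : ∀ x y z, x ≠ y → x ≠ z → y ≠ z → ∃ b ∈ B, x ∈ b ∧ y ∈ b ∧ z ∈ b)
    (col : ∀ b ∈ B, ∀ x ∈ b, ∃ h, K x h b)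
    (inj : ∀ b ∈ B, ∀ b' ∈ B, ∀ x y h, x ≠ y → x ∈ b → y ∈ b → x ∈ b' → y ∈ b' →
      K x h b → K x h b' → b = b') : ∃ r : RDS X H, r.B = B := by
  classical
  have hX : Nonempty H := inferInstance
  have hκ : ∀ (x : X) (b : Finset X), ∃ h, (b ∈ B → x ∈ b → K x h b) := by
    intro x b
    by_cases hb : b ∈ B ∧ x ∈ b
    · obtain ⟨h, hh⟩ := col b hb.1 x hb.2
      exact ⟨h, fun _ _ => hh⟩
    · exact ⟨hX.some, fun h1 h2 => absurd ⟨h1, h2⟩ hb⟩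
  choose κ hκ using hκ
  have key : ∀ x y, x ≠ y → (∀ h, ∃ b ∈ B, x ∈ b ∧ y ∈ b ∧ κ x b = h) ∧
      ∀ b ∈ B, ∀ b' ∈ B, ∀ z, z ≠ x → z ≠ y → x ∈ b → y ∈ b → z ∈ b →
    x ∈ b' → y ∈ b' → z ∈ b' → b = b' := by
    intro x y hxy
    have := count_lemma (H := H) (Finset.univ.filter (fun b => b ∈ B ∧ x ∈ b ∧ y ∈ b))
      (fun b => (b.erase x).erase y) ((Finset.univ.erase x).erase y) (fun b => κ x b)
      (by
        intro b hb b' hb' h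
        simp only [mem_filter, mem_univ, true_and] at hb hb'
        exact inj b hb.1 b' hb'.1 x y _ hxy hb.2.1 hb.2.2 hb'.2.1 hb'.2.2 (hκ x b hb.1 hb.2.1)
          (h ▸ hκ x b' hb'.1 hb'.2.1))
      (by
        intro b hb
        simp only [mem_filter, mem_univ, true_and] at hb
        rw [Finset.card_erase_of_mem (by simp [hb, hxy.symm]), Finset.card_erase_of_mem hb.2.1, c4 b hb.1])
      (by
        intro z hz
        simp only [mem_erase, mem_univ, and_true] at hz
        obtain ⟨b, hb, h1, h2, h3⟩ := ex x y z hxy (Ne.symm hz.2) (Ne.symm hz.1)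
        simp only [mem_biUnion, mem_filter, mem_univ, true_and, mem_erase]
        exact ⟨b, ⟨hb, h1, h2⟩, hz.1, hz.2, h3⟩)
      (by
        rw [Finset.card_erase_of_mem (by simp [hxy.symm]), Finset.card_erase_of_mem (by simp),
          Finset.card_univ, hc]; omega)
    constructor
    · intro h
      obtain ⟨b, hb, hh⟩ := this.1 h
      simp only [mem_filter, mem_univ, true_and] at hb
      exact ⟨b, hb.1, hb.2.1, hb.2.2, hh⟩
    · intro b hb b' hb' z hzx hzy h1 h2 h3 h4 h5 h6
      exact this.2 b (by simp [*]) b' (by simp [*]) z (by simp [*]) (by simp [*]) (by simp [*])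
  exact ⟨⟨B, κ, c4, ex, fun x y z h1 h2 h3 b hb b' hb' a1 a2 a3 a4 a5 a6 =>
    (key x y h1).2 b hb b' hb' z h2.symm h3.symm a1 a2 a3 a4 a5 a6,
    fun b hb b' hb' x y hxy a1 a2 a3 a4 h => inj b hb b' hb' x y _ hxy a1 a2 a3 a4
      (hκ x b hb a1) (h ▸ hκ x b' hb' a3), fun x y hxy => (key x y hxy).1⟩, rfl⟩

/-- Transport along equivalences. -/
def RDS.tr {X H Y H' : Type} (r : RDS X H) (e : X ≃ Y) (g : H ≃ H') : RDS Y H' where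
  B := {b | b.map e.symm.toEmbedding ∈ r.B}
  κ := fun y b => g (r.κ (e.symm y) (b.map e.symm.toEmbedding))
  c4 := fun b hb => by have := r.c4 _ hb; simpa using this
  ex := fun x y z h1 h2 h3 => by
    obtain ⟨b, hb, h⟩ := r.ex (e.symm x) (e.symm y) (e.symm z) (by simpa) (by simpa) (by simpa)
    refine ⟨b.map e.toEmbedding, ?_, ?_⟩
    · simpa [Finset.map_map] using hb
    · simpa using h
  un := fun x y z h1 h2 h3 b hb b' hb' a1 a2 a3 a4 a5 a6 => by
    have := r.un (e.symm x) (e.symm y) (e.symm z) (by simpa) (by simpa) (by simpa) _ hb _ hb'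
      (by simpa) (by simpa) (by simpa) (by simpa) (by simpa) (by simpa)
    simpa using this
  inj := fun b hb b' hb' x y hxy a1 a2 a3 a4 h => by
    have := r.inj _ hb _ hb' (e.symm x) (e.symm y) (by simpa) (by simpa) (by simpa) (by simpa)
      (by simpa) (g.injective h)
    simpa using this
  sur := fun x y hxy h => by
    obtain ⟨b, hb, h1, h2, h3⟩ := r.sur (e.symm x) (e.symm y) (by simpa) (g.symm h)
    refine ⟨b.map e.toEmbedding, ?_, ?_, ?_, ?_⟩
    · simpa [Finset.map_map] using hb
    · simpa using h1
    · simpa using h2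
    · simp [Finset.map_map, h3]

def HasRD (n : ℕ) : Prop := Nonempty (RDS (Fin (2 * n + 2)) (Fin n))

theorem HasRD.of {X H : Type} [Fintype X] [Fintype H] (r : RDS X H) (n : ℕ)
    (h1 : Fintype.card X = 2 * n + 2) (h2 : Fintype.card H = n) : HasRD n :=
  ⟨r.tr (Fintype.equivFinOfCardEq h1) (Fintype.equivFinOfCardEq h2)⟩

theorem HasRD.get {n : ℕ} (h : HasRD n) (X H : Type) [Fintype X] [Fintype H]
    (h1 : Fintype.card X = 2 * n + 2) (h2 : Fintype.card H = n) : Nonempty (RDS X H) :=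
  h.map fun r => r.tr (Fintype.equivFinOfCardEq h1).symm (Fintype.equivFinOfCardEq h2).symm

theorem exists_of_hasRD {n : ℕ} (h : HasRD n) : ExistsRDSQS (2 * n + 2) := by
  classical
  obtain ⟨r⟩ := h
  let f : Fin (2 * n + 2) ↪ ℕ := Fin.valEmbedding
  refine ⟨Finset.univ.map f, (Finset.univ.filter (· ∈ r.B)).image (fun b => b.map f), ⟨⟨by simp, ?_, ?_⟩, ?_⟩⟩
  · intro b hb
    simp only [mem_image, mem_filter, mem_univ, true_and] at hb
    obtain ⟨c, hc, rfl⟩ := hb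
    exact ⟨Finset.map_subset_map.2 (Finset.subset_univ _), by rw [Finset.card_map]; exact r.c4 c hc⟩
  · intro T hT hT3
    obtain ⟨x, y, z, hxy, hxz, hyz, rfl⟩ := Finset.card_eq_three.1 hT3
    have h1 : x ∈ Finset.univ.map f := hT (by simp)
    have h2 : y ∈ Finset.univ.map f := hT (by simp)
    have h3 : z ∈ Finset.univ.map f := hT (by simp)
    simp only [mem_map, mem_univ, true_and] at h1 h2 h3
    obtain ⟨x, rfl⟩ := h1
    obtain ⟨y, rfl⟩ := h2
    obtain ⟨z, rfl⟩ := h3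
    have e1 : x ≠ y := fun h => hxy (by rw [h])
    have e2 : x ≠ z := fun h => hxz (by rw [h])
    have e3 : y ≠ z := fun h => hyz (by rw [h])
    obtain ⟨b, hb, a1, a2, a3⟩ := r.ex x y z e1 e2 e3
    refine ⟨b.map f, ⟨by simp only [mem_image, mem_filter, mem_univ, true_and]; exact ⟨b, hb, rfl⟩, ?_⟩, ?_⟩
    · intro t ht
      simp only [mem_insert, mem_singleton] at ht
      rcases ht with rfl | rfl | rfl <;> exact Finset.mem_map_of_mem _ ‹_›
    · rintro _ ⟨hb', hs⟩
      simp only [mem_image, mem_filter, mem_univ, true_and] at hb'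
      obtain ⟨b', hb', rfl⟩ := hb'
      have i1 : f x ∈ b'.map f := hs (by simp)
      have i2 : f y ∈ b'.map f := hs (by simp)
      have i3 : f z ∈ b'.map f := hs (by simp)
      rw [Finset.mem_map' f] at i1 i2 i3
      rw [r.un x y z e1 e2 e3 b' hb' b hb i1 i2 i3 a1 a2 a3]
  · intro x hx
    simp only [mem_map, mem_univ, true_and] at hx
    obtain ⟨x, rfl⟩ := hx
    have hder : ∀ t, t ∈ derivedBlocks ((Finset.univ.filter (· ∈ r.B)).image (fun b => b.map f)) (f x) ↔
        ∃ b ∈ r.B, x ∈ b ∧ (b.erase x).map f = t := by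
      intro t
      simp only [derivedBlocks, mem_image, mem_filter, mem_univ, true_and]
      constructor
      · rintro ⟨_, ⟨⟨b, hb, rfl⟩, hxb⟩, rfl⟩
        rw [Finset.mem_map' f] at hxb
        exact ⟨b, hb, hxb, by rw [Finset.map_erase]⟩
      · rintro ⟨b, hb, hxb, rfl⟩
        exact ⟨_, ⟨⟨b, hb, rfl⟩, by rwa [Finset.mem_map' f]⟩, by rw [Finset.map_erase]⟩
    have herase : ∀ b b' : Finset (Fin (2 * n + 2)), x ∈ b → x ∈ b' →
        (b.erase x).map f = (b'.erase x).map f → b = b' := by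
      intro b b' h1 h2 h
      rw [← Finset.insert_erase h1, ← Finset.insert_erase h2, Finset.map_injective f h]
    refine ⟨n, fun h => (Finset.univ.filter (fun b => b ∈ r.B ∧ x ∈ b ∧ r.κ x b = h)).image
      (fun b => (b.erase x).map f), ?_, ?_, ?_⟩
    · intro h
      constructor
      · intro t ht
        simp only [mem_image, mem_filter, mem_univ, true_and] at ht
        obtain ⟨b, hb, rfl⟩ := ht
        rw [← Finset.map_erase]
        exact Finset.map_subset_map.2 (Finset.erase_subset_erase _ (Finset.subset_univ _))
      · intro y hy
        rw [← Finset.map_erase] at hy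
        simp only [mem_map, mem_erase, mem_univ, and_true] at hy
        obtain ⟨y, hyx, rfl⟩ := hy
        obtain ⟨b, hb, h1, h2, h3⟩ := r.sur x y hyx.symm h
        refine ⟨(b.erase x).map f, ⟨?_, ?_⟩, ?_⟩
        · simp only [mem_image, mem_filter, mem_univ, true_and]
          exact ⟨b, ⟨hb, h1, h3⟩, rfl⟩
        · rw [Finset.mem_map' f]; simp [hyx, h2]
        · rintro _ ⟨hb', hy'⟩
          simp only [mem_image, mem_filter, mem_univ, true_and] at hb'
          obtain ⟨b', ⟨hb', hx', hk⟩, rfl⟩ := hb'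
          rw [Finset.mem_map' f] at hy'
          have := r.inj b' hb' b hb x y hyx.symm hx' (Finset.mem_of_mem_erase hy') h1 h2 (by rw [hk, h3])
          rw [this]
    · intro h t ht
      simp only [mem_image, mem_filter, mem_univ, true_and] at ht
      obtain ⟨b, ⟨hb, hx, hk⟩, rfl⟩ := ht
      rw [hder]
      exact ⟨b, hb, hx, rfl⟩
    · intro t ht
      rw [hder] at ht
      obtain ⟨b, hb, hx, rfl⟩ := ht
      refine ⟨r.κ x b, ?_, ?_⟩
      · simp only [mem_image, mem_filter, mem_univ, true_and]
        exact ⟨b, ⟨hb, hx, rfl⟩, rfl⟩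
      · intro h hh
        simp only [mem_image, mem_filter, mem_univ, true_and] at hh
        obtain ⟨b', ⟨hb', hx', rfl⟩, he⟩ := hh
        rw [herase b' b hx' hx he]

theorem LK.mk' {Y C H : Type} [Fintype Y] [Fintype C] [Fintype H] [Nonempty H]
    (hH : Fintype.card Y = 2 * Fintype.card H + 1) (hC : Fintype.card Y = Fintype.card C + 2)
    (T : C → Set (Finset Y)) (K : C → H → Finset Y → Prop)
    (c3 : ∀ c, ∀ b ∈ T c, b.card = 3)
    (ex : ∀ c x y, x ≠ y → ∃ b ∈ T c, x ∈ b ∧ y ∈ b)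
    (ex' : ∀ x y z, x ≠ y → x ≠ z → y ≠ z → ∃ c, ∃ b ∈ T c, x ∈ b ∧ y ∈ b ∧ z ∈ b)
    (col : ∀ c, ∀ b ∈ T c, ∃ h, K c h b)
    (inj : ∀ c, ∀ b ∈ T c, ∀ b' ∈ T c, ∀ y h, y ∈ b → y ∈ b' → K c h b → K c h b' → b = b') :
    ExistsLKTS (Fintype.card Y) := by
  classical
  have hκ : ∀ (c : C) (b : Finset Y), ∃ h, (b ∈ T c → K c h b) := by
    intro c b
    by_cases hb : b ∈ T c
    · obtain ⟨h, hh⟩ := col c b hb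
      exact ⟨h, fun _ => hh⟩
    · exact ⟨Classical.arbitrary H, fun h1 => absurd h1 hb⟩
  choose κ hκ using hκ
  have key : ∀ c y, (∀ h, ∃ b ∈ T c, y ∈ b ∧ κ c b = h) ∧
      ∀ b ∈ T c, ∀ b' ∈ T c, ∀ z, z ≠ y → y ∈ b → z ∈ b → y ∈ b' → z ∈ b' → b = b' := by
    intro c y
    have := count_lemma (H := H) (Finset.univ.filter (fun b => b ∈ T c ∧ y ∈ b))
      (fun b => b.erase y) (Finset.univ.erase y) (fun b => κ c b)
      (by
        intro b hb b' hb' h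
        simp only [mem_filter, mem_univ, true_and] at hb hb'
        exact inj c b hb.1 b' hb'.1 y _ hb.2 hb'.2 (hκ c b hb.1) (h ▸ hκ c b' hb'.1))
      (by
        intro b hb
        simp only [mem_filter, mem_univ, true_and] at hb
        rw [Finset.card_erase_of_mem hb.2, c3 c b hb.1])
      (by
        intro z hz
        simp only [mem_erase, mem_univ, and_true] at hz
        obtain ⟨b, hb, h1, h2⟩ := ex c y z hz.symm
        simp only [mem_biUnion, mem_filter, mem_univ, true_and, mem_erase]
        exact ⟨b, ⟨hb, h1⟩, hz, h2⟩)
      (by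
        rw [Finset.card_erase_of_mem (by simp), Finset.card_univ, hH]; omega)
    constructor
    · intro h
      obtain ⟨b, hb, hh⟩ := this.1 h
      simp only [mem_filter, mem_univ, true_and] at hb
      exact ⟨b, hb.1, hb.2, hh⟩
    · intro b hb b' hb' z hzx h1 h2 h3 h4
      exact this.2 b (by simp [*]) b' (by simp [*]) z (by simp [*]) (by simp [*]) (by simp [*])
  have disj : ∀ c c' b, b ∈ T c → b ∈ T c' → c = c' := by
    intro c c' b hb hb'
    obtain ⟨x, y, z, hxy, hxz, hyz, rfl⟩ := Finset.card_eq_three.1 (c3 c b hb)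
    have hF : ∀ d : C, ∃ w : {w : Y // w ≠ x ∧ w ≠ y}, ∃ b ∈ T d, x ∈ b ∧ y ∈ b ∧ w.1 ∈ b := by
      intro d
      obtain ⟨b, hb, h1, h2⟩ := ex d x y hxy
      have : ((b.erase x).erase y).Nonempty := by
        rw [← Finset.card_pos, Finset.card_erase_of_mem (by simp [hxy.symm, h2]),
          Finset.card_erase_of_mem h1, c3 d b hb]; omega
      obtain ⟨w, hw⟩ := this
      simp only [mem_erase] at hw
      exact ⟨⟨w, hw.2.1, hw.1⟩, b, hb, h1, h2, hw.2.2⟩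
    choose F hF using hF
    have huniq : ∀ d (w : {w : Y // w ≠ x ∧ w ≠ y}) b, b ∈ T d → x ∈ b → y ∈ b → w.1 ∈ b → F d = w := by
      intro d w b hb h1 h2 h3
      obtain ⟨b', hb', g1, g2, g3⟩ := hF d
      have e := (key d x).2 b hb b' hb' y hxy.symm h1 h2 g1 g2
      subst e
      by_contra hne
      have : ({x, y, (F d).1, w.1} : Finset Y) ⊆ b := by
        intro t ht
        simp only [mem_insert, mem_singleton] at ht
        rcases ht with rfl | rfl | rfl | rfl <;> assumption
      have h4 := Finset.card_le_card this
      rw [c3 d b hb] at h4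
      have hn : (F d).1 ≠ w.1 := fun h => hne (Subtype.ext h)
      have := (F d).2; have := w.2
      rw [Finset.card_insert_of_notMem (by simp; tauto), Finset.card_insert_of_notMem (by simp; tauto),
        Finset.card_pair hn] at h4
      omega
    have hsurj : Function.Surjective F := by
      intro w
      obtain ⟨d, b, hb, h1, h2, h3⟩ := ex' x y w.1 hxy w.2.1.symm w.2.2.symm
      exact ⟨d, huniq d w b hb h1 h2 h3⟩
    have hcard : Fintype.card {w : Y // w ≠ x ∧ w ≠ y} = Fintype.card C := by
      rw [Fintype.card_subtype]
      have : (Finset.univ.filter fun w : Y => w ≠ x ∧ w ≠ y) = (Finset.univ.erase x).erase y := by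
        ext w; simp [and_comm]
      rw [this, Finset.card_erase_of_mem (by simp [hxy.symm]), Finset.card_erase_of_mem (by simp),
        Finset.card_univ]; omega
    have hbij : Function.Injective F :=
      ((Fintype.bijective_iff_surjective_and_card F).2 ⟨hsurj, hcard.symm⟩).1
    apply hbij
    rw [huniq c ⟨z, hxz.symm, hyz.symm⟩ _ hb (by simp) (by simp) (by simp),
      huniq c' ⟨z, hxz.symm, hyz.symm⟩ _ hb' (by simp) (by simp) (by simp)]
  let f : Y ↪ ℕ := (Fintype.equivFin Y).toEmbedding.trans Fin.valEmbedding
  let e : Fin (Fintype.card Y - 2) ≃ C := (finCongr (by omega)).trans (Fintype.equivFin C).symm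
  let n := Fintype.card H
  let g : Fin n ≃ H := (Fintype.equivFin H).symm
  have memC : ∀ c t, t ∈ (Finset.univ.filter (· ∈ T c)).image (fun b => b.map f) ↔
      ∃ b ∈ T c, b.map f = t := by
    intro c t; simp
  refine ⟨Finset.univ.map f, fun i => (Finset.univ.filter (· ∈ T (e i))).image (fun b => b.map f),
    by simp, ?_, ?_, ?_⟩
  · intro i
    refine ⟨⟨by simp, ?_, ?_⟩, ?_⟩
    · intro b hb
      rw [memC] at hb
      obtain ⟨c, hc, rfl⟩ := hb
      exact ⟨Finset.map_subset_map.2 (Finset.subset_univ _), by rw [Finset.card_map]; exact c3 _ c hc⟩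
    · intro S hS hS2
      obtain ⟨x, y, hxy, rfl⟩ := Finset.card_eq_two.1 hS2
      have h1 : x ∈ Finset.univ.map f := hS (by simp)
      have h2 : y ∈ Finset.univ.map f := hS (by simp)
      simp only [mem_map, mem_univ, true_and] at h1 h2
      obtain ⟨x, rfl⟩ := h1
      obtain ⟨y, rfl⟩ := h2
      have e1 : x ≠ y := fun h => hxy (by rw [h])
      obtain ⟨b, hb, a1, a2⟩ := ex (e i) x y e1
      refine ⟨b.map f, ⟨(memC _ _).2 ⟨b, hb, rfl⟩, ?_⟩, ?_⟩
      · intro t ht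
        simp only [mem_insert, mem_singleton] at ht
        rcases ht with rfl | rfl <;> exact Finset.mem_map_of_mem _ ‹_›
      · rintro _ ⟨hb0, hs⟩
        obtain ⟨b', hb', rfl⟩ := (memC _ _).1 hb0
        have i1 : f x ∈ b'.map f := hs (by simp)
        have i2 : f y ∈ b'.map f := hs (by simp)
        rw [Finset.mem_map' f] at i1 i2
        rw [(key (e i) x).2 b' hb' b hb y e1.symm i1 i2 a1 a2]
    · refine ⟨n, fun h => (Finset.univ.filter (fun b => b ∈ T (e i) ∧ κ (e i) b = g h)).image
        (fun b => b.map f), ?_, ?_, ?_⟩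
      · intro h
        constructor
        · intro t ht
          simp only [mem_image, mem_filter, mem_univ, true_and] at ht
          obtain ⟨b, hb, rfl⟩ := ht
          exact Finset.map_subset_map.2 (Finset.subset_univ _)
        · intro y hy
          simp only [mem_map, mem_univ, true_and] at hy
          obtain ⟨y, rfl⟩ := hy
          obtain ⟨b, hb, h1, h2⟩ := (key (e i) y).1 (g h)
          refine ⟨b.map f, ⟨?_, Finset.mem_map_of_mem _ h1⟩, ?_⟩
          · simp only [mem_image, mem_filter, mem_univ, true_and]
            exact ⟨b, ⟨hb, h2⟩, rfl⟩
          · rintro _ ⟨hb', hy'⟩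
            simp only [mem_image, mem_filter, mem_univ, true_and] at hb'
            obtain ⟨b', ⟨hb', hk⟩, rfl⟩ := hb'
            rw [Finset.mem_map' f] at hy'
            rw [inj (e i) b' hb' b hb y (g h) hy' h1 (hk ▸ hκ _ _ hb') (h2 ▸ hκ _ _ hb)]
      · intro h t ht
        simp only [mem_image, mem_filter, mem_univ, true_and] at ht
        obtain ⟨b, ⟨hb, hk⟩, rfl⟩ := ht
        exact (memC _ _).2 ⟨b, hb, rfl⟩
      · intro t ht
        obtain ⟨b, hb, rfl⟩ := (memC _ _).1 ht
        refine ⟨g.symm (κ (e i) b), ?_, ?_⟩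
        · simp only [mem_image, mem_filter, mem_univ, true_and]
          exact ⟨b, ⟨hb, by simp⟩, rfl⟩
        · intro h hh
          simp only [mem_image, mem_filter, mem_univ, true_and] at hh
          obtain ⟨b', ⟨hb', hk⟩, he⟩ := hh
          rw [Finset.map_injective f he] at hk
          rw [hk]; simp
  · intro S
    constructor
    · rintro ⟨hS, h3⟩
      obtain ⟨x, y, z, hxy, hxz, hyz, rfl⟩ := Finset.card_eq_three.1 h3
      have h1 : x ∈ Finset.univ.map f := hS (by simp)
      have h2 : y ∈ Finset.univ.map f := hS (by simp)
      have h4 : z ∈ Finset.univ.map f := hS (by simp)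
      simp only [mem_map, mem_univ, true_and] at h1 h2 h4
      obtain ⟨x, rfl⟩ := h1
      obtain ⟨y, rfl⟩ := h2
      obtain ⟨z, rfl⟩ := h4
      have e1 : x ≠ y := fun h => hxy (by rw [h])
      have e2 : x ≠ z := fun h => hxz (by rw [h])
      have e3 : y ≠ z := fun h => hyz (by rw [h])
      obtain ⟨c, b, hb, a1, a2, a3⟩ := ex' x y z e1 e2 e3
      refine ⟨e.symm c, (memC _ _).2 ⟨b, by simpa using hb, ?_⟩⟩
      symm
      apply Finset.eq_of_subset_of_card_le
      · intro t ht
        simp only [mem_insert, mem_singleton] at ht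
        rcases ht with rfl | rfl | rfl <;> exact Finset.mem_map_of_mem _ ‹_›
      · rw [Finset.card_map, c3 c b hb]
        rw [Finset.card_eq_three.2 ⟨_, _, _, hxy, hxz, hyz, rfl⟩]
    · rintro ⟨i, hi⟩
      obtain ⟨b, hb, rfl⟩ := (memC _ _).1 hi
      exact ⟨Finset.map_subset_map.2 (Finset.subset_univ _), by rw [Finset.card_map]; exact c3 _ b hb⟩
  · intro S i j hi hj
    obtain ⟨b, hb, rfl⟩ := (memC _ _).1 hi
    obtain ⟨b', hb', he⟩ := (memC _ _).1 hj
    rw [Finset.map_injective f he] at hb'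
    exact e.injective (disj _ _ b hb hb')

section S5a
def DT : List (List ℕ) := [[2241,5711,3994,4115,2398,5865,5986,4269,2555],
  [2242,5709,3995,4113,2399,5866,5987,4270,2553],
  [2243,5710,3993,4114,2397,5867,5985,4271,2554],
  [1809,5279,3562,3683,1966,5433,5554,3837,2123],
  [1810,5277,3563,3681,1967,5434,5555,3838,2121],
  [1811,5278,3561,3682,1965,5435,5553,3839,2122],
  [1773,5243,3526,3647,1930,5397,5518,3801,2087],
  [1774,5241,3527,3645,1931,5398,5519,3802,2085],
  [1775,5242,3525,3646,1929,5399,5517,3803,2086],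
  [1770,5240,3523,3644,1927,5394,5515,3798,2084],
  [1771,5238,3524,3642,1928,5395,5516,3799,2082],
  [1772,5239,3522,3643,1926,5396,5514,3800,2083],
  [3970,2255,5372,1926,5854,4139,5987,3667,2554],
  [2243,5227,3994,5842,4127,1784,3522,2542,6011],
  [2058,3982,5723,4115,5527,2410,5986,2543,3812],
  [1810,3511,5291,3683,5422,1928,5526,2111,3850],
  [1770,5279,3562,5410,3643,1979,3827,2110,5516],
  [5267,1822,3524,1938,3695,5434,3826,5539,2123],
  [5230,1787,3523,3647,5383,1942,2059,3802,5543],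
  [5231,3510,1798,1914,5386,3671,3790,2075,5538],
  [5228,1786,3527,3646,5387,1940,2063,3800,5542],
  [],
  [],
  [],
  [5721,5238,2397,4257,5539,3784,1769,644,511,2096,3548],
  [3981,2060,2385,1939,6009,5368,498,3797,5551,3680,668],
  [2241,5228,5382,4137,5997,487,3641,1781,3535,800,1964],
  [1771,3561,5421,1940,2097,18,5213,3627,4255,5696,380],
  [3549,1953,3656,3810,5577,5201,1756,175,5839,80,2540],
  [5265,1783,1977,2058,3837,3471,32,5356,223,4112,5708],
  [1785,3522,3645,3800,5541,5204,27,1902,5670,2228,197],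
  [5229,3524,3643,1941,3801,16,1759,5360,2216,329,5827],
  [1797,1914,3657,5517,2071,5203,3486,173,40,3955,5826],
  [14,485,956,1770,5240,3523,3644,1927,5394,5515,3798,2084],
  [],
  [],
  [68,367,184,1771,1901,2384,3954,3484,3692,5516,5202,5827],
  [212,330,55,1900,2227,1808,3485,3679,3944,5564,5826,5199],
  [185,30,668,2083,1772,1926,3784,3475,4256,5237,5360,5695],
  [40,812,174,2240,1925,1759,4111,3476,3785,5371,5250,5528],
  [32,486,211,1744,2252,2082,3535,3627,4100,5408,5225,5527],
  [54,500,175,1755,2527,1928,3943,3824,3473,5370,5525,5276],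
  [],
  [],
  [],
  [14,485,956,1770,5240,3523,3644,1927,5394,5515,3798,2084],
  [],
  []]

abbrev Ent := ℕ × ℕ × ℕ × ℕ
def Ddec (n : ℕ) : Ent := (n / 144 % 12, n / 12 % 12, n % 12, n / 1728)
def Dk (k : ℕ) : List Ent := (DT.getD k []).map Ddec
def Dx (ty x i : ℕ) : List Ent := Dk (12 * ty + 3 * x + i)
def inE (p : ℕ) (d : Ent) : Prop := p = d.1 ∨ p = d.2.1 ∨ p = d.2.2.1
instance (p : ℕ) (d : Ent) : Decidable (inE p d) := by unfold inE; infer_instance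
def cov (l : List Ent) (p q : ℕ) : Prop := ∃ d ∈ l, inE p d ∧ inE q d
def cov3 (l : List Ent) (p q r : ℕ) : Prop := ∃ d ∈ l, inE p d ∧ inE q d ∧ inE r d
instance (l p q) : Decidable (cov l p q) := by unfold cov; infer_instance
instance (l p q r) : Decidable (cov3 l p q r) := by unfold cov3; infer_instance
def pts (d : Ent) : List ℕ := [d.1, d.2.1, d.2.2.1]
set_option synthInstance.maxHeartbeats 400000
set_option synthInstance.maxSize 20000
set_option maxSynthPendingDepth 10

theorem L1 : ∀ ty < 4, ∀ x < 4, ∀ i < 3, ∀ d ∈ Dx ty x i,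
    (∀ p ∈ pts d, p < 12 ∧ (ty = 0 → p / 3 ≠ x) ∧ (ty = 3 → p / 3 ≠ 3) ∧ (x = 3 → p / 3 ≠ 3)) ∧
    d.1 ≠ d.2.1 ∧ d.1 ≠ d.2.2.1 ∧ d.2.1 ≠ d.2.2.1 ∧ d.2.2.2 < 4 := by decide +kernel
theorem L2 : ∀ ty < 4, ∀ x < 4, ∀ i < 3, ∀ d ∈ Dx ty x i, ∀ d' ∈ Dx ty x i, d.2.2.2 = d'.2.2.2 →
    (∃ p ∈ pts d, p ∈ pts d') → d = d' := by decide +kernel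
theorem L3 : ∀ x < 3, ∀ x' < 3, ∀ i < 3, ∀ d ∈ Dx 1 x i, ∀ d' ∈ Dx 2 x' i, d.2.2.2 = d'.2.2.2 →
    d.2.2.2 ≠ 0 ∧ ∀ p ∈ pts d, ∀ q ∈ pts d', p % 3 = q % 3 →
      ¬ ((p / 3 = x ∧ q / 3 = x') ∨ (p / 3 = 3 ∧ q / 3 = 3)) := by decide +kernel
theorem L4 : ∀ ty < 3, ∀ x < 4, ∀ i < 3, 0 < ty → x ≠ 3 → ∀ d ∈ Dx ty x i, d.2.2.2 = 0 →
    ∀ p ∈ pts d, p / 3 ≠ x ∧ p / 3 ≠ 3 := by decide +kernel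
theorem L5 : ∀ x < 4, ∀ i < 3, ∀ d ∈ Dx 0 x i, d.2.2.2 ≠ 0 := by decide +kernel
theorem L6 : ∀ ty < 4, 2 ≤ ty → ∀ d ∈ Dx ty 3 0, d.2.2.2 = 0 → ∃ m < 3, d = (3 * m, 3 * m + 1, 3 * m + 2, 0) := by
  decide +kernel
theorem E1 : ∀ ty < 3, ∀ x < 4, ∀ y < 4, ∀ z < 4, ((ty = 0 ∨ (x < 3 ∧ y < 3 ∧ z < 3)) ∧ x ≠ y ∧ x ≠ z ∧ y ≠ z) →
    ∀ i < 3, ∀ j < 3, ∀ k < 3, cov (Dx ty x i) (3 * y + j) (3 * z + k) := by decide +kernel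
theorem E2a : ∀ i < 3, ∀ j < 3, ∀ k < 3, 
    (∀ x < 3, ∀ y < 3, x ≠ y → cov (Dx 1 x i) (3 * x + j) (3 * y + k)) ∨
    (∀ x < 3, ∀ y < 3, x ≠ y → cov (Dx 2 x i) (3 * x + j) (3 * y + k)) := by decide +kernel
theorem E2b : ∀ i < 3, ∀ j < 3, ∀ k < 3, 
    (∀ x < 3, ∀ y < 3, x ≠ y → cov (Dx 1 x i) (9 + j) (3 * y + k)) ∨
    (∀ x < 3, ∀ y < 3, x ≠ y → cov (Dx 2 x i) (9 + j) (3 * y + k)) := by decide +kernel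
theorem E2c : ∀ i < 3, ∀ j < 3, ∀ k < 3, j ≠ k →
    (∀ x < 3, ∀ y < 3, x ≠ y → cov (Dx 1 x i) (3 * y + j) (3 * y + k)) ∨
    (∀ x < 3, ∀ y < 3, x ≠ y → cov (Dx 2 x i) (3 * y + j) (3 * y + k)) := by decide +kernel
theorem E3 : ∀ x < 2, ∀ i < 3, ∀ p < 9, ∀ q < 9, p ≠ q → cov (Dx 3 x i) p q := by decide +kernel
theorem E4 : ∀ ty < 4, 2 ≤ ty → ∀ p < 9, ∀ q < 9, p ≠ q → cov (Dx ty 3 0) p q := by decide +kernel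
theorem E5 : ∀ ty < 3, 0 < ty → ∀ j < 3, ∀ k < 3, ∀ l < 3, (∃ x < 3, ∃ i < 3, cov3 (Dx ty x i) j (3 + k) (6 + l)) ∨
    (ty = 2 ∧ cov3 (Dx ty 3 0) j (3 + k) (6 + l)) := by decide +kernel
theorem E6a : ∀ j < 3, ∀ k < 3, ∀ l < 3,
    (∀ y < 3, ∀ z < 3, y ≠ z → ∃ x < 3, ∃ i < 3, cov3 (Dx 1 x i) (3 * y + j) (3 * z + k) (9 + l)) ∨
    (∀ y < 3, ∀ z < 3, y ≠ z → ∃ x < 3, ∃ i < 3, cov3 (Dx 2 x i) (3 * y + j) (3 * z + k) (9 + l)) := by decide +kernel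
theorem E6b : ∀ j < 3, ∀ k < 3, ∀ l < 3, j ≠ k →
    (∀ y < 3, ∀ z < 3, y ≠ z → ∃ x < 3, ∃ i < 3, cov3 (Dx 1 x i) (3 * y + j) (3 * y + k) (3 * z + l)) ∨
    (∀ y < 3, ∀ z < 3, y ≠ z → ∃ x < 3, ∃ i < 3, cov3 (Dx 2 x i) (3 * y + j) (3 * y + k) (3 * z + l)) := by decide +kernel
theorem E7 : ∀ p < 9, ∀ q < 9, ∀ r < 9, p ≠ q → p ≠ r → q ≠ r → (∃ x < 2, ∃ i < 3, cov3 (Dx 3 x i) p q r) ∨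
    cov3 (Dx 3 3 0) p q r := by decide +kernel
theorem E8 : ∀ y < 4, ∀ z < 4, ∀ w < 4, (y ≠ z ∧ y ≠ w ∧ z ≠ w) → ∀ j < 3, ∀ k < 3, ∀ l < 3,
    ∃ x < 4, ∃ i < 3, cov3 (Dx 0 x i) (3 * y + j) (3 * z + k) (3 * w + l) := by decide +kernel
theorem E9 : ∀ ty < 4, 2 ≤ ty → ∀ m < 3, cov3 (Dx ty 3 0) (3 * m) (3 * m + 1) (3 * m + 2) := by decide +kernel

end S5a

section LK
variable {A : Type}

abbrev XX (A : Type) := Option (Option A)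
abbrev i1 : XX A := some none
abbrev i2 : XX A := none
abbrev rh (x : XX A) : Option A := x.join

open Classical in
noncomputable def tyb (b : Finset (XX A)) : ℕ := (if i1 ∈ b then 1 else 0) + (if i2 ∈ b then 2 else 0)

/-- charts -/
structure Chart (b : Finset (XX A)) (e : ℕ → XX A) : Prop where
  inj : ∀ m < 4, ∀ n < 4, e m = e n → m = n
  mem : ∀ x, x ∈ b ↔ ∃ m < 4, e m = x
  h2 : i2 ∈ b → e 3 = i2
  h1 : i1 ∈ b → i2 ∉ b → e 3 = i1
  h12 : i1 ∈ b → i2 ∈ b → e 2 = i1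

def e4 (a b c d : XX A) (n : ℕ) : XX A := if n = 0 then a else if n = 1 then b else if n = 2 then c else d

theorem Chart.of4 (p q r s : XX A) (h : p ≠ q ∧ p ≠ r ∧ p ≠ s ∧ q ≠ r ∧ q ≠ s ∧ r ≠ s)
    (b : Finset (XX A)) (hb : ∀ x, x ∈ b ↔ x = p ∨ x = q ∨ x = r ∨ x = s)
    (h2 : i2 ∈ b → s = i2) (h1 : i1 ∈ b → i2 ∉ b → s = i1) (h12 : i1 ∈ b → i2 ∈ b → r = i1) :
    Chart b (e4 p q r s) := by
  obtain ⟨a1, a2, a3, a4, a5, a6⟩ := h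
  constructor
  · intro m hm n hn he
    interval_cases m <;> interval_cases n <;> simp_all [e4]
  · intro x
    rw [hb]
    constructor
    · rintro (rfl | rfl | rfl | rfl)
      exacts [⟨0, by simp [e4]⟩, ⟨1, by simp [e4]⟩, ⟨2, by simp [e4]⟩, ⟨3, by simp [e4]⟩]
    · rintro ⟨m, hm, rfl⟩
      interval_cases m <;> simp [e4]
  · intro h; simpa [e4] using h2 h
  · intro h h'; simpa [e4] using h1 h h'
  · intro h h'; simpa [e4] using h12 h h'

theorem Chart.exists (b : Finset (XX A)) (hb : b.card = 4) : ∃ e, Chart b e := by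
  classical
  have gen : ∀ s ∈ b, (i2 ∈ b → s = i2) → (i1 ∈ b → i2 ∉ b → s = i1) → ¬ (i1 ∈ b ∧ i2 ∈ b) → ∃ e, Chart b e := by
    intro s hs h2 h1 h12
    have : (b.erase s).card = 3 := by rw [Finset.card_erase_of_mem hs, hb]
    obtain ⟨p, q, r, a1, a2, a3, he⟩ := Finset.card_eq_three.1 this
    have hm : ∀ x, x ∈ b ↔ x = p ∨ x = q ∨ x = r ∨ x = s := by
      intro x
      rw [← Finset.insert_erase hs, he]; simp; tauto
    have hne : ∀ x, x = p ∨ x = q ∨ x = r → x ≠ s := by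
      intro x hx
      have : x ∈ b.erase s := by rw [he]; simpa using hx
      exact Finset.ne_of_mem_erase this
    exact ⟨_, Chart.of4 p q r s ⟨a1, a2, hne p (by simp), a3, hne q (by simp), hne r (by simp)⟩ b hm h2 h1
      (fun h h' => absurd ⟨h, h'⟩ h12)⟩
  by_cases h2 : i2 ∈ b
  · by_cases h1 : i1 ∈ b
    · have h12 : (i1 : XX A) ∈ b.erase i2 := by simp [h1]
      have : ((b.erase i2).erase i1).card = 2 := by
        rw [Finset.card_erase_of_mem h12, Finset.card_erase_of_mem h2, hb]
      obtain ⟨p, q, a1, he⟩ := Finset.card_eq_two.1 this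
      have hm : ∀ x, x ∈ b ↔ x = p ∨ x = q ∨ x = i1 ∨ x = i2 := by
        intro x
        rw [← Finset.insert_erase h2, ← Finset.insert_erase h12, he]; simp; tauto
      have hne : ∀ x, x = p ∨ x = q → x ≠ i1 ∧ x ≠ i2 := by
        intro x hx
        have : x ∈ (b.erase i2).erase i1 := by rw [he]; simpa using hx
        simp only [mem_erase] at this
        exact ⟨this.1, this.2.1⟩
      exact ⟨_, Chart.of4 p q i1 i2 ⟨a1, (hne p (by simp)).1, (hne p (by simp)).2, (hne q (by simp)).1,
        (hne q (by simp)).2, by simp⟩ b hm (fun _ => rfl) (fun _ h => absurd h2 h) (fun _ _ => rfl)⟩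
    · exact gen i2 h2 (fun _ => rfl) (fun h => absurd h h1) (fun h => h1 h.1)
  · by_cases h1 : i1 ∈ b
    · exact gen i1 h1 (fun h => absurd h h2) (fun _ _ => rfl) (fun h => h2 h.2)
    · have : b.Nonempty := by rw [← Finset.card_pos, hb]; omega
      obtain ⟨s, hs⟩ := this
      exact gen s hs (fun h => absurd h h2) (fun h => absurd h h1) (fun h => h1 h.1)

def ph (e : ℕ → XX A) (p : ℕ) : Option A × Fin 3 := (rh (e (p / 3)), Fin.ofNat 3 p)

theorem ph_eq (e : ℕ → XX A) (m : ℕ) (j : Fin 3) : ph e (3 * m + j) = (rh (e m), j) := by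
  have : (3 * m + (j : ℕ)) / 3 = m := by omega
  simp only [ph, this]
  congr 1
  ext; simp

theorem rh_inj (x y : XX A) (h : rh x = rh y) : x = y ∨ (rh x = none ∧ (x = i1 ∧ y = i2 ∨ x = i2 ∧ y = i1)) := by
  rcases x with _ | _ | x <;> rcases y with _ | _ | y <;> simp_all [i1, i2]

variable {b : Finset (XX A)} {e : ℕ → XX A}

theorem ph_inj (hc : Chart b e) (p q : ℕ) (hp : p < 12) (hq : q < 12)
    (h3 : i1 ∈ b → i2 ∈ b → p / 3 ≠ 3 ∧ q / 3 ≠ 3) (h : ph e p = ph e q) : p = q := by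
  have h1 : rh (e (p/3)) = rh (e (q/3)) := congrArg Prod.fst h
  have h2 : p % 3 = q % 3 := by simpa [ph] using congrArg (fun x => (x.2 : ℕ)) h
  have hpb : e (p/3) ∈ b := (hc.mem _).2 ⟨_, by omega, rfl⟩
  have hqb : e (q/3) ∈ b := (hc.mem _).2 ⟨_, by omega, rfl⟩
  have h4 : p / 3 = q / 3 := by
    apply hc.inj _ (by omega) _ (by omega)
    rcases rh_inj _ _ h1 with h | ⟨-, ⟨a, a'⟩ | ⟨a, a'⟩⟩
    · exact h
    · rw [a] at hpb; rw [a'] at hqb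
      have := hc.inj (q/3) (by omega) 3 (by omega) (by rw [a', hc.h2 hqb])
      exact absurd this (h3 hpb hqb).2
    · rw [a] at hpb; rw [a'] at hqb
      have := hc.inj (p/3) (by omega) 3 (by omega) (by rw [a, hc.h2 hpb])
      exact absurd this (h3 hqb hpb).1
  omega

theorem tyb_cases (b : Finset (XX A)) : (tyb b = 0 ∧ i1 ∉ b ∧ i2 ∉ b) ∨ (tyb b = 1 ∧ i1 ∈ b ∧ i2 ∉ b) ∨
    (tyb b = 2 ∧ i1 ∉ b ∧ i2 ∈ b) ∨ (tyb b = 3 ∧ i1 ∈ b ∧ i2 ∈ b) := by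
  by_cases h1 : (i1 : XX A) ∈ b <;> by_cases h2 : (i2 : XX A) ∈ b <;> simp [tyb, h1, h2]

def cb : Option (A × Fin 3) → XX A
  | none => none
  | some (a, _) => some (some a)
def ci : Option (A × Fin 3) → ℕ
  | none => 0
  | some (_, i) => i
theorem ci_lt (c : Option (A × Fin 3)) : ci c < 3 := by rcases c with _ | ⟨a, i⟩ <;> simp [ci]

def clr {H : Type} (h : H) (c : ℕ) : Option (H × Fin 3) := if c = 0 then none else some (h, Fin.ofNat 3 c)
theorem clr_inj {H : Type} {h h' : H} {c c' : ℕ} (hc : c < 4) (hc' : c' < 4) (he : clr h c = clr h' c') :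
    c = c' ∧ (c ≠ 0 → h = h') := by
  unfold clr at he
  split_ifs at he with h1 h2
  · simp_all
  · simp only [Option.some.injEq, Prod.mk.injEq] at he
    refine ⟨?_, fun _ => he.1⟩
    have := congrArg Fin.val he.2
    simp at this
    omega

open Classical in
noncomputable def tri (e : ℕ → XX A) (d : Ent) : Finset (Option A × Fin 3) := {ph e d.1, ph e d.2.1, ph e d.2.2.1}

theorem mem_tri (e : ℕ → XX A) (d : Ent) (y) : y ∈ tri e d ↔ ∃ p ∈ pts d, y = ph e p := by
  simp [tri, pts]

theorem inE_pts {p d} (h : inE p d) : p ∈ pts d := by simpa [inE, pts] using h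

theorem in_tri_cov {l p q} (e : ℕ → XX A) (h : cov l p q) : ∃ d ∈ l, ph e p ∈ tri e d ∧ ph e q ∈ tri e d := by
  obtain ⟨d, hd, h1, h2⟩ := h
  exact ⟨d, hd, (mem_tri _ _ _).2 ⟨p, inE_pts h1, rfl⟩, (mem_tri _ _ _).2 ⟨q, inE_pts h2, rfl⟩⟩
theorem in_tri_cov3 {l p q r} (e : ℕ → XX A) (h : cov3 l p q r) : ∃ d ∈ l, ph e p ∈ tri e d ∧ ph e q ∈ tri e d ∧
    ph e r ∈ tri e d := by
  obtain ⟨d, hd, h1, h2, h3⟩ := h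
  exact ⟨d, hd, (mem_tri _ _ _).2 ⟨p, inE_pts h1, rfl⟩, (mem_tri _ _ _).2 ⟨q, inE_pts h2, rfl⟩,
    (mem_tri _ _ _).2 ⟨r, inE_pts h3, rfl⟩⟩
end LK

section LK2
variable {A H : Type} (r : RDS (XX A) H) (E : Finset (XX A) → ℕ → XX A)

def entr (c : Option (A × Fin 3)) (b : Finset (XX A)) (x : ℕ) (d : Ent) : Prop :=
  b ∈ r.B ∧ x < 4 ∧ E b x = cb c ∧ d ∈ Dx (tyb b) x (ci c)

variable {r E} (hE : ∀ b ∈ r.B, Chart b (E b))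

theorem tyb_iff (b : Finset (XX A)) : (i1 ∈ b ↔ tyb b % 2 = 1) ∧ (i2 ∈ b ↔ 2 ≤ tyb b) := by
  by_cases h1 : (i1 : XX A) ∈ b <;> by_cases h2 : (i2 : XX A) ∈ b <;> simp [tyb, h1, h2]
theorem tyb3 {b : Finset (XX A)} (h1 : i1 ∈ b) (h2 : i2 ∈ b) : tyb b = 3 := by simp [tyb, h1, h2]
theorem tyb_lt' (b : Finset (XX A)) : tyb b < 4 := by
  rcases tyb_cases b with h | h | h | h <;> omega
theorem tyb4 {b b' : Finset (XX A)} (h : tyb b ≠ 0) (h' : tyb b' ≠ 0) : (tyb b = 1 ∧ tyb b' = 2) ∨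
    (tyb b = 2 ∧ tyb b' = 1) ∨ (i1 ∈ b ∧ i1 ∈ b') ∨ (i2 ∈ b ∧ i2 ∈ b') := by
  rw [(tyb_iff b).1, (tyb_iff b).2, (tyb_iff b').1, (tyb_iff b').2]
  have := tyb_lt' b
  have := tyb_lt' b'
  omega
include hE
theorem tyb_lt (b : Finset (XX A)) : tyb b < 4 := by
  rcases tyb_cases b with h | h | h | h <;> omega

theorem E_ne3 {b} (hb : b ∈ r.B) {m : ℕ} (hm : m < 4) {a : A} (h : E b m = some (some a)) (ht : tyb b ≠ 0) : m < 3 := by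
  by_contra hlt
  have : m = 3 := by omega
  subst this
  rcases tyb_cases b with h' | h' | h' | h'
  · omega
  · rw [(hE b hb).h1 h'.2.1 h'.2.2] at h; simp [i1] at h
  · rw [(hE b hb).h2 h'.2.2] at h; simp [i2] at h
  · rw [(hE b hb).h2 h'.2.2] at h; simp [i2] at h

theorem E_lt2 {b} (hb : b ∈ r.B) {m : ℕ} (hm : m < 4) {a : A} (h : E b m = some (some a)) (ht : tyb b = 3) : m < 2 := by
  have h3 := E_ne3 hE hb hm h (by omega)
  by_contra hlt
  have : m = 2 := by omega
  subst this
  rcases tyb_cases b with h' | h' | h' | h' <;> try omega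
  rw [(hE b hb).h12 h'.2.1 h'.2.2] at h; simp [i1] at h

theorem posn {b} (hb : b ∈ r.B) {w : Option A} (h : some w ∈ b) : ∃ m < 4, E b m = some w ∧
    (i2 ∈ b → m < 3) ∧ ∀ j : Fin 3, (w, j) = ph (E b) (3 * m + j) := by
  obtain ⟨m, hm, he⟩ := ((hE b hb).mem _).1 h
  refine ⟨m, hm, he, ?_, ?_⟩
  · intro h2
    by_contra hlt
    have : m = 3 := by omega
    subst this
    rw [(hE b hb).h2 h2] at he; simp [i2] at he
  · intro j; rw [ph_eq, he]; rfl

theorem entr_b {c b x d} (h : entr r E c b x d) : cb c ∈ b := by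
  rw [← h.2.2.1]; exact ((hE b h.1).mem _).2 ⟨x, h.2.1, rfl⟩

theorem entr_inj_same {c b x d x' d'} (h : entr r E c b x d) (h' : entr r E c b x' d') {y}
    (hy : y ∈ tri (E b) d) (hy' : y ∈ tri (E b) d') (hc : d.2.2.2 = d'.2.2.2) : d = d' := by
  have hx : x = x' := (hE b h.1).inj _ h.2.1 _ h'.2.1 (by rw [h.2.2.1, h'.2.2.1])
  subst hx
  obtain ⟨p, hp, rfl⟩ := (mem_tri _ _ _).1 hy
  obtain ⟨q, hq, he⟩ := (mem_tri _ _ _).1 hy'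
  have l1 := (L1 _ (tyb_lt hE b) _ h.2.1 _ (ci_lt c) d h.2.2.2).1 p hp
  have l1' := (L1 _ (tyb_lt hE b) _ h.2.1 _ (ci_lt c) d' h'.2.2.2).1 q hq
  have := ph_inj (hE b h.1) p q l1.1 l1'.1 (fun h1 h2 => by
    rcases tyb_cases b with h' | h' | h' | h'
    · exact absurd h1 h'.2.1
    · exact absurd h2 h'.2.2
    · exact absurd h1 h'.2.1
    · exact ⟨l1.2.2.1 h'.1, l1'.2.2.1 h'.1⟩) he
  subst this
  exact L2 _ (tyb_lt hE b) _ h.2.1 _ (ci_lt c) d h.2.2.2 d' h'.2.2.2 hc ⟨p, hp, hq⟩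

theorem entr_cross {c b x d b' x' d'} (a : A) (hca : cb c = some (some a))
    (h : entr r E c b x d) (h' : entr r E c b' x' d') (hc : d.2.2.2 = d'.2.2.2) (ht : tyb b = 1) (ht' : tyb b' = 2) :
    d.2.2.2 ≠ 0 ∧ ∀ p ∈ pts d, ∀ q ∈ pts d', ph (E b) p = ph (E b') q →
      E b (p / 3) = E b' (q / 3) ∧ E b (p / 3) ≠ cb c := by
  have hx := E_ne3 hE h.1 h.2.1 (h.2.2.1.trans hca) (by omega)
  have hx' := E_ne3 hE h'.1 h'.2.1 (h'.2.2.1.trans hca) (by omega)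
  have l3 := L3 x hx x' hx' _ (ci_lt c) d (ht ▸ h.2.2.2) d' (ht' ▸ h'.2.2.2) hc
  refine ⟨l3.1, fun p hp q hq he => ?_⟩
  have l1 := (L1 _ (tyb_lt hE b) _ h.2.1 _ (ci_lt c) d h.2.2.2).1 p hp
  have l1' := (L1 _ (tyb_lt hE b') _ h'.2.1 _ (ci_lt c) d' h'.2.2.2).1 q hq
  have e1 : rh (E b (p/3)) = rh (E b' (q/3)) := congrArg Prod.fst he
  have e2 : p % 3 = q % 3 := by simpa [ph] using congrArg (fun x => (x.2 : ℕ)) he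
  have l := l3.2 p hp q hq e2
  have hb : E b 3 = i1 := by
    rcases tyb_cases b with h' | h' | h' | h' <;> try omega
    exact (hE b h.1).h1 h'.2.1 h'.2.2
  have hb' : E b' 3 = i2 := by
    rcases tyb_cases b' with h | h | h | h <;> try omega
    exact (hE b' h'.1).h2 h.2.2
  rcases rh_inj _ _ e1 with h0 | ⟨-, ⟨k, k'⟩ | ⟨k, k'⟩⟩
  · refine ⟨h0, fun h1 => l (Or.inl ⟨(hE b h.1).inj _ (by omega) _ h.2.1 (h1.trans h.2.2.1.symm), 
      (hE b' h'.1).inj _ (by omega) _ h'.2.1 ((h0 ▸ h1).trans h'.2.2.1.symm)⟩)⟩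
  · exact absurd (Or.inr ⟨(hE b h.1).inj _ (by omega) _ (by omega) (k.trans hb.symm), 
      (hE b' h'.1).inj _ (by omega) _ (by omega) (k'.trans hb'.symm)⟩) l
  · exfalso
    have : i2 ∈ b := ((hE b h.1).mem _).2 ⟨_, by omega, k⟩
    rcases tyb_cases b with h' | h' | h' | h' <;> first | omega | exact h'.2.2 this

set_option maxHeartbeats 2000000 in
theorem entr_inj {c b x d b' x' d'} (h : entr r E c b x d) (h' : entr r E c b' x' d') {y}
    (hy : y ∈ tri (E b) d) (hy' : y ∈ tri (E b') d')
    (hcl : clr (r.κ (cb c) b) d.2.2.2 = clr (r.κ (cb c) b') d'.2.2.2) : tri (E b) d = tri (E b') d' := by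
  have m1 := L1 _ (tyb_lt hE b) _ h.2.1 _ (ci_lt c) d h.2.2.2
  have m1' := L1 _ (tyb_lt hE b') _ h'.2.1 _ (ci_lt c) d' h'.2.2.2
  obtain ⟨hc, hk⟩ := clr_inj m1.2.2.2.2 m1'.2.2.2.2 hcl
  by_cases hbb : b = b'
  · subst hbb; rw [entr_inj_same hE h h' hy hy' hc]
  obtain ⟨p, hp, rfl⟩ := (mem_tri _ _ _).1 hy
  obtain ⟨q, hq, he⟩ := (mem_tri _ _ _).1 hy'
  have l1 := m1.1 p hp
  have l1' := m1'.1 q hq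
  have e1 : rh (E b (p/3)) = rh (E b' (q/3)) := congrArg Prod.fst he
  have cb1 := entr_b hE h
  have cb2 := entr_b hE h'
  have zb : E b (p/3) ∈ b := ((hE b h.1).mem _).2 ⟨_, by omega, rfl⟩
  have zb' : E b' (q/3) ∈ b' := ((hE b' h'.1).mem _).2 ⟨_, by omega, rfl⟩
  have shr : ∀ w, w ≠ cb c → w ∈ b → w ∈ b' → d.2.2.2 = 0 := by
    intro w hw hb hb'
    by_contra h0
    exact hbb (r.inj b h.1 b' h'.1 _ w (Ne.symm hw) cb1 hb cb2 hb' (hk h0))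
  rcases hcase : c with _ | ⟨a, i⟩
  · -- class none
    have hcc : cb c = i2 := by rw [hcase]; rfl
    have x3 : x = 3 := (hE b h.1).inj _ h.2.1 _ (by omega) (by rw [h.2.2.1, hcc, (hE b h.1).h2 (hcc ▸ cb1)])
    have x3' : x' = 3 := (hE b' h'.1).inj _ h'.2.1 _ (by omega) (by rw [h'.2.2.1, hcc, (hE b' h'.1).h2 (hcc ▸ cb2)])
    subst x3 x3'
    have z2 : E b (p/3) ≠ i2 := by
      rw [← hcc, ← h.2.2.1]; intro h0
      exact l1.2.2.2 rfl ((hE b h.1).inj _ (by omega) _ h.2.1 h0)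
    have z2' : E b' (q/3) ≠ i2 := by
      rw [← hcc, ← h'.2.2.1]; intro h0
      exact l1'.2.2.2 rfl ((hE b' h'.1).inj _ (by omega) _ h'.2.1 h0)
    have zz : E b (p/3) = E b' (q/3) := by
      rcases rh_inj _ _ e1 with h | ⟨-, ⟨a, a'⟩ | ⟨a, a'⟩⟩
      · exact h
      · exact absurd a' z2'
      · exact absurd a z2
    have c0 := shr _ (by rw [hcc]; exact z2) zb (zz ▸ zb')
    have ty2 : 2 ≤ tyb b := by
      rw [hcc] at cb1
      exact (tyb_iff b).2.1 cb1
    have ty2' : 2 ≤ tyb b' := by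
      rw [hcc] at cb2
      exact (tyb_iff b').2.1 cb2
    have hci : ci c = 0 := by rw [hcase]; rfl
    obtain ⟨m, hm, rfl⟩ := L6 _ (tyb_lt hE b) ty2 d (hci ▸ h.2.2.2) c0
    obtain ⟨m', hm', rfl⟩ := L6 _ (tyb_lt hE b') ty2' d' (hci ▸ h'.2.2.2) (hc ▸ c0)
    have hpm : p / 3 = m := by simp [pts] at hp; omega
    have hqm : q / 3 = m' := by simp [pts] at hq; omega
    rw [hpm, hqm] at zz
    have := ph_eq (E b) m 0; have := ph_eq (E b) m 1; have := ph_eq (E b) m 2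
    have := ph_eq (E b') m' 0; have := ph_eq (E b') m' 1; have := ph_eq (E b') m' 2
    simp_all [tri]
  · have hca : cb c = some (some a) := by rw [hcase]; rfl
    exfalso
    have n1 : (i1 : XX A) ≠ cb c := by rw [hca]; simp [i1]
    have n2 : (i2 : XX A) ≠ cb c := by rw [hca]; simp [i2]
    have cr : tyb b = 1 → tyb b' = 2 → False := by
      intro t t'
      have k := entr_cross hE a hca h h' hc t t'
      have := k.2 p hp q hq he
      exact k.1 (shr _ this.2 zb (this.1 ▸ zb'))
    have cr' : tyb b = 2 → tyb b' = 1 → False := by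
      intro t t'
      have k := entr_cross hE a hca h' h hc.symm t' t
      have := k.2 q hq p hp he.symm
      exact k.1 (hc ▸ shr _ (this.1 ▸ this.2) zb (this.1 ▸ zb'))
    have zc : E b (p/3) = cb c → tyb b ≠ 0 := by
      intro h0 h1
      rw [← h.2.2.1] at h0
      exact l1.2.1 h1 ((hE b h.1).inj _ (by omega) _ h.2.1 h0)
    have zc' : E b' (q/3) = cb c → tyb b' ≠ 0 := by
      intro h0 h1
      rw [← h'.2.2.1] at h0
      exact l1'.2.1 h1 ((hE b' h'.1).inj _ (by omega) _ h'.2.1 h0)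
    have zi : ∀ b : Finset (XX A), (i1 ∈ b ∨ i2 ∈ b) → tyb b ≠ 0 := by
      intro b hb h0
      have := tyb_iff b
      rcases hb with hb | hb
      · have := this.1.1 hb; omega
      · have := this.2.1 hb; omega
    -- color zero
    have c0 : d.2.2.2 = 0 := by
      by_contra hne
      have f1 : ¬ (i1 ∈ b ∧ i1 ∈ b') := fun hh => hne (shr _ n1 hh.1 hh.2)
      have f2 : ¬ (i2 ∈ b ∧ i2 ∈ b') := fun hh => hne (shr _ n2 hh.1 hh.2)
      have t12 : tyb b ≠ 0 ∧ tyb b' ≠ 0 := by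
        rcases rh_inj _ _ e1 with h0 | ⟨-, ⟨k, k'⟩ | ⟨k, k'⟩⟩
        · have : E b (p/3) = cb c := by
            by_contra h1; exact hne (shr _ h1 zb (h0 ▸ zb'))
          exact ⟨zc this, zc' (h0 ▸ this)⟩
        · exact ⟨zi _ (by rw [← k]; exact Or.inl zb), zi _ (by rw [← k']; exact Or.inr zb')⟩
        · exact ⟨zi _ (by rw [← k]; exact Or.inr zb), zi _ (by rw [← k']; exact Or.inl zb')⟩
      rcases tyb4 t12.1 t12.2 with t | t | t | t
      · exact cr t.1 t.2
      · exact cr' t.1 t.2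
      · exact f1 t
      · exact f2 t
    have t0 : tyb b ≠ 0 := fun h0 => L5 _ h.2.1 _ (ci_lt c) d (h0 ▸ h.2.2.2) c0
    have t0' : tyb b' ≠ 0 := fun h0 => L5 _ h'.2.1 _ (ci_lt c) d' (h0 ▸ h'.2.2.2) (hc ▸ c0)
    have q3 : ¬ (tyb b = 3 ∧ tyb b' = 3) := by
      rintro ⟨t, t'⟩
      have k := tyb_iff b
      have k' := tyb_iff b'
      exact hbb (r.un (cb c) i1 i2 n1.symm n2.symm (by simp) b h.1 b' h'.1 cb1 (k.1.2 (by rw [t]))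
        (k.2.2 (by rw [t]; simp)) cb2 (k'.1.2 (by rw [t'])) (k'.2.2 (by rw [t']; simp)))
    have ns : ∀ w, w ≠ cb c → w ∈ b → w ∈ b' → ∀ w', w' ≠ cb c → w' ∈ b → w' ∈ b' → w = w' := by
      intro w hw hb hb' w' hw' gb gb'
      by_contra hne
      exact hbb (r.un (cb c) w w' hw.symm hw'.symm hne b h.1 b' h'.1 cb1 hb gb cb2 hb' gb')
    have fin : E b (p/3) = E b' (q/3) → E b (p/3) ≠ cb c → E b (p/3) ≠ i1 → E b (p/3) ≠ i2 → False := by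
      intro zz z0 z1 z2
      have := ns _ z0 zb (zz ▸ zb')
      rcases tyb4 t0 t0' with t | t | t | t
      · exact cr t.1 t.2
      · exact cr' t.1 t.2
      · exact z1 (this _ n1 t.1 t.2)
      · exact z2 (this _ n2 t.1 t.2)
    have lab : ∀ {b x d p}, entr r E c b x d → tyb b ≠ 0 → tyb b ≠ 3 → d.2.2.2 = 0 → p ∈ pts d → p < 12 →
        E b (p/3) ≠ cb c ∧ E b (p/3) ≠ i1 ∧ E b (p/3) ≠ i2 := by
      intro b x d p h t0 t3 c0 hp l1
      have ht := tyb_lt hE b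
      have hx := E_ne3 hE h.1 h.2.1 (h.2.2.1.trans hca) (by omega)
      have l4 := L4 (tyb b) (by omega) x h.2.1 _ (ci_lt c) (by omega) (by omega) d h.2.2.2 c0 p hp
      refine ⟨?_, ?_, ?_⟩
      · rw [← h.2.2.1]; intro h0
        exact l4.1 ((hE b h.1).inj _ (by omega) _ h.2.1 h0)
      · intro h0
        have hi : i1 ∈ b := ((hE b h.1).mem _).2 ⟨_, by omega, h0⟩
        have hi2 : i2 ∉ b := fun hi2 => t3 (tyb3 hi hi2)
        exact l4.2 ((hE b h.1).inj _ (by omega) _ (by omega) (h0.trans ((hE b h.1).h1 hi hi2).symm))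
      · intro h0
        have hi : i2 ∈ b := ((hE b h.1).mem _).2 ⟨_, by omega, h0⟩
        exact l4.2 ((hE b h.1).inj _ (by omega) _ (by omega) (h0.trans ((hE b h.1).h2 hi).symm))
    by_cases t3 : tyb b = 3
    · obtain ⟨g1, g2, g3⟩ := lab h' t0' (fun k => q3 ⟨t3, k⟩) (hc ▸ c0) hq l1'.1
      have zz : E b (p/3) = E b' (q/3) := by
        rcases rh_inj _ _ e1 with h | ⟨-, ⟨k, k'⟩ | ⟨k, k'⟩⟩
        · exact h
        · exact absurd k' g3
        · exact absurd k' g2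
      exact fin zz (zz ▸ g1) (zz ▸ g2) (zz ▸ g3)
    · obtain ⟨g1, g2, g3⟩ := lab h t0 t3 c0 hp l1.1
      have zz : E b (p/3) = E b' (q/3) := by
        rcases rh_inj _ _ e1 with h | ⟨-, ⟨k, k'⟩ | ⟨k, k'⟩⟩
        · exact h
        · exact absurd k g2
        · exact absurd k g3
      exact fin zz g1 g2 g3
end LK2

section LK3
variable {A H : Type} {r : RDS (XX A) H} {E : Finset (XX A) → ℕ → XX A} (hE : ∀ b ∈ r.B, Chart b (E b))
include hE

/-- two points of a class are covered -/
def Cv (r : RDS (XX A) H) (E : Finset (XX A) → ℕ → XX A) (c : Option (A × Fin 3)) (y y' : Option A × Fin 3) : Prop :=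
  ∃ b x d, entr r E c b x d ∧ y ∈ tri (E b) d ∧ y' ∈ tri (E b) d
def Cv3 (r : RDS (XX A) H) (E : Finset (XX A) → ℕ → XX A) (y y' y'' : Option A × Fin 3) : Prop :=
  ∃ c b x d, entr r E c b x d ∧ y ∈ tri (E b) d ∧ y' ∈ tri (E b) d ∧ y'' ∈ tri (E b) d

omit hE in
theorem Cv.symm {c y y'} (h : Cv r E c y y') : Cv r E c y' y := by
  obtain ⟨b, x, d, h1, h2, h3⟩ := h
  exact ⟨b, x, d, h1, h3, h2⟩

omit hE in
theorem Cv.mk {c b x p q} (hb : b ∈ r.B) (hx : x < 4) (hc : E b x = cb c) (h : cov (Dx (tyb b) x (ci c)) p q) :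
    Cv r E c (ph (E b) p) (ph (E b) q) := by
  obtain ⟨d, hd, h⟩ := in_tri_cov (E b) h
  exact ⟨b, x, d, ⟨hb, hx, hc, hd⟩, h⟩
omit hE in
theorem Cv3.mk {c b x p q s} (hb : b ∈ r.B) (hx : x < 4) (hc : E b x = cb c) (h : cov3 (Dx (tyb b) x (ci c)) p q s) :
    Cv3 r E (ph (E b) p) (ph (E b) q) (ph (E b) s) := by
  obtain ⟨d, hd, h⟩ := in_tri_cov3 (E b) h
  exact ⟨c, b, x, d, ⟨hb, hx, hc, hd⟩, h⟩
/-- from a position carrying a genuine point -/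
theorem Cv3.mk' {b x i p q s} (hb : b ∈ r.B) (hx : x < 4) (hi : i < 3) (h1 : E b x ≠ i1) (h2 : E b x ≠ i2)
    (h : cov3 (Dx (tyb b) x i) p q s) :
    Cv3 r E (ph (E b) p) (ph (E b) q) (ph (E b) s) := by
  rcases he : E b x with _ | _ | a
  · exact absurd he h2
  · exact absurd he h1
  · exact Cv3.mk (c := some (a, ⟨i, hi⟩)) hb hx he h

theorem cv_ty3 {a : A} {i : Fin 3} {b} (hb : b ∈ r.B) (h1 : i1 ∈ b) (h2 : i2 ∈ b) (ha : some (some a) ∈ b)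
    {w w' : Option A} {j j' : Fin 3} (hw : some w ∈ b) (hw' : some w' ∈ b) (hne : (w, j) ≠ (w', j')) :
    Cv r E (some (a, i)) (w, j) (w', j') := by
  obtain ⟨x, hx, hxe, -, -⟩ := posn hE hb ha
  obtain ⟨m, hm, hme, hm3, hmp⟩ := posn hE hb hw
  obtain ⟨n, hn, hne', hn3, hnp⟩ := posn hE hb hw'
  have := hm3 h2; have := hn3 h2
  rw [hmp, hnp] at hne ⊢
  refine Cv.mk hb hx hxe ?_
  rw [tyb3 h1 h2]
  exact E3 x (E_lt2 hE hb hx hxe (tyb3 h1 h2)) i i.2 _ (by omega) _ (by omega) (fun h => hne (by rw [h]))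

/-- for two genuine points either a type 3 block or a pair of type 1, type 2 blocks -/
theorem two_blocks {a g : A} (hag : a ≠ g) :
    (∃ b ∈ r.B, i1 ∈ b ∧ i2 ∈ b ∧ some (some a) ∈ b ∧ some (some g) ∈ b) ∨
    (∃ b ∈ r.B, ∃ x < 3, ∃ y < 3, x ≠ y ∧ tyb b = 1 ∧ E b x = some (some a) ∧ E b y = some (some g) ∧ E b 3 = i1) ∧
    (∃ b ∈ r.B, ∃ x < 3, ∃ y < 3, x ≠ y ∧ tyb b = 2 ∧ E b x = some (some a) ∧ E b y = some (some g) ∧ E b 3 = i2) := by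
  have n1 : (some (some a) : XX A) ≠ some (some g) := by simpa using hag
  obtain ⟨b1, hb1, p1, p2, p3⟩ := r.ex i1 (some (some a)) (some (some g)) (by simp [i1]) (by simp [i1]) n1
  obtain ⟨b2, hb2, q1, q2, q3⟩ := r.ex i2 (some (some a)) (some (some g)) (by simp [i2]) (by simp [i2]) n1
  by_cases h1 : i2 ∈ b1
  · exact Or.inl ⟨b1, hb1, p1, h1, p2, p3⟩
  by_cases h2 : i1 ∈ b2
  · exact Or.inl ⟨b2, hb2, h2, q1, q2, q3⟩
  right
  have t1 : tyb b1 = 1 := by simp [tyb, p1, h1]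
  have t2 : tyb b2 = 2 := by simp [tyb, q1, h2]
  constructor
  · obtain ⟨x, hx, hxe, -, -⟩ := posn hE hb1 p2
    obtain ⟨y, hy, hye, -, -⟩ := posn hE hb1 p3
    exact ⟨b1, hb1, x, E_ne3 hE hb1 hx hxe (by omega), y, E_ne3 hE hb1 hy hye (by omega), fun h => n1 (by
      rw [← hxe, ← hye, h]), t1, hxe, hye, (hE b1 hb1).h1 p1 h1⟩
  · obtain ⟨x, hx, hxe, -, -⟩ := posn hE hb2 q2
    obtain ⟨y, hy, hye, -, -⟩ := posn hE hb2 q3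
    exact ⟨b2, hb2, x, E_ne3 hE hb2 hx hxe (by omega), y, E_ne3 hE hb2 hy hye (by omega), fun h => n1 (by
      rw [← hxe, ← hye, h]), t2, hxe, hye, (hE b2 hb2).h2 q1⟩

omit hE in
theorem ph_at {b m} {w : Option A} (h : rh (E b m) = w) (j : Fin 3) : (w, j) = ph (E b) (3 * m + j) := by
  rw [ph_eq, h]

theorem cv_mixed {a g : A} {i : Fin 3} (hag : a ≠ g) {w w' : Option A} {j k : Fin 3}
    (hw : w = none ∨ w = some a ∨ w = some g) (hw' : w' = some g) (hne : (w, j) ≠ (w', k)) :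
    Cv r E (some (a, i)) (w, j) (w', k) := by
  subst hw'
  rcases two_blocks hE hag with ⟨b, hb, h1, h2, ha, hg⟩ | ⟨⟨b, hb, x, hx, y, hy, hxy, ht, hxe, hye, h3⟩,
      ⟨b', hb', x', hx', y', hy', hxy', ht', hxe', hye', h3'⟩⟩
  · refine cv_ty3 hE hb h1 h2 ha ?_ hg hne
    rcases hw with rfl | rfl | rfl <;> assumption
  · have ax : rh (E b x) = some a := by rw [hxe]; rfl
    have ay : rh (E b y) = some g := by rw [hye]; rfl
    have a3 : rh (E b 3) = none := by rw [h3]; rfl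
    have ax' : rh (E b' x') = some a := by rw [hxe']; rfl
    have ay' : rh (E b' y') = some g := by rw [hye']; rfl
    have a3' : rh (E b' 3) = none := by rw [h3']; rfl
    rcases hw with rfl | rfl | rfl
    · rcases E2b i i.2 j j.2 k k.2 with h | h
      · rw [ph_at a3, ph_at ay]
        exact Cv.mk hb (by omega) hxe (ht ▸ h x hx y hy hxy)
      · rw [ph_at a3', ph_at ay']
        exact Cv.mk hb' (by omega) hxe' (ht' ▸ h x' hx' y' hy' hxy')
    · rcases E2a i i.2 j j.2 k k.2 with h | h
      · rw [ph_at ax, ph_at ay]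
        exact Cv.mk hb (by omega) hxe (ht ▸ h x hx y hy hxy)
      · rw [ph_at ax', ph_at ay']
        exact Cv.mk hb' (by omega) hxe' (ht' ▸ h x' hx' y' hy' hxy')
    · rcases E2c i i.2 j j.2 k k.2 (fun h => hne (by rw [Fin.ext h])) with h | h
      · rw [ph_at ay, ph_at ay]
        exact Cv.mk hb (by omega) hxe (ht ▸ h x hx y hy hxy)
      · rw [ph_at ay', ph_at ay']
        exact Cv.mk hb' (by omega) hxe' (ht' ▸ h x' hx' y' hy' hxy')

theorem cv_gen {a g g' : A} {i : Fin 3} (h1 : a ≠ g) (h2 : a ≠ g') (h3 : g ≠ g') (j k : Fin 3) :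
    Cv r E (some (a, i)) (some g, j) (some g', k) := by
  obtain ⟨b, hb, p1, p2, p3⟩ := r.ex (some (some a)) (some (some g)) (some (some g')) (by simpa using h1)
    (by simpa using h2) (by simpa using h3)
  obtain ⟨x, hx, hxe, -, -⟩ := posn hE hb p1
  obtain ⟨y, hy, hye, -, hyp⟩ := posn hE hb p2
  obtain ⟨z, hz, hze, -, hzp⟩ := posn hE hb p3
  rw [hyp, hzp]
  refine Cv.mk hb hx hxe ?_
  have xy : x ≠ y := by rintro rfl; rw [hxe] at hye; simp at hye; exact h1 hye
  have xz : x ≠ z := by rintro rfl; rw [hxe] at hze; simp at hze; exact h2 hze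
  have yz : y ≠ z := by rintro rfl; rw [hye] at hze; simp at hze; exact h3 hze
  have t3 : tyb b ≠ 3 := by
    intro t
    have := E_lt2 hE hb hx hxe t; have := E_lt2 hE hb hy hye t; have := E_lt2 hE hb hz hze t
    omega
  have := tyb_lt' b
  refine E1 _ (by omega) x hx y hy z hz ⟨?_, xy, xz, yz⟩ _ (ci_lt _) _ j.2 _ k.2
  by_cases t0 : tyb b = 0
  · exact Or.inl t0
  · exact Or.inr ⟨E_ne3 hE hb hx hxe t0, E_ne3 hE hb hy hye t0, E_ne3 hE hb hz hze t0⟩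

theorem cv_none {w w' : Option A} {j j' : Fin 3} (hne : (w, j) ≠ (w', j')) (hA : ∀ w : Option A, ∃ w', w ≠ w') :
    Cv r E none (w, j) (w', j') := by
  have : ∃ b ∈ r.B, i2 ∈ b ∧ some w ∈ b ∧ some w' ∈ b := by
    by_cases h : w = w'
    · subst h
      obtain ⟨w', hw'⟩ := hA w
      obtain ⟨b, hb, h1, h2, h3⟩ := r.ex i2 (some w) (some w') (by simp [i2]) (by simp [i2]) (by simpa using hw')
      exact ⟨b, hb, h1, h2, h2⟩
    · exact r.ex i2 (some w) (some w') (by simp [i2]) (by simp [i2]) (by simpa using h)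
  obtain ⟨b, hb, h2, hw, hw'⟩ := this
  obtain ⟨m, hm, hme, hm3, hmp⟩ := posn hE hb hw
  obtain ⟨n, hn, hne', hn3, hnp⟩ := posn hE hb hw'
  have := hm3 h2; have := hn3 h2
  rw [hmp, hnp] at hne ⊢
  exact Cv.mk hb (x := 3) (by omega) ((hE b hb).h2 h2) (E4 _ (tyb_lt' b) ((tyb_iff b).2.1 h2) _ (by omega) _ (by omega)
    (fun h => hne (by rw [h])))

theorem cv_all (hA : ∀ w : Option A, ∃ w', w ≠ w') (c y y') (hne : y ≠ y') : Cv r E c y y' := by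
  obtain ⟨w, j⟩ := y
  obtain ⟨w', j'⟩ := y'
  rcases c with _ | ⟨a, i⟩
  · exact cv_none hE hne hA
  by_cases hw' : w' = none ∨ w' = some a
  · by_cases hw : w = none ∨ w = some a
    · obtain ⟨b, hb, h1, h2, h3⟩ := r.ex i1 i2 (some (some a)) (by simp) (by simp [i1]) (by simp [i2])
      refine cv_ty3 hE hb h1 h2 h3 ?_ ?_ hne
      · rcases hw with rfl | rfl <;> assumption
      · rcases hw' with rfl | rfl <;> assumption
    · rcases w with _ | g
      · simp at hw
      · simp only [reduceCtorEq, Option.some.injEq, false_or] at hw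
        exact (cv_mixed hE (Ne.symm hw) (by tauto) rfl hne.symm).symm
  · rcases w' with _ | g
    · simp at hw'
    · simp only [reduceCtorEq, Option.some.injEq, false_or] at hw'
      by_cases hw : w = none ∨ w = some a ∨ w = some g
      · exact cv_mixed hE (Ne.symm hw') hw rfl hne
      · rcases w with _ | g'
        · simp at hw
        · simp only [reduceCtorEq, Option.some.injEq, false_or, not_or] at hw
          exact cv_gen hE (Ne.symm hw.1) (Ne.symm hw') hw.2 _ _

/-- triples -/
theorem cv3_ty3 {b} (hb : b ∈ r.B) (h1 : i1 ∈ b) (h2 : i2 ∈ b) {w w' w'' : Option A} {j j' j'' : Fin 3}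
    (hw : some w ∈ b) (hw' : some w' ∈ b) (hw'' : some w'' ∈ b)
    (n1 : (w, j) ≠ (w', j')) (n2 : (w, j) ≠ (w'', j'')) (n3 : (w', j') ≠ (w'', j'')) :
    Cv3 r E (w, j) (w', j') (w'', j'') := by
  obtain ⟨m, hm, hme, hm3, hmp⟩ := posn hE hb hw
  obtain ⟨n, hn, hne', hn3, hnp⟩ := posn hE hb hw'
  obtain ⟨k, hk, hke', hk3, hkp⟩ := posn hE hb hw''
  have := hm3 h2; have := hn3 h2; have := hk3 h2
  rw [hmp, hnp] at n1
  rw [hmp, hkp] at n2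
  rw [hnp, hkp] at n3
  rw [hmp, hnp, hkp]
  have q2 : E b 2 = i1 := (hE b hb).h12 h1 h2
  have q3 : E b 3 = i2 := (hE b hb).h2 h2
  rcases E7 (3*m+j) (by omega) (3*n+j') (by omega) (3*k+j'') (by omega) (fun h => n1 (by rw [h])) (fun h => n2 (by rw [h]))
    (fun h => n3 (by rw [h])) with ⟨x, hx, i, hi, h⟩ | h
  · refine Cv3.mk' hE (x := x) (i := i) hb (by omega) hi ?_ ?_ (by rw [tyb3 h1 h2]; exact h)
    · rw [← q2]; intro h; have := (hE b hb).inj _ (by omega) _ (by omega) h; omega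
    · rw [← q3]; intro h; have := (hE b hb).inj _ (by omega) _ (by omega) h; omega
  · exact Cv3.mk (c := none) (x := 3) hb (by omega) q3 (by rw [tyb3 h1 h2]; exact h)

theorem gen_pos {b} (hb : b ∈ r.B) {x : ℕ} (hx : x < 3) (ht : tyb b < 3) : E b x ≠ i1 ∧ E b x ≠ i2 := by
  have k := tyb_iff b
  have mm : E b x ∈ b := ((hE b hb).mem _).2 ⟨x, by omega, rfl⟩
  constructor
  · intro h
    rw [h] at mm
    have h2 : i2 ∉ b := by intro h2; have := tyb3 mm h2; omega
    have := (hE b hb).inj _ (by omega) _ (by omega) (h.trans ((hE b hb).h1 mm h2).symm)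
    omega
  · intro h
    rw [h] at mm
    have := (hE b hb).inj _ (by omega) _ (by omega) (h.trans ((hE b hb).h2 mm).symm)
    omega

theorem cv3_mixed {a g : A} (hag : a ≠ g) {w : Option A} {j k l : Fin 3}
    (hw : (w = none) ∨ (w = some a ∧ j ≠ l)) :
    Cv3 r E (some a, j) (some g, k) (w, l) := by
  rcases two_blocks hE hag with ⟨b, hb, h1, h2, ha, hg⟩ | ⟨⟨b, hb, x, hx, y, hy, hxy, ht, hxe, hye, h3⟩,
      ⟨b', hb', x', hx', y', hy', hxy', ht', hxe', hye', h3'⟩⟩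
  · refine cv3_ty3 hE hb h1 h2 ha hg ?_ (by simp [hag]) ?_ ?_
    · rcases hw with rfl | ⟨rfl, -⟩ <;> assumption
    · rcases hw with rfl | ⟨rfl, h⟩ <;> simp_all
    · rcases hw with rfl | ⟨rfl, h⟩ <;> simp [hag.symm]
  · have ax : rh (E b x) = some a := by rw [hxe]; rfl
    have ay : rh (E b y) = some g := by rw [hye]; rfl
    have a3 : rh (E b 3) = none := by rw [h3]; rfl
    have ax' : rh (E b' x') = some a := by rw [hxe']; rfl
    have ay' : rh (E b' y') = some g := by rw [hye']; rfl
    have a3' : rh (E b' 3) = none := by rw [h3']; rfl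
    rcases hw with rfl | ⟨rfl, hjl⟩
    · rcases E6a j j.2 k k.2 l l.2 with h | h
      · obtain ⟨z, hz, i, hi, h⟩ := h x hx y hy hxy
        have := gen_pos hE hb hz (by omega)
        rw [ph_at ax, ph_at ay, ph_at a3]
        exact Cv3.mk' hE hb (by omega) hi this.1 this.2 (ht ▸ h)
      · obtain ⟨z, hz, i, hi, h⟩ := h x' hx' y' hy' hxy'
        have := gen_pos hE hb' hz (by omega)
        rw [ph_at ax', ph_at ay', ph_at a3']
        exact Cv3.mk' hE hb' (by omega) hi this.1 this.2 (ht' ▸ h)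
    · have sw : ∀ {p q s}, Cv3 r E p q s → Cv3 r E p s q := by
        rintro p q s ⟨c, b, x, d, h, h1, h2, h3⟩
        exact ⟨c, b, x, d, h, h1, h3, h2⟩
      apply sw
      rcases E6b j j.2 l l.2 k k.2 (fun h => hjl (Fin.ext h)) with h | h
      · obtain ⟨z, hz, i, hi, h⟩ := h x hx y hy hxy
        have := gen_pos hE hb hz (by omega)
        rw [ph_at ax, ph_at ay, ph_at ax]
        exact Cv3.mk' hE hb (by omega) hi this.1 this.2 (ht ▸ h)
      · obtain ⟨z, hz, i, hi, h⟩ := h x' hx' y' hy' hxy'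
        have := gen_pos hE hb' hz (by omega)
        rw [ph_at ax', ph_at ay', ph_at ax']
        exact Cv3.mk' hE hb' (by omega) hi this.1 this.2 (ht' ▸ h)

omit hE in
theorem Cv3.s1 {p q s} (h : Cv3 r E p q s) : Cv3 r E q p s := by
  obtain ⟨c, b, x, d, h, h1, h2, h3⟩ := h
  exact ⟨c, b, x, d, h, h2, h1, h3⟩
omit hE in
theorem Cv3.s2 {p q s} (h : Cv3 r E p q s) : Cv3 r E p s q := by
  obtain ⟨c, b, x, d, h, h1, h2, h3⟩ := h
  exact ⟨c, b, x, d, h, h1, h3, h2⟩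

theorem cv3_gen {a g k : A} (h1 : a ≠ g) (h2 : a ≠ k) (h3 : g ≠ k) (j j' j'' : Fin 3) :
    Cv3 r E (some a, j) (some g, j') (some k, j'') := by
  obtain ⟨b, hb, p1, p2, p3⟩ := r.ex (some (some a)) (some (some g)) (some (some k)) (by simpa using h1)
    (by simpa using h2) (by simpa using h3)
  obtain ⟨x, hx, hxe, -, hxp⟩ := posn hE hb p1
  obtain ⟨y, hy, hye, -, hyp⟩ := posn hE hb p2
  obtain ⟨z, hz, hze, -, hzp⟩ := posn hE hb p3
  have xy : x ≠ y := by rintro rfl; rw [hxe] at hye; simp at hye; exact h1 hye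
  have xz : x ≠ z := by rintro rfl; rw [hxe] at hze; simp at hze; exact h2 hze
  have yz : y ≠ z := by rintro rfl; rw [hye] at hze; simp at hze; exact h3 hze
  have t3 : tyb b ≠ 3 := by
    intro t
    have := E_lt2 hE hb hx hxe t; have := E_lt2 hE hb hy hye t; have := E_lt2 hE hb hz hze t
    omega
  have tl := tyb_lt' b
  by_cases t0 : tyb b = 0
  · rw [hxp, hyp, hzp]
    obtain ⟨w, hw, i, hi, h⟩ := E8 x hx y hy z hz ⟨xy, xz, yz⟩ j j.2 j' j'.2 j'' j''.2
    have mm : E b w ∈ b := ((hE b hb).mem _).2 ⟨w, hw, rfl⟩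
    have := tyb_iff b
    refine Cv3.mk' hE hb hw hi ?_ ?_ (t0 ▸ h)
    · intro h; rw [h] at mm; have := this.1.1 mm; omega
    · intro h; rw [h] at mm; have := this.2.1 mm; omega
  have x3 := E_ne3 hE hb hx hxe t0
  have y3 := E_ne3 hE hb hy hye t0
  have z3 := E_ne3 hE hb hz hze t0
  have main : ∀ (f : Fin 3 → Option A × Fin 3), (∀ m : Fin 3, ∃ j : Fin 3, f m = ph (E b) (3 * m + j)) →
      Cv3 r E (f 0) (f 1) (f 2) := by
    intro f hf
    obtain ⟨j0, e0⟩ := hf 0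
    obtain ⟨j1, e1⟩ := hf 1
    obtain ⟨j2, e2⟩ := hf 2
    rw [e0, e1, e2]
    rcases E5 (tyb b) (by omega) (by omega) j0 j0.2 j1 j1.2 j2 j2.2 with ⟨w, hw, i, hi, h⟩ | ⟨t2, h⟩
    · have := gen_pos hE hb hw (by omega)
      have h' := Cv3.mk' hE hb (by omega) hi this.1 this.2 h
      simpa using h'
    · have h' := Cv3.mk (c := none) (x := 3) hb (by omega) ((hE b hb).h2 ((tyb_iff b).2.2 (by omega))) h
      simpa using h'
  rw [hxp, hyp, hzp]
  have key := main (fun m => if (m : ℕ) = x then ph (E b) (3 * x + j) else if (m : ℕ) = y then ph (E b) (3 * y + j')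
    else ph (E b) (3 * z + j'')) (by
      intro m
      have hm := m.2
      by_cases h1 : (m : ℕ) = x
      · exact ⟨j, by simp [h1]⟩
      · by_cases h2 : (m : ℕ) = y
        · exact ⟨j', by simp [h2, xy.symm]⟩
        · have : (m : ℕ) = z := by omega
          exact ⟨j'', by simp [this, xz.symm, yz.symm]⟩)
  clear main hxp hyp hzp hxe hye hze
  interval_cases x <;> interval_cases y <;> (try omega) <;> interval_cases z <;> (try omega) <;> simp at key ⊢
  · exact key
  · exact key.s2
  · exact key.s1
  · exact key.s1.s2
  · exact key.s2.s1
  · exact key.s1.s2.s1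

theorem cv3_vert (hA : ∀ w : Option A, ∃ w', w ≠ w') (w : Option A) (j j' j'' : Fin 3) (h1 : j ≠ j') (h2 : j ≠ j'')
    (h3 : j' ≠ j'') : Cv3 r E (w, j) (w, j') (w, j'') := by
  obtain ⟨w', hw'⟩ := hA w
  obtain ⟨b, hb, q1, q2, q3⟩ := r.ex i2 (some w) (some w') (by simp [i2]) (by simp [i2]) (by simpa using hw')
  obtain ⟨m, hm, hme, hm3, hmp⟩ := posn hE hb q2
  have m3 := hm3 q1
  have h := Cv3.mk (c := none) (x := 3) hb (by omega) ((hE b hb).h2 q1)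
    (E9 _ (tyb_lt' b) ((tyb_iff b).2.1 q1) m m3)
  have h : Cv3 r E (w, 0) (w, 1) (w, 2) := by
    rw [hmp, hmp, hmp]; simpa using h
  have cs : ∀ j j' j'' : Fin 3, j ≠ j' → j ≠ j'' → j' ≠ j'' → 
    (j = 0 ∧ j' = 1 ∧ j'' = 2) ∨ (j = 0 ∧ j' = 2 ∧ j'' = 1) ∨ (j = 1 ∧ j' = 0 ∧ j'' = 2) ∨
    (j = 1 ∧ j' = 2 ∧ j'' = 0) ∨ (j = 2 ∧ j' = 0 ∧ j'' = 1) ∨ (j = 2 ∧ j' = 1 ∧ j'' = 0) := by decide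
  rcases cs j j' j'' h1 h2 h3 with ⟨rfl, rfl, rfl⟩ | ⟨rfl, rfl, rfl⟩ | ⟨rfl, rfl, rfl⟩ | ⟨rfl, rfl, rfl⟩ |
    ⟨rfl, rfl, rfl⟩ | ⟨rfl, rfl, rfl⟩
  · exact h
  · exact h.s2
  · exact h.s1
  · exact h.s1.s2
  · exact h.s2.s1
  · exact h.s1.s2.s1

theorem cv3_star {a : A} {w w' w'' : Option A} {j j' j'' : Fin 3} (hw : w = none ∨ w = some a)
    (hw' : w' = none ∨ w' = some a) (hw'' : w'' = none ∨ w'' = some a)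
    (n1 : (w, j) ≠ (w', j')) (n2 : (w, j) ≠ (w'', j'')) (n3 : (w', j') ≠ (w'', j'')) :
    Cv3 r E (w, j) (w', j') (w'', j'') := by
  obtain ⟨b, hb, h1, h2, h3⟩ := r.ex i1 i2 (some (some a)) (by simp) (by simp [i1]) (by simp [i2])
  refine cv3_ty3 hE hb h1 h2 ?_ ?_ ?_ n1 n2 n3
  · rcases hw with rfl | rfl <;> assumption
  · rcases hw' with rfl | rfl <;> assumption
  · rcases hw'' with rfl | rfl <;> assumption

theorem cv3_all (hA : ∀ w : Option A, ∃ w', w ≠ w') (y y' y'') (n1 : y ≠ y') (n2 : y ≠ y'') (n3 : y' ≠ y'') :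
    Cv3 r E y y' y'' := by
  obtain ⟨w, j⟩ := y
  obtain ⟨w', j'⟩ := y'
  obtain ⟨w'', j''⟩ := y''
  have jn : ∀ (w : Option A) (j j' : Fin 3), (w, j) ≠ (w, j') → j ≠ j' := by
    intro w j j' h h'; exact h (by rw [h'])
  rcases w with _ | a <;> rcases w' with _ | g <;> rcases w'' with _ | k
  · exact cv3_vert hE hA none _ _ _ (jn _ _ _ n1) (jn _ _ _ n2) (jn _ _ _ n3)
  · exact cv3_star hE (a := k) (by simp) (by simp) (by simp) n1 n2 n3
  · exact cv3_star hE (a := g) (by simp) (by simp) (by simp) n1 n2 n3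
  · by_cases h : g = k
    · exact cv3_star hE (a := g) (by simp) (by simp) (by simp [h]) n1 n2 n3
    · exact (cv3_mixed hE h (Or.inl rfl)).s2.s1
  · exact cv3_star hE (a := a) (by simp) (by simp) (by simp) n1 n2 n3
  · by_cases h : a = k
    · exact cv3_star hE (a := a) (by simp) (by simp) (by simp [h]) n1 n2 n3
    · exact (cv3_mixed hE h (Or.inl rfl)).s2
  · by_cases h : a = g
    · exact cv3_star hE (a := a) (by simp) (by simp [h]) (by simp) n1 n2 n3
    · exact (cv3_mixed hE h (Or.inl rfl))
  · by_cases h1 : a = g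
    · subst h1
      by_cases h2 : a = k
      · subst h2
        exact cv3_vert hE hA _ _ _ _ (jn _ _ _ n1) (jn _ _ _ n2) (jn _ _ _ n3)
      · exact (cv3_mixed hE h2 (Or.inr ⟨rfl, jn _ _ _ n1⟩)).s2
    · by_cases h2 : a = k
      · subst h2
        exact cv3_mixed hE h1 (Or.inr ⟨rfl, jn _ _ _ n2⟩)
      · by_cases h3 : g = k
        · subst h3
          exact (cv3_mixed hE (Ne.symm h1) (Or.inr ⟨rfl, jn _ _ _ n3⟩)).s1
        · exact cv3_gen hE h1 h2 h3 _ _ _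
end LK3

theorem lkts_of_hasRD {n : ℕ} (hn : 0 < n) (h : HasRD n) : ExistsLKTS (3 * (2 * n + 1)) := by
  classical
  obtain ⟨r⟩ := h.get (XX (Fin (2 * n))) (Fin n) (by simp) (by simp)
  have := fun (b : Finset (XX (Fin (2*n)))) (hb : b ∈ r.B) => Chart.exists b (r.c4 b hb)
  choose! E hE using this
  have hA : ∀ w : Option (Fin (2 * n)), ∃ w', w ≠ w' := by
    intro w
    rcases w with _ | w
    · exact ⟨some ⟨0, by omega⟩, by simp⟩
    · exact ⟨none, by simp⟩
  have key := LK.mk' (Y := Option (Fin (2 * n)) × Fin 3) (C := Option (Fin (2 * n) × Fin 3)) (H := Option (Fin n × Fin 3))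
    (by simp; ring) (by simp; ring)
    (fun c => {s | ∃ b x d, entr r E c b x d ∧ s = tri (E b) d})
    (fun c h s => ∃ b x d, entr r E c b x d ∧ s = tri (E b) d ∧ h = clr (r.κ (cb c) b) d.2.2.2)
    (by
      rintro c s ⟨b, x, d, h, rfl⟩
      have l1 := L1 _ (tyb_lt' b) _ h.2.1 _ (ci_lt c) d h.2.2.2
      have hi : ∀ p ∈ pts d, ∀ q ∈ pts d, ph (E b) p = ph (E b) q → p = q := by
        intro p hp q hq
        refine ph_inj (hE b h.1) p q (l1.1 p hp).1 (l1.1 q hq).1 (fun h1 h2 => ?_)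
        exact ⟨(l1.1 p hp).2.2.1 (tyb3 h1 h2), (l1.1 q hq).2.2.1 (tyb3 h1 h2)⟩
      apply Finset.card_eq_three.2
      refine ⟨ph (E b) d.1, ph (E b) d.2.1, ph (E b) d.2.2.1, ?_, ?_, ?_, by ext; simp [tri]⟩
      · intro h; exact l1.2.1 (hi _ (by simp [pts]) _ (by simp [pts]) h)
      · intro h; exact l1.2.2.1 (hi _ (by simp [pts]) _ (by simp [pts]) h)
      · intro h; exact l1.2.2.2.1 (hi _ (by simp [pts]) _ (by simp [pts]) h))
    (by
      intro c y y' hne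
      obtain ⟨b, x, d, h, h1, h2⟩ := cv_all hE hA c y y' hne
      exact ⟨_, ⟨b, x, d, h, rfl⟩, h1, h2⟩)
    (by
      intro y y' y'' n1 n2 n3
      obtain ⟨c, b, x, d, h, h1, h2, h3⟩ := cv3_all hE hA y y' y'' n1 n2 n3
      exact ⟨c, _, ⟨b, x, d, h, rfl⟩, h1, h2, h3⟩)
    (by
      rintro c s ⟨b, x, d, h, rfl⟩
      exact ⟨clr (r.κ (cb c) b) d.2.2.2, b, x, d, h, rfl, rfl⟩)
    (by
      rintro c s - s' - y h hy hy' ⟨b, x, d, h1, rfl, rfl⟩ ⟨b', x', d', h1', rfl, h2⟩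
      exact entr_inj hE h1 h1' hy hy' h2)
  convert key using 1
  simp; ring

section P1a
set_option synthInstance.maxHeartbeats 400000
set_option synthInstance.maxSize 20000
set_option maxSynthPendingDepth 10

/-- Column embedding. -/
def colm {G : Type} {P : Type} (p : P) : Option G → Option (P × G) := Option.map (fun g => (p, g))

/-- Local system on three columns. -/
structure PLine (G C HG : Type) where
  RB : Set (Finset (Option G))
  RK : Option G → HG → Finset (Option G) → Prop
  B : Set (Finset (Option (Fin 3 × G)))
  K : Option (Fin 3 × G) → C ⊕ HG → Finset (Option (Fin 3 × G)) → Prop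
  c4 : ∀ b ∈ B, b.card = 4
  ex : ∀ x y z, x ≠ y → x ≠ z → y ≠ z → ∃ b ∈ B, x ∈ b ∧ y ∈ b ∧ z ∈ b
  col : ∀ b ∈ B, ∀ x ∈ b, ∃ h, K x h b
  inj : ∀ b ∈ B, ∀ b' ∈ B, ∀ x y h, x ≠ y → x ∈ b → y ∈ b → x ∈ b' → y ∈ b' →
      K x h b → K x h b' → b = b'
  rinj : ∀ b ∈ RB, ∀ b' ∈ RB, ∀ x y h, x ≠ y → x ∈ b → y ∈ b → x ∈ b' → y ∈ b' →
      RK x h b → RK x h b' → b = b'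
  cR : ∀ b ∈ B, ∀ p g h y, K (some (p, g)) (Sum.inr h) b → some (p, g) ∈ b → colm p y ∈ b →
      y ≠ some g → ∃ r ∈ RB, (∀ z, z ∈ b ↔ ∃ w ∈ r, z = colm p w) ∧ RK (some g) h r
  cN : ∀ b ∈ B, ∀ h, K none (Sum.inr h) b → none ∈ b →
      ∃ r ∈ RB, ∃ p, (∀ z, z ∈ b ↔ ∃ w ∈ r, z = colm p w) ∧ RK none h r

def LB10 : List (ℕ × ℕ) := [(519, 786495), (27, 394), (291, 199680), (195, 20485), (45, 1105),
  (149, 49920), (325, 73762), (585, 0), (393, 195), (113, 12291), (785, 655873), (673, 296962),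
  (78, 12480), (54, 2596), (390, 163864), (170, 49164), (778, 327748), (338, 780), (658, 0),
  (610, 533512), (284, 196656), (652, 540832), (596, 266512), (228, 3120), (804, 0),
  (568, 790464), (216, 41536), (360, 137344), (432, 83200), (960, 1044480)]

abbrev P10 := Option (Fin 3 × Fin 3)

def pt10 : P10 → ℕ
  | none => 9
  | some (p, g) => 3 * p.val + g.val

def bl10 (n : ℕ) : Finset P10 := univ.filter (fun x => n.testBit (pt10 x) = true)

theorem mem_bl10 (n : ℕ) (x : P10) : x ∈ bl10 n ↔ n.testBit (pt10 x) = true := by simp [bl10]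

def kc10 (k : ℕ) (x : P10) : ℕ := k / 4 ^ (pt10 x) % 4

def co10 : ℕ → Fin 3 ⊕ Unit
  | 0 => Sum.inl 0
  | 1 => Sum.inl 1
  | 2 => Sum.inl 2
  | _ => Sum.inr ()

theorem co10_inj {a b : ℕ} (ha : a < 4) (hb : b < 4) (h : co10 a = co10 b) : a = b := by
  interval_cases a <;> interval_cases b <;> first | rfl | (exfalso; revert h; decide)

theorem co10_r {a : ℕ} (ha : a < 4) (h : co10 a = Sum.inr ()) : a = 3 := by
  interval_cases a <;> first | rfl | (exfalso; revert h; decide)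

theorem co10_z {a : ℕ} (ha : a < 4) (h : co10 a = Sum.inl 0) : a = 0 := by
  interval_cases a <;> first | rfl | (exfalso; revert h; decide)

theorem f10c4 : ∀ c ∈ LB10, (bl10 c.1).card = 4 := by decide +kernel
theorem f10ex : ∀ x y z : P10, x ≠ y → x ≠ z → y ≠ z → ∃ c ∈ LB10, c.1.testBit (pt10 x) = true ∧
    c.1.testBit (pt10 y) = true ∧ c.1.testBit (pt10 z) = true := by decide +kernel
theorem f10inj : ∀ c ∈ LB10, ∀ c' ∈ LB10, c = c' ∨ ∀ x : P10, c.1.testBit (pt10 x) = true →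
    c'.1.testBit (pt10 x) = true → kc10 c.2 x = kc10 c'.2 x → ∀ y : P10,
    c.1.testBit (pt10 y) = true → c'.1.testBit (pt10 y) = true → x = y := by decide +kernel
theorem f10R : ∀ c ∈ LB10, ∀ p : Fin 3, ∀ g : Fin 3, kc10 c.2 (some (p, g)) = 3 →
    c.1.testBit (pt10 (some (p, g))) = true → ∀ y : Option (Fin 3),
    c.1.testBit (pt10 (colm p y)) = true → y = some g ∨
    ∀ z, c.1.testBit (pt10 z) = true ↔ ∃ w, z = colm p w := by decide +kernel
theorem f10N : ∀ c ∈ LB10, kc10 c.2 none = 3 → c.1.testBit 9 = true → ∃ p : Fin 3,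
    ∀ z, c.1.testBit (pt10 z) = true ↔ ∃ w : Option (Fin 3), z = colm p w := by decide +kernel
/-- Facts for the other direction. -/
theorem f10R2 : ∀ c ∈ LB10, ∀ p : Fin 3, ∀ g : Fin 3, kc10 c.2 (some (p, g)) = 0 →
    c.1.testBit (pt10 (some (p, g))) = true → (c.1.testBit 9 = true ∨ ∃ q, q ≠ p ∧
    c.1.testBit (pt10 (some (q, g))) = true) →
    ∀ z, c.1.testBit (pt10 z) = true ↔ z = none ∨ ∃ q, z = some (q, g) := by decide +kernel
theorem f10N2 : ∀ c ∈ LB10, kc10 c.2 none = 0 → c.1.testBit 9 = true → ∃ g : Fin 3,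
    ∀ z, c.1.testBit (pt10 z) = true ↔ z = none ∨ ∃ q, z = some (q, g) := by decide +kernel

def pl10 : PLine (Fin 3) (Fin 3) Unit where
  RB := {Finset.univ}
  RK := fun _ _ _ => True
  B := {b | ∃ c ∈ LB10, b = bl10 c.1}
  K := fun x h b => ∃ c ∈ LB10, b = bl10 c.1 ∧ co10 (kc10 c.2 x) = h
  c4 := by rintro _ ⟨c, hc, rfl⟩; exact f10c4 c hc
  ex := by
    intro x y z h1 h2 h3
    obtain ⟨c, hc, h⟩ := f10ex x y z h1 h2 h3
    exact ⟨_, ⟨c, hc, rfl⟩, by simpa only [mem_bl10] using h⟩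
  col := by
    rintro _ ⟨c, hc, rfl⟩ x hx
    exact ⟨_, c, hc, rfl, rfl⟩
  inj := by
    rintro _ _ _ _ x y h hxy h1 h2 h3 h4 ⟨c, hc, rfl, rfl⟩ ⟨c', hc', rfl, e⟩
    rw [mem_bl10] at h1 h2 h3 h4
    rcases f10inj c hc c' hc' with rfl | h5
    · rfl
    · exact absurd (h5 x h1 h3 (co10_inj (Nat.mod_lt _ (by norm_num)) (Nat.mod_lt _ (by norm_num)) e.symm) y h2 h4) hxy
  rinj := by rintro _ rfl _ rfl; intros; rfl
  cR := by
    rintro _ - p g ⟨⟩ y ⟨c, hc, rfl, e⟩ h1 h2 h3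
    rw [mem_bl10] at h1 h2
    have e' := co10_r (Nat.mod_lt _ (by norm_num)) e
    rcases f10R c hc p g e' h1 y h2 with h | h
    · exact absurd h h3
    · exact ⟨_, rfl, fun z => by rw [mem_bl10, h z]; simp, trivial⟩
  cN := by
    rintro _ - ⟨⟩ ⟨c, hc, rfl, e⟩ h1
    rw [mem_bl10] at h1
    have e' := co10_r (Nat.mod_lt _ (by norm_num)) e
    obtain ⟨p, h⟩ := f10N c hc e' h1
    exact ⟨_, rfl, p, fun z => by rw [mem_bl10, h z]; simp, trivial⟩

/-- Coloured transversal designs on four groups. -/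
structure TDc (G C : Type) where
  S : Set (Fin 4 → G)
  K : Fin 4 → C → (Fin 4 → G) → Prop
  ex : ∀ i j k : Fin 4, i ≠ j → i ≠ k → j ≠ k → ∀ a b c : G, ∃ x ∈ S, x i = a ∧ x j = b ∧ x k = c
  col : ∀ x ∈ S, ∀ i, ∃ c, K i c x
  inj : ∀ x ∈ S, ∀ x' ∈ S, ∀ i j c, i ≠ j → x i = x' i → x j = x' j → K i c x → K i c x' → x = x'

def tdK {G : Type} [AddCommGroup G] (i : Fin 4) (x : Fin 4 → G) : G :=
  if i = 0 ∨ i = 1 then x 2 - x 3 else x 0 - x 1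

def tdG (G : Type) [AddCommGroup G] (h2 : ∀ g g' : G, g + g = g' + g' → g = g') : TDc G G where
  S := {x | x 0 + x 1 = x 2 + x 3}
  K := fun i c x => tdK i x = c
  ex := by
    intro i j k h1 h2 h3 a b c
    obtain ⟨l, hl⟩ : ∃ l : Fin 4, l ≠ i ∧ l ≠ j ∧ l ≠ k := by revert h1 h2 h3; revert i j k; decide
    let f : Fin 4 → G := fun t => if t = i then a else if t = j then b else if t = k then c else 0
    let d : G := f 0 + f 1 - f 2 - f 3
    let g : Fin 4 → G := fun t => if t = l then (if l = 0 ∨ l = 1 then -d else d) else f t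
    refine ⟨g, ?_, ?_, ?_, ?_⟩
    · have hf : f l = 0 := by simp [f, hl]
      show g 0 + g 1 = g 2 + g 3
      have hd : d = f 0 + f 1 - f 2 - f 3 := rfl
      simp only [g]
      clear_value d f
      fin_cases l <;> simp at hf ⊢ <;> rw [hf] at hd <;> rw [hd] <;> abel
    · simp [g, f, hl.1.symm]
    · simp [g, f, hl.2.1.symm, h1.symm]
    · simp [g, f, hl.2.2.symm, h2.symm, h3.symm]
  col := fun x _ i => ⟨_, rfl⟩
  inj := by
    intro x hx x' hx' i j c hij h1 h3 h4 h5
    have hk := h4.trans h5.symm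
    clear h4 h5
    simp only [Set.mem_ofPred_eq] at hx hx'
    have key : ∀ a b c d a' b' c' d' : G, a + b = c + d → a' + b' = c' + d' → a = a' →
        c - d = c' - d' → (b = b' ∨ c = c' ∨ d = d') → b = b' ∧ c = c' ∧ d = d' := by
      rintro a b c d a' b' c' d' e1 e2 rfl e3 e4
      have e5 : c = c' → b = b' ∧ c = c' ∧ d = d' := by
        rintro rfl
        have : d = d' := by simpa using e3
        subst this
        exact ⟨by rw [← e2] at e1; simpa using e1, rfl, rfl⟩
      rcases e4 with rfl | h | rfl
      · apply e5
        apply h2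
        have : c + d = c' + d' := by rw [← e1, ← e2]
        calc c + c = (c + d) + (c - d) := by abel
          _ = _ := by rw [this, e3]; abel
      · exact e5 h
      · exact e5 (by simpa using e3)
    have fin : x 0 = x' 0 → x 1 = x' 1 → x 2 = x' 2 → x 3 = x' 3 → x = x' := by
      intros; funext t; fin_cases t <;> assumption
    fin_cases i
    · simp [tdK] at hk h1
      have := key _ _ _ _ _ _ _ _ hx hx' h1 hk (by fin_cases j; exacts [absurd rfl hij, Or.inl h3, Or.inr (Or.inl h3), Or.inr (Or.inr h3)])
      exact fin h1 this.1 this.2.1 this.2.2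
    · simp [tdK] at hk h1
      have := key _ _ _ _ _ _ _ _ (by rw [add_comm]; exact hx) (by rw [add_comm]; exact hx') h1 hk (by fin_cases j; exacts [Or.inl h3, absurd rfl hij, Or.inr (Or.inl h3), Or.inr (Or.inr h3)])
      exact fin this.1 h1 this.2.1 this.2.2
    · simp [tdK] at hk h1
      have := key _ _ _ _ _ _ _ _ hx.symm hx'.symm h1 hk (by fin_cases j; exacts [Or.inr (Or.inl h3), Or.inr (Or.inr h3), absurd rfl hij, Or.inl h3])
      exact fin this.2.1 this.2.2 h1 this.1
    · simp [tdK] at hk h1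
      have := key _ _ _ _ _ _ _ _ (by rw [add_comm (x 3)]; exact hx.symm) (by rw [add_comm]; exact hx'.symm) h1 hk (by fin_cases j; exacts [Or.inr (Or.inl h3), Or.inr (Or.inr h3), Or.inl h3, absurd rfl hij])
      exact fin this.2.1 this.2.2 this.1 h1

end P1a

section P1b
open Classical in
noncomputable def tb {V G : Type} (e : Fin 4 → V) (x : Fin 4 → G) : Finset (Option (G × V)) :=
  univ.image (fun j => some (x j, e j))

def lm {V G : Type} (e : Fin 3 → V) : Option (Fin 3 × G) → Option (G × V) :=
  Option.map (fun o => (o.2, e o.1))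

open Classical in
noncomputable def lb {V G : Type} (e : Fin 3 → V) (r : Finset (Option (Fin 3 × G))) :
    Finset (Option (G × V)) := r.image (lm e)

def vpt {V G : Type} : Option (G × V) → Option V := Option.map Prod.snd

theorem mem_tb {V G : Type} (e : Fin 4 → V) (x : Fin 4 → G) (y) :
    y ∈ tb e x ↔ ∃ j, y = some (x j, e j) := by
  simp [tb, eq_comm]

theorem mem_lb {V G : Type} (e : Fin 3 → V) (r : Finset (Option (Fin 3 × G))) (y) :
    y ∈ lb e r ↔ ∃ o ∈ r, y = lm e o := by
  simp [lb, eq_comm]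

theorem lm_inj {V G : Type} {e : Fin 3 → V} (he : Function.Injective e) :
    Function.Injective (lm (G := G) e) := by
  intro a b h
  rcases a with _ | ⟨p, g⟩ <;> rcases b with _ | ⟨q, g'⟩ <;> simp [lm] at h ⊢
  exact ⟨he h.2, h.1⟩

theorem mem_lb' {V G : Type} {e : Fin 3 → V} (he : Function.Injective e)
    (r : Finset (Option (Fin 3 × G))) (o) : lm e o ∈ lb e r ↔ o ∈ r := by
  rw [mem_lb]
  constructor
  · rintro ⟨o', h, h'⟩; rwa [lm_inj he h']
  · exact fun h => ⟨o, h, rfl⟩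

structure PG (V HV G C HG : Type) where
  Q : RDS (Option V) HV
  T : TDc G C
  L : PLine G C HG
  eG : Finset (Option V) → Fin 4 → V
  eL : Finset (Option V) → Fin 3 → V
  iG : ∀ b ∈ Q.B, none ∉ b → Function.Injective (eG b)
  iL : ∀ b ∈ Q.B, none ∈ b → Function.Injective (eL b)
  hG : ∀ b ∈ Q.B, none ∉ b → ∀ z, z ∈ b ↔ ∃ j, z = some (eG b j)
  hL : ∀ b ∈ Q.B, none ∈ b → ∀ z, z ∈ b ↔ z = none ∨ ∃ j, z = some (eL b j)
  pr : ∀ u u' : Option V, ∃ b ∈ Q.B, none ∈ b ∧ u ∈ b ∧ u' ∈ b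

namespace PG
variable {V HV G C HG : Type} (M : PG V HV G C HG)

def B : Set (Finset (Option (G × V))) :=
  {β | (∃ b ∈ M.Q.B, none ∉ b ∧ ∃ x ∈ M.T.S, β = tb (M.eG b) x) ∨
    (∃ b ∈ M.Q.B, none ∈ b ∧ ∃ r ∈ M.L.B, β = lb (M.eL b) r)}

def K (y : Option (G × V)) (h : (HV × C) ⊕ HG) (β : Finset (Option (G × V))) : Prop :=
  (∃ b ∈ M.Q.B, none ∉ b ∧ ∃ x ∈ M.T.S, ∃ j c, M.T.K j c x ∧ y = some (x j, M.eG b j) ∧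
    h = Sum.inl (M.Q.κ (vpt y) b, c) ∧ β = tb (M.eG b) x) ∨
  (∃ b ∈ M.Q.B, none ∈ b ∧ ∃ r ∈ M.L.B, ∃ o ∈ r, ∃ c, M.L.K o (Sum.inl c) r ∧ y = lm (M.eL b) o ∧
    h = Sum.inl (M.Q.κ (vpt y) b, c) ∧ β = lb (M.eL b) r) ∨
  (∃ b ∈ M.Q.B, none ∈ b ∧ ∃ r ∈ M.L.B, ∃ o ∈ r, ∃ c, M.L.K o (Sum.inr c) r ∧ y = lm (M.eL b) o ∧
    h = Sum.inr c ∧ β = lb (M.eL b) r)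

theorem vG {b} (hb : b ∈ M.Q.B) (hn : none ∉ b) {x y} (hy : y ∈ tb (G := G) (M.eG b) x) :
    vpt y ∈ b := by
  obtain ⟨j, rfl⟩ := (mem_tb _ _ _).1 hy
  exact (M.hG b hb hn _).2 ⟨j, rfl⟩

theorem vG' {b} (hb : b ∈ M.Q.B) (hn : none ∉ b) {x y y'} (hy : y ∈ tb (G := G) (M.eG b) x)
    (hy' : y' ∈ tb (M.eG b) x) (h : vpt y = vpt y') : y = y' := by
  obtain ⟨j, rfl⟩ := (mem_tb _ _ _).1 hy
  obtain ⟨j', rfl⟩ := (mem_tb _ _ _).1 hy'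
  simp [vpt] at h
  rw [M.iG b hb hn h]

theorem vL {b} (hb : b ∈ M.Q.B) (hn : none ∈ b) (o : Option (Fin 3 × G)) :
    vpt (lm (M.eL b) o) ∈ b := by
  rw [M.hL b hb hn]
  rcases o with _ | ⟨p, g⟩
  · left; rfl
  · right; exact ⟨p, rfl⟩

theorem vL' {b} (hb : b ∈ M.Q.B) (hn : none ∈ b) {y : Option (G × V)} (hy : vpt y ∈ b) :
    ∃ o, y = lm (M.eL b) o := by
  rcases y with _ | ⟨g, v⟩
  · exact ⟨none, rfl⟩
  · rcases (M.hL b hb hn _).1 hy with h | ⟨j, h⟩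
    · simp [vpt] at h
    · simp [vpt] at h
      exact ⟨some (j, g), by simp [lm, h]⟩

theorem c4 : ∀ b ∈ M.B, b.card = 4 := by
  classical
  rintro β (⟨b, hb, hn, x, hx, rfl⟩ | ⟨b, hb, hn, r, hr, rfl⟩)
  · rw [tb, Finset.card_image_of_injective]
    · simp
    · intro i j h
      simp at h
      exact M.iG b hb hn h.2
  · rw [lb, Finset.card_image_of_injective _ (lm_inj (M.iL b hb hn))]
    exact M.L.c4 r hr

theorem ex : ∀ x y z, x ≠ y → x ≠ z → y ≠ z → ∃ b ∈ M.B, x ∈ b ∧ y ∈ b ∧ z ∈ b := by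
  intro x y z h1 h2 h3
  have key : (∃ b ∈ M.Q.B, none ∈ b ∧ vpt x ∈ b ∧ vpt y ∈ b ∧ vpt z ∈ b) ∨
      (∃ b ∈ M.Q.B, none ∉ b ∧ vpt x ∈ b ∧ vpt y ∈ b ∧ vpt z ∈ b ∧ vpt x ≠ vpt y ∧ vpt x ≠ vpt z ∧
        vpt y ≠ vpt z) := by
    by_cases a1 : vpt x = vpt y
    · obtain ⟨b, hb, c1, c2, c3⟩ := M.pr (vpt x) (vpt z)
      exact Or.inl ⟨b, hb, c1, c2, a1 ▸ c2, c3⟩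
    by_cases a2 : vpt x = vpt z
    · obtain ⟨b, hb, c1, c2, c3⟩ := M.pr (vpt x) (vpt y)
      exact Or.inl ⟨b, hb, c1, c2, c3, a2 ▸ c2⟩
    by_cases a3 : vpt y = vpt z
    · obtain ⟨b, hb, c1, c2, c3⟩ := M.pr (vpt x) (vpt y)
      exact Or.inl ⟨b, hb, c1, c2, c3, a3 ▸ c3⟩
    obtain ⟨b, hb, c1, c2, c3⟩ := M.Q.ex _ _ _ a1 a2 a3
    by_cases hn : none ∈ b
    · exact Or.inl ⟨b, hb, hn, c1, c2, c3⟩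
    · exact Or.inr ⟨b, hb, hn, c1, c2, c3, a1, a2, a3⟩
  rcases key with ⟨b, hb, hn, c1, c2, c3⟩ | ⟨b, hb, hn, c1, c2, c3, a1, a2, a3⟩
  · obtain ⟨o1, rfl⟩ := M.vL' hb hn c1
    obtain ⟨o2, rfl⟩ := M.vL' hb hn c2
    obtain ⟨o3, rfl⟩ := M.vL' hb hn c3
    obtain ⟨r, hr, d1, d2, d3⟩ := M.L.ex o1 o2 o3 (fun h => h1 (by rw [h])) (fun h => h2 (by rw [h]))
      (fun h => h3 (by rw [h]))
    exact ⟨_, Or.inr ⟨b, hb, hn, r, hr, rfl⟩, (mem_lb _ _ _).2 ⟨_, d1, rfl⟩,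
      (mem_lb _ _ _).2 ⟨_, d2, rfl⟩, (mem_lb _ _ _).2 ⟨_, d3, rfl⟩⟩
  · have pt : ∀ w : Option (G × V), vpt w ∈ b → ∃ j g, w = some (g, M.eG b j) := by
      intro w hw
      obtain ⟨j, hj⟩ := (M.hG b hb hn _).1 hw
      rcases w with _ | ⟨g, v⟩
      · simp [vpt] at hj
      · simp [vpt] at hj
        exact ⟨j, g, by rw [hj]⟩
    obtain ⟨i, g1, rfl⟩ := pt x c1
    obtain ⟨j, g2, rfl⟩ := pt y c2
    obtain ⟨k, g3, rfl⟩ := pt z c3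
    obtain ⟨s, hs, d1, d2, d3⟩ := M.T.ex i j k (by rintro rfl; exact a1 rfl) (by rintro rfl; exact a2 rfl)
      (by rintro rfl; exact a3 rfl) g1 g2 g3
    exact ⟨_, Or.inl ⟨b, hb, hn, s, hs, rfl⟩, (mem_tb _ _ _).2 ⟨i, by rw [d1]⟩,
      (mem_tb _ _ _).2 ⟨j, by rw [d2]⟩, (mem_tb _ _ _).2 ⟨k, by rw [d3]⟩⟩

theorem col : ∀ β ∈ M.B, ∀ x ∈ β, ∃ h, M.K x h β := by
  rintro β (⟨b, hb, hn, s, hs, rfl⟩ | ⟨b, hb, hn, r, hr, rfl⟩) x hx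
  · obtain ⟨j, rfl⟩ := (mem_tb _ _ _).1 hx
    obtain ⟨c, hc⟩ := M.T.col s hs j
    exact ⟨_, Or.inl ⟨b, hb, hn, s, hs, j, c, hc, rfl, rfl, rfl⟩⟩
  · obtain ⟨o, ho, rfl⟩ := (mem_lb _ _ _).1 hx
    obtain ⟨c | c, hc⟩ := M.L.col r hr o ho
    · exact ⟨_, Or.inr (Or.inl ⟨b, hb, hn, r, hr, o, ho, c, hc, rfl, rfl, rfl⟩)⟩
    · exact ⟨_, Or.inr (Or.inr ⟨b, hb, hn, r, hr, o, ho, c, hc, rfl, rfl, rfl⟩)⟩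

/-- Two equally coloured local line blocks over the same base block. -/
theorem injL {b} (hb : b ∈ M.Q.B) (hn : none ∈ b) {r r'} (hr : r ∈ M.L.B) (hr' : r' ∈ M.L.B)
    {o o' y' c} (ho : o ∈ r) (ho' : o' ∈ r') (hk : M.L.K o c r) (hk' : M.L.K o' c r')
    (hoo : lm (M.eL b) o = lm (M.eL b) o') (hne : lm (M.eL b) o ≠ y')
    (h1 : y' ∈ lb (M.eL b) r) (h2 : y' ∈ lb (M.eL b) r') : r = r' := by
  have hi := M.iL b hb hn
  have := lm_inj hi hoo
  subst this
  obtain ⟨w, hw, rfl⟩ := (mem_lb _ _ _).1 h1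
  rw [mem_lb' hi] at h2
  exact M.L.inj r hr r' hr' o w c (fun h => hne (by rw [h])) ho hw ho' h2 hk hk'

def cm (v : V) : Option G → Option (G × V) := Option.map (fun g => (g, v))

theorem lm_colm (e : Fin 3 → V) (p) (w : Option G) : lm e (colm p w) = cm (e p) w := by
  cases w <;> rfl

theorem cm_inj (v : V) : Function.Injective (cm (G := G) v) := by
  intro a b h
  cases a <;> cases b <;> simp [cm] at h ⊢
  exact h

/-- Column shape of inr coloured blocks. -/
theorem colShape {b} (hb : b ∈ M.Q.B) (hn : none ∈ b) {r} (hr : r ∈ M.L.B) {o c y'} (ho : o ∈ r)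
    (hk : M.L.K o (Sum.inr c) r) (hne : lm (M.eL b) o ≠ y') (h1 : y' ∈ lb (M.eL b) r)
    (hv : vpt (lm (M.eL b) o) = none ∨ vpt y' = none ∨ vpt y' = vpt (lm (M.eL b) o)) :
    ∃ ρ ∈ M.L.RB, ∃ v, (∀ z, z ∈ lb (M.eL b) r ↔ ∃ w ∈ ρ, z = cm v w) ∧
      ∃ w, lm (M.eL b) o = cm v w ∧ M.L.RK w c ρ := by
  have hi := M.iL b hb hn
  have fin : ∀ p, ∀ ρ : Finset (Option G), (∀ z, z ∈ r ↔ ∃ w ∈ ρ, z = colm p w) →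
      ∀ z, z ∈ lb (M.eL b) r ↔ ∃ w ∈ ρ, z = cm (M.eL b p) w := by
    intro p ρ h z
    rw [mem_lb]
    constructor
    · rintro ⟨o, ho, rfl⟩
      obtain ⟨w, hw, rfl⟩ := (h o).1 ho
      exact ⟨w, hw, lm_colm _ _ _⟩
    · rintro ⟨w, hw, rfl⟩
      exact ⟨colm p w, (h _).2 ⟨w, hw, rfl⟩, (lm_colm _ _ _).symm⟩
  rcases o with _ | ⟨p, g⟩
  · obtain ⟨ρ, hρ, p, h2, h3⟩ := M.L.cN r hr c hk ho
    exact ⟨ρ, hρ, _, fin p ρ h2, none, rfl, h3⟩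
  · obtain ⟨w, hw, rfl⟩ := (mem_lb _ _ _).1 h1
    have hy : ∃ y, w = colm p y := by
      rcases hv with hv | hv | hv
      · simp [vpt, lm] at hv
      · rcases w with _ | ⟨q, g'⟩
        · exact ⟨none, rfl⟩
        · simp [vpt, lm] at hv
      · rcases w with _ | ⟨q, g'⟩
        · exact ⟨none, rfl⟩
        · simp [vpt, lm] at hv
          exact ⟨some g', by rw [hi hv]; rfl⟩
    obtain ⟨y, rfl⟩ := hy
    obtain ⟨ρ, hρ, h2, h3⟩ := M.L.cR r hr p g c y hk ho hw (by rintro rfl; exact hne rfl)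
    exact ⟨ρ, hρ, _, fin p ρ h2, some g, rfl, h3⟩

theorem inj : ∀ β ∈ M.B, ∀ β' ∈ M.B, ∀ x y h, x ≠ y → x ∈ β → y ∈ β → x ∈ β' → y ∈ β' →
      M.K x h β → M.K x h β' → β = β' := by
  rintro β - β' - x y h hxy h1 h2 h3 h4 k1 k2
  rcases h with ⟨h, c⟩ | c
  · -- inl
    have key : ∀ {b b' : Finset (Option V)}, b ∈ M.Q.B → b' ∈ M.Q.B → vpt x ∈ b → vpt y ∈ b →
        vpt x ∈ b' → vpt y ∈ b' → M.Q.κ (vpt x) b = M.Q.κ (vpt x) b' →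
        (vpt x ≠ vpt y ∨ (none ∈ b ∧ none ∈ b')) → b = b' := by
      intro b b' hb hb' e1 e2 e3 e4 e5 e6
      by_cases hv : vpt x = vpt y
      · have e7 := e6.resolve_left (fun h => h hv)
        have hx : vpt x ≠ none := by
          intro h
          rcases x with _ | x
          · rcases y with _ | y
            · exact hxy rfl
            · simp [vpt] at hv
          · simp [vpt] at h
        exact M.Q.inj b hb b' hb' _ _ hx e1 e7.1 e3 e7.2 e5
      · exact M.Q.inj b hb b' hb' _ _ hv e1 e2 e3 e4 e5
    rcases k1 with ⟨b, hb, hn, s, hs, j, c1, hc, e1, e2, rfl⟩ | ⟨b, hb, hn, r, hr, o, ho, c1, hc, e1, e2, rfl⟩ | ⟨_, _, _, _, _, _, _, _, _, _, e2, _⟩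
    · rcases k2 with ⟨b', hb', hn', s', hs', j', c1', hc', e1', e2', rfl⟩ | ⟨b', hb', hn', r', hr', o', ho', c1', hc', e1', e2', rfl⟩ | ⟨_, _, _, _, _, _, _, _, _, _, e2', _⟩
      · simp only [Sum.inl.injEq, Prod.mk.injEq] at e2 e2'
        obtain ⟨rfl, rfl⟩ := e2
        have hv : vpt x ≠ vpt y := fun h => hxy (M.vG' hb hn h1 h2 h)
        have := key hb hb' (M.vG hb hn h1) (M.vG hb hn h2) (M.vG hb' hn' h3) (M.vG hb' hn' h4)
          e2'.1 (Or.inl hv)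
        subst this
        rw [← e2'.2] at hc'
        have hi := M.iG b hb hn
        obtain ⟨i, hyi⟩ := (mem_tb _ _ _).1 h2
        obtain ⟨i', hyi'⟩ := (mem_tb _ _ _).1 h4
        have q1 := Option.some.inj (e1.symm.trans e1')
        have q2 := Option.some.inj (hyi.symm.trans hyi')
        simp only [Prod.mk.injEq] at q1 q2
        have r1 := hi q1.2
        have r2 := hi q2.2
        subst r1 r2
        rw [M.T.inj s hs s' hs' j i c (by rintro rfl; exact hxy (e1.trans hyi.symm)) q1.1 q2.1 hc hc']
      · exfalso
        simp only [Sum.inl.injEq, Prod.mk.injEq] at e2 e2'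
        have hv : vpt x ≠ vpt y := fun h => hxy (M.vG' hb hn h1 h2 h)
        obtain ⟨w, hw, rfl⟩ := (mem_lb _ _ _).1 h4
        have := key hb hb' (M.vG hb hn h1) (M.vG hb hn h2) (by rw [e1']; exact M.vL hb' hn' _)
          (M.vL hb' hn' _) (e2.1.symm.trans e2'.1) (Or.inl hv)
        subst this
        exact hn hn'
      · simp at e2'
    · rcases k2 with ⟨b', hb', hn', s', hs', j', c1', hc', e1', e2', rfl⟩ | ⟨b', hb', hn', r', hr', o', ho', c1', hc', e1', e2', rfl⟩ | ⟨_, _, _, _, _, _, _, _, _, _, e2', _⟩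
      · exfalso
        simp only [Sum.inl.injEq, Prod.mk.injEq] at e2 e2'
        have hv : vpt x ≠ vpt y := fun h => hxy (M.vG' hb' hn' h3 h4 h)
        obtain ⟨w, hw, rfl⟩ := (mem_lb _ _ _).1 h2
        have := key hb hb' (by rw [e1]; exact M.vL hb hn _) (M.vL hb hn _)
          (M.vG hb' hn' h3) (M.vG hb' hn' h4) (e2.1.symm.trans e2'.1) (Or.inl hv)
        subst this
        exact hn' hn
      · simp only [Sum.inl.injEq, Prod.mk.injEq] at e2 e2'
        obtain ⟨w, hw, ew⟩ := (mem_lb _ _ _).1 h2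
        obtain ⟨w', hw', ew'⟩ := (mem_lb _ _ _).1 h4
        have := key hb hb' (by rw [e1]; exact M.vL hb hn _) (by rw [ew]; exact M.vL hb hn _)
          (by rw [e1']; exact M.vL hb' hn' _) (by rw [ew']; exact M.vL hb' hn' _)
          (e2.1.symm.trans e2'.1) (Or.inr ⟨hn, hn'⟩)
        subst this
        have ec : c1' = c1 := e2'.2.symm.trans e2.2
        subst ec
        rw [M.injL hb hn hr hr' ho ho' hc hc' (e1.symm.trans e1') (e1 ▸ hxy) h2 h4]
      · simp at e2'
    · simp at e2
  · rcases k1 with ⟨_, _, _, _, _, _, _, _, _, e2, _⟩ | ⟨_, _, _, _, _, _, _, _, _, _, e2, _⟩ | ⟨b, hb, hn, r, hr, o, ho, c1, hc, e1, e2, rfl⟩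
    · simp at e2
    · simp at e2
    rcases k2 with ⟨_, _, _, _, _, _, _, _, _, e2', _⟩ | ⟨_, _, _, _, _, _, _, _, _, _, e2', _⟩ | ⟨b', hb', hn', r', hr', o', ho', c1', hc', e1', e2', rfl⟩
    · simp at e2'
    · simp at e2'
    simp only [Sum.inr.injEq] at e2 e2'
    subst e2 e2'
    by_cases hv : vpt x = none ∨ vpt y = none ∨ vpt y = vpt x
    · obtain ⟨ρ, hρ, v, s1, w, s2, s3⟩ := M.colShape hb hn hr ho hc (e1 ▸ hxy) h2 (e1 ▸ hv)
      obtain ⟨ρ', hρ', v', s1', w', s2', s3'⟩ := M.colShape hb' hn' hr' ho' hc' (e1' ▸ hxy) h4 (e1' ▸ hv)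
      rw [← e1] at s2
      rw [← e1'] at s2'
      have h1' := (s1 _).1 h1
      have h2' := (s1 _).1 h2
      have h3' := (s1' _).1 h3
      have h4' := (s1' _).1 h4
      have ce : ∀ (w1 w2 : Option G) (v v' : V), cm v w1 = cm v' w2 → cm v w1 ≠ none → v = v' := by
        intro w1 w2 v v' h h'
        cases w1 <;> cases w2 <;> simp [cm] at h h'
        exact h.2
      have ev : v = v' := by
        have : x ≠ none ∨ y ≠ none := by
          by_contra! h
          exact hxy (h.1.trans h.2.symm)
        rcases this with h | h
        · obtain ⟨w1, _, q1⟩ := h1'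
          obtain ⟨w2, _, q2⟩ := h3'
          exact ce w1 w2 v v' (q1.symm.trans q2) (fun e => h (q1.trans e))
        · obtain ⟨w1, _, q1⟩ := h2'
          obtain ⟨w2, _, q2⟩ := h4'
          exact ce w1 w2 v v' (q1.symm.trans q2) (fun e => h (q1.trans e))
      subst ev
      have ew : w = w' := cm_inj v (s2.symm.trans s2')
      subst ew
      obtain ⟨w1, hw1, q1⟩ := h1'
      obtain ⟨w2, hw2, q2⟩ := h2'
      obtain ⟨w3, hw3, q3⟩ := h3'
      obtain ⟨w4, hw4, q4⟩ := h4'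
      have p1 := cm_inj v (q1.symm.trans s2)
      have p3 := cm_inj v (q3.symm.trans s2)
      have p4 := cm_inj v (q4.symm.trans q2)
      subst p1 p3 p4
      have : ρ = ρ' := M.L.rinj ρ hρ ρ' hρ' w3 w4 _ (by rintro rfl; exact hxy (q1.trans q2.symm))
        hw1 hw2 hw3 hw4 s3 s3'
      subst this
      ext z
      rw [s1, s1']
    · push Not at hv
      obtain ⟨w, hw, ew⟩ := (mem_lb _ _ _).1 h2
      obtain ⟨w', hw', ew'⟩ := (mem_lb _ _ _).1 h4
      have : b = b' := M.Q.un _ _ _ hv.1 (Ne.symm hv.2.2) (Ne.symm hv.2.1) b hb b' hb'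
        (by rw [e1]; exact M.vL hb hn _) hn (by rw [ew]; exact M.vL hb hn _)
        (by rw [e1']; exact M.vL hb' hn' _) hn' (by rw [ew']; exact M.vL hb' hn' _)
      · subst this
        rw [M.injL hb hn hr hr' ho ho' hc hc' (e1.symm.trans e1') (e1 ▸ hxy) h2 h4]

end PG
end P1b

section P1c

theorem exists_PG {V HV G C HG : Type} [Fintype V] (hV : 3 ≤ Fintype.card V) (Q : RDS (Option V) HV)
    (T : TDc G C) (L : PLine G C HG) : ∃ M : PG V HV G C HG, M.Q = Q ∧ M.T = T ∧ M.L = L := by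
  classical
  have : Nonempty V := Fintype.card_pos_iff.1 (by omega)
  have h1 : ∀ b : Finset (Option V), ∃ e : Fin 4 → V, b ∈ Q.B → none ∉ b → Function.Injective e ∧
      ∀ z, z ∈ b ↔ ∃ j, z = some (e j) := by
    intro b
    by_cases h : b ∈ Q.B ∧ none ∉ b
    · let s : Finset V := b.eraseNone
      have hs : ∀ v, v ∈ s ↔ some v ∈ b := by intro v; simp [s]
      have hc : s.card = 4 := by
        rw [← Q.c4 b h.1, ← Finset.card_map Function.Embedding.some]
        congr 1
        ext z
        cases z <;> simp [hs, h.2]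
      let f := s.equivFinOfCardEq hc
      refine ⟨fun j => (f.symm j).1, fun _ _ => ⟨fun i j hij => ?_, fun z => ?_⟩⟩
      · exact f.symm.injective (Subtype.ext hij)
      · constructor
        · intro hz
          rcases z with _ | v
          · exact absurd hz h.2
          · exact ⟨f ⟨v, (hs v).2 hz⟩, by simp⟩
        · rintro ⟨j, rfl⟩
          exact (hs _).1 (f.symm j).2
    · exact ⟨fun _ => Classical.arbitrary V, fun a b => absurd ⟨a, b⟩ h⟩
  have h2 : ∀ b : Finset (Option V), ∃ e : Fin 3 → V, b ∈ Q.B → none ∈ b → Function.Injective e ∧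
      ∀ z, z ∈ b ↔ z = none ∨ ∃ j, z = some (e j) := by
    intro b
    by_cases h : b ∈ Q.B ∧ none ∈ b
    · let s : Finset V := b.eraseNone
      have hs : ∀ v, v ∈ s ↔ some v ∈ b := by intro v; simp [s]
      have hc : s.card = 3 := by
        have : b = Finset.insertNone s := by
          ext z
          cases z <;> simp [hs, h.2]
        have h4 := Q.c4 b h.1
        rw [this, Finset.card_insertNone] at h4
        omega
      let f := s.equivFinOfCardEq hc
      refine ⟨fun j => (f.symm j).1, fun _ _ => ⟨fun i j hij => ?_, fun z => ?_⟩⟩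
      · exact f.symm.injective (Subtype.ext hij)
      · constructor
        · intro hz
          rcases z with _ | v
          · exact Or.inl rfl
          · exact Or.inr ⟨f ⟨v, (hs v).2 hz⟩, by simp⟩
        · rintro (rfl | ⟨j, rfl⟩)
          · exact h.2
          · exact (hs _).1 (f.symm j).2
    · exact ⟨fun _ => Classical.arbitrary V, fun a b => absurd ⟨a, b⟩ h⟩
  choose eG hG using h1
  choose eL hL using h2
  refine ⟨⟨Q, T, L, eG, eL, fun b hb hn => (hG b hb hn).1, fun b hb hn => (hL b hb hn).1,
    fun b hb hn => (hG b hb hn).2, fun b hb hn => (hL b hb hn).2, ?_⟩, rfl, rfl, rfl⟩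
  intro u u'
  obtain ⟨t, ht, hc⟩ := Finset.exists_superset_card_eq (s := {none, u, u'}) (n := 3)
    Finset.card_le_three (by rw [Fintype.card_option]; omega)
  obtain ⟨x, y, z, hxy, hxz, hyz, rfl⟩ := Finset.card_eq_three.1 hc
  obtain ⟨b, hb, k1, k2, k3⟩ := Q.ex x y z hxy hxz hyz
  have hsub : ∀ w ∈ ({none, u, u'} : Finset (Option V)), w ∈ b := by
    intro w hw
    have := ht hw
    simp only [mem_insert, mem_singleton] at this
    rcases this with rfl | rfl | rfl <;> assumption
  exact ⟨b, hb, hsub _ (by simp), hsub _ (by simp), hsub _ (by simp)⟩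

def cmap {H : Type} : ((H × Bool) ⊕ Unit) ⊕ H → (H × Fin 3) ⊕ Unit
  | Sum.inl (Sum.inl (g, false)) => Sum.inl (g, 1)
  | Sum.inl (Sum.inl (g, true)) => Sum.inl (g, 2)
  | Sum.inl (Sum.inr _) => Sum.inr ()
  | Sum.inr g => Sum.inl (g, 0)

theorem cmap_surj {H : Type} : Function.Surjective (cmap (H := H)) := by
  rintro (⟨g, i⟩ | ⟨⟩)
  · fin_cases i
    · exact ⟨Sum.inr g, rfl⟩
    · exact ⟨Sum.inl (Sum.inl (g, false)), rfl⟩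
    · exact ⟨Sum.inl (Sum.inl (g, true)), rfl⟩
  · exact ⟨Sum.inl (Sum.inr ()), rfl⟩

theorem fin3_two (g g' : Fin 3) : g + g = g' + g' → g = g' := by revert g g'; decide

theorem td3 : ∀ x : Fin 4 → Fin 3, x 0 + x 1 = x 2 + x 3 → ∀ i j, tdK i x = 0 → i ≠ j → x i = x j →
    ∀ k, x k = x i := by decide +kernel

theorem exists_PLine {W H : Type} [Fintype W] (hW : 3 ≤ Fintype.card W) (Q : RDS (Option W) H) :
    Nonempty (PLine W ((H × Bool) ⊕ Unit) H) := by
  obtain ⟨M, hQ, hT, hL⟩ := exists_PG hW Q (tdG (Fin 3) fin3_two) pl10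
  have lines : ∀ b ∈ M.Q.B, none ∈ b → ∀ c ∈ LB10, ∀ p : Fin 3,
      (∀ z, c.1.testBit (pt10 z) = true ↔ z = none ∨ ∃ q, z = some (q, p)) →
      ∀ z, z ∈ lb (M.eL b) (bl10 c.1) ↔ ∃ w ∈ b, z = colm p w := by
    intro b hb hn c hc p h z
    rw [mem_lb]
    constructor
    · rintro ⟨o, ho, rfl⟩
      rw [mem_bl10, h] at ho
      rcases ho with rfl | ⟨q, rfl⟩
      · exact ⟨none, hn, rfl⟩
      · exact ⟨some (M.eL b q), (M.hL b hb hn _).2 (Or.inr ⟨q, rfl⟩), rfl⟩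
    · rintro ⟨w, hw, rfl⟩
      rcases (M.hL b hb hn _).1 hw with rfl | ⟨q, rfl⟩
      · exact ⟨none, by rw [mem_bl10, h]; exact Or.inl rfl, rfl⟩
      · exact ⟨some (q, p), by rw [mem_bl10, h]; exact Or.inr ⟨q, rfl⟩, rfl⟩
  refine ⟨⟨Q.B, fun x h b => Q.κ x b = h, M.B, fun x h b => M.K x (cmap h) b, M.c4, M.ex, ?_, ?_, ?_, ?_, ?_⟩⟩
  · intro b hb x hx
    obtain ⟨h, hh⟩ := M.col b hb x hx
    obtain ⟨h', rfl⟩ := cmap_surj h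
    exact ⟨h', hh⟩
  · intro b hb b' hb' x y h hxy h1 h2 h3 h4 k1 k2
    exact M.inj b hb b' hb' x y _ hxy h1 h2 h3 h4 k1 k2
  · intro b hb b' hb' x y h hxy h1 h2 h3 h4 k1 k2
    exact Q.inj b hb b' hb' x y hxy h1 h2 h3 h4 (k1.trans k2.symm)
  · rintro β - p i g y k1 h1 h2 hne
    simp only [cmap] at k1
    rcases k1 with ⟨b, hb, hn, x, hx, j, c, hc, e1, e2, rfl⟩ | ⟨b, hb, hn, r, hr, o, ho, c, hc, e1, e2, rfl⟩ | ⟨_, _, _, _, _, _, _, _, _, _, e2, _⟩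
    · simp only [Sum.inl.injEq, Prod.mk.injEq] at e2
      obtain ⟨e2, rfl⟩ := e2
      simp only [Option.some.injEq, Prod.mk.injEq] at e1
      obtain ⟨j', hj'⟩ := (mem_tb _ _ _).1 h2
      rcases y with _ | i'
      · simp [colm] at hj'
      simp only [colm, Option.map_some, Option.some.injEq, Prod.mk.injEq] at hj'
      have hcst := td3 x (by rw [hT] at hx; exact hx) j j' (by rw [hT] at hc; exact hc)
        (by rintro rfl; exact hne (by rw [hj'.2, e1.2])) (by rw [← e1.1, ← hj'.1])
      refine ⟨b, hQ ▸ hb, ?_, ?_⟩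
      · intro z
        rw [mem_tb]
        constructor
        · rintro ⟨k, rfl⟩
          exact ⟨some (M.eG b k), (M.hG b hb hn _).2 ⟨k, rfl⟩, by rw [hcst k, ← e1.1]; rfl⟩
        · rintro ⟨w, hw, rfl⟩
          obtain ⟨k, rfl⟩ := (M.hG b hb hn _).1 hw
          exact ⟨k, by rw [hcst k, ← e1.1]; rfl⟩
      · rw [e2, ← hQ]; rfl
    · simp only [Sum.inl.injEq, Prod.mk.injEq] at e2
      obtain ⟨e2, rfl⟩ := e2
      rw [hL] at hc
      obtain ⟨c, hcL, rfl, hcc⟩ := hc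
      have hi := M.iL b hb hn
      have hz := co10_z (Nat.mod_lt _ (by norm_num)) hcc
      rcases o with _ | ⟨q, p'⟩
      · simp [lm] at e1
      simp only [lm, Option.map_some, Option.some.injEq, Prod.mk.injEq] at e1
      obtain ⟨rfl, rfl⟩ := e1
      rw [mem_bl10] at ho
      obtain ⟨o', ho', e'⟩ := (mem_lb _ _ _).1 h2
      rw [mem_bl10] at ho'
      have := f10R2 c hcL q p hz ho (by
        rcases o' with _ | ⟨q', p'⟩
        · exact Or.inl ho'
        · rcases y with _ | i'
          · simp [colm, lm] at e'
          simp only [colm, lm, Option.map_some, Option.some.injEq, Prod.mk.injEq] at e'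
          obtain ⟨rfl, rfl⟩ := e'
          exact Or.inr ⟨q', by rintro rfl; exact hne rfl, ho'⟩)
      refine ⟨b, hQ ▸ hb, lines b hb hn c hcL p this, ?_⟩
      rw [e2, ← hQ]; rfl
    · simp at e2
  · rintro β - g k1 h1
    simp only [cmap] at k1
    rcases k1 with ⟨b, hb, hn, x, hx, j, c, hc, e1, e2, rfl⟩ | ⟨b, hb, hn, r, hr, o, ho, c, hc, e1, e2, rfl⟩ | ⟨_, _, _, _, _, _, _, _, _, _, e2, _⟩
    · simp at e1
    · simp only [Sum.inl.injEq, Prod.mk.injEq] at e2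
      obtain ⟨e2, rfl⟩ := e2
      rw [hL] at hc
      obtain ⟨c, hcL, rfl, hcc⟩ := hc
      have hz := co10_z (Nat.mod_lt _ (by norm_num)) hcc
      rcases o with _ | ⟨q, p'⟩
      · rw [mem_bl10] at ho
        obtain ⟨p, this⟩ := f10N2 c hcL hz ho
        refine ⟨b, hQ ▸ hb, p, lines b hb hn c hcL p this, ?_⟩
        rw [e2, ← hQ]; rfl
      · simp [lm] at e1
    · simp at e2

def TDc.rel {G C C' : Type} (T : TDc G C) (e : C' ≃ C) : TDc G C' where
  S := T.S
  K := fun i c x => T.K i (e c) x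
  ex := T.ex
  col := fun x hx i => by obtain ⟨c, hc⟩ := T.col x hx i; exact ⟨e.symm c, by simpa using hc⟩
  inj := fun x hx x' hx' i j c => T.inj x hx x' hx' i j (e c)

theorem HasRD.mul {n m k : ℕ} (hn : 0 < n) (hm : 0 < m) (h1 : HasRD n) (h2 : HasRD m)
    (hk : 2 * k + 1 = (2 * n + 1) * (2 * m + 1)) : HasRD k := by
  obtain ⟨Q1⟩ := h1.get (Option (Fin (2 * n + 1))) (Fin n) (by simp) (by simp)
  obtain ⟨Q2⟩ := h2.get (Option (ZMod (2 * m + 1))) (Fin m) (by simp [ZMod.card]) (by simp)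
  obtain ⟨L⟩ := exists_PLine (by rw [ZMod.card]; omega) Q2
  have hodd : ∀ g g' : ZMod (2 * m + 1), g + g = g' + g' → g = g' := by
    intro g g' h
    have h0 : ((2 * m + 1 : ℕ) : ZMod (2 * m + 1)) = 0 := ZMod.natCast_self _
    push_cast at h0
    have : ∀ a : ZMod (2 * m + 1), a = -((a + a) * (m : ZMod (2 * m + 1))) := by
      intro a
      linear_combination a * h0
    rw [this g, this g', h]
  have e : ((Fin m × Bool) ⊕ Unit) ≃ ZMod (2 * m + 1) := Fintype.equivOfCardEq (by
    rw [ZMod.card]; simp; omega)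
  obtain ⟨M, -⟩ := exists_PG (by simp; omega) Q1 ((tdG _ hodd).rel e) L
  have : Nonempty (Fin m) := ⟨⟨0, hm⟩⟩
  obtain ⟨r, -⟩ := RDS.mk' (X := Option (ZMod (2 * m + 1) × Fin (2 * n + 1)))
    (H := (Fin n × ((Fin m × Bool) ⊕ Unit)) ⊕ Fin m)
    (by simp [ZMod.card]; ring) M.B M.K M.c4 M.ex M.col M.inj
  exact HasRD.of r k (by simp [ZMod.card]; nlinarith) (by simp; nlinarith)

end P1c

section P2

structure Fr (G H U : Type) (β : Finset U) where
  B : Set (Finset (U × G))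
  K : U × G → U → H → Finset (U × G) → Prop
  sub : ∀ b ∈ B, ∀ y ∈ b, y.1 ∈ β
  c4 : ∀ b ∈ B, b.card = 4
  tr : ∀ b ∈ B, ∀ x ∈ b, ∀ y ∈ b, x.1 = y.1 → x = y
  ex : ∀ x y z, x.1 ∈ β → y.1 ∈ β → z.1 ∈ β → x.1 ≠ y.1 → x.1 ≠ z.1 → y.1 ≠ z.1 →
    ∃ b ∈ B, x ∈ b ∧ y ∈ b ∧ z ∈ b
  col : ∀ b ∈ B, ∀ x ∈ b, ∃ c h, K x c h b
  kc : ∀ b ∈ B, ∀ x ∈ b, ∀ c h, K x c h b → c ∈ β ∧ ∀ y ∈ b, y.1 ≠ c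
  inj : ∀ b ∈ B, ∀ b' ∈ B, ∀ x y c h, x ≠ y → x ∈ b → y ∈ b → x ∈ b' → y ∈ b' →
      K x c h b → K x c h b' → b = b'

structure LF (G H H' U : Type) (β : Finset U) where
  B : Set (Finset (U × G))
  K : U × G → (U × H) ⊕ H' → Finset (U × G) → Prop
  sub : ∀ b ∈ B, ∀ y ∈ b, y.1 ∈ β
  c4 : ∀ b ∈ B, b.card = 4
  ex : ∀ x y z, x.1 ∈ β → y.1 ∈ β → z.1 ∈ β → x ≠ y → x ≠ z → y ≠ z →
    ∃ b ∈ B, x ∈ b ∧ y ∈ b ∧ z ∈ b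
  col : ∀ b ∈ B, ∀ x ∈ b, ∃ c, K x c b
  kc : ∀ b ∈ B, ∀ x ∈ b, ∀ c h, K x (Sum.inl (c, h)) b → c ∈ β ∧ c ≠ x.1
  inj : ∀ b ∈ B, ∀ b' ∈ B, ∀ x y c, x ≠ y → x ∈ b → y ∈ b → x ∈ b' → y ∈ b' →
      K x c b → K x c b' → b = b'
  grp : ∀ b ∈ B, ∀ x ∈ b, ∀ y ∈ b, ∀ h, K x (Sum.inr h) b → x ≠ y → y.1 = x.1 →
    ∀ z, z ∈ b ↔ z.1 = x.1

def pm {V U : Type} (G : Type) (f : V ↪ U) : V × G ↪ U × G := f.prodMap (Function.Embedding.refl G)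

theorem pm_fst {V U G : Type} (f : V ↪ U) (x : V × G) : (pm G f x).1 = f x.1 := rfl

theorem pm_ex {V U G : Type} [Fintype V] (f : V ↪ U) (x : U × G) (h : x.1 ∈ univ.map f) :
    ∃ x', x = pm G f x' := by
  obtain ⟨v, -, hv⟩ := Finset.mem_map.1 h
  exact ⟨(v, x.2), Prod.ext hv.symm rfl⟩

def Fr.map {G H V U : Type} [Fintype V] (f : V ↪ U) (F : Fr G H V univ) : Fr G H U (univ.map f) where
  B := {b | ∃ b' ∈ F.B, b = b'.map (pm G f)}
  K := fun x c h b => ∃ x' c', ∃ b' ∈ F.B, x = pm G f x' ∧ c = f c' ∧ b = b'.map (pm G f) ∧ F.K x' c' h b'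
  sub := by
    rintro _ ⟨b, hb, rfl⟩ y hy
    obtain ⟨x, hx, rfl⟩ := Finset.mem_map.1 hy
    rw [pm_fst]; simp
  c4 := by
    rintro _ ⟨b, hb, rfl⟩
    rw [card_map]; exact F.c4 b hb
  tr := by
    rintro _ ⟨b, hb, rfl⟩ x hx y hy h
    obtain ⟨x, hx', rfl⟩ := Finset.mem_map.1 hx
    obtain ⟨y, hy', rfl⟩ := Finset.mem_map.1 hy
    rw [F.tr b hb x hx' y hy' (f.injective h)]
  ex := by
    intro x y z h1 h2 h3 h4 h5 h6
    obtain ⟨x, rfl⟩ := pm_ex f x h1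
    obtain ⟨y, rfl⟩ := pm_ex f y h2
    obtain ⟨z, rfl⟩ := pm_ex f z h3
    obtain ⟨b, hb, k1, k2, k3⟩ := F.ex x y z (by simp) (by simp) (by simp) (fun h => h4 (by rw [pm_fst, pm_fst, h]))
      (fun h => h5 (by rw [pm_fst, pm_fst, h])) (fun h => h6 (by rw [pm_fst, pm_fst, h]))
    exact ⟨_, ⟨b, hb, rfl⟩, Finset.mem_map_of_mem _ k1, Finset.mem_map_of_mem _ k2, Finset.mem_map_of_mem _ k3⟩
  col := by
    rintro _ ⟨b, hb, rfl⟩ x hx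
    obtain ⟨x, hx', rfl⟩ := Finset.mem_map.1 hx
    obtain ⟨c, h, k⟩ := F.col b hb x hx'
    exact ⟨_, h, x, c, b, hb, rfl, rfl, rfl, k⟩
  kc := by
    rintro _ - x hx _ h ⟨x', c, b, hb, rfl, rfl, rfl, k⟩
    refine ⟨by simp, ?_⟩
    intro y hy
    obtain ⟨y, hy', rfl⟩ := Finset.mem_map.1 hy
    rw [Finset.mem_map' ] at hx
    rw [pm_fst]
    exact fun h' => (F.kc b hb x' hx c h k).2 y hy' (f.injective h')
  inj := by
    rintro _ - _ - x y _ h hxy h1 h2 h3 h4 ⟨x', c, b, hb, rfl, rfl, rfl, k⟩ ⟨x'', c', b', hb', e1, e2, rfl, k'⟩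
    have := (pm G f).injective e1
    have e3 := f.injective e2
    subst this e3
    rw [Finset.mem_map'] at h1 h3
    obtain ⟨y, hy, rfl⟩ := Finset.mem_map.1 h2
    rw [Finset.mem_map'] at h4
    rw [F.inj b hb b' hb' x' y c h (fun h => hxy (by rw [h])) h1 hy h3 h4 k k']

def LF.map {G H H' V U : Type} [Fintype V] (f : V ↪ U) (F : LF G H H' V univ) :
    LF G H H' U (univ.map f) where
  B := {b | ∃ b' ∈ F.B, b = b'.map (pm G f)}
  K := fun x c b => ∃ x' c', ∃ b' ∈ F.B, x = pm G f x' ∧ c = Sum.map (Prod.map f id) id c' ∧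
    b = b'.map (pm G f) ∧ F.K x' c' b'
  sub := by
    rintro _ ⟨b, hb, rfl⟩ y hy
    obtain ⟨x, hx, rfl⟩ := Finset.mem_map.1 hy
    rw [pm_fst]; simp
  c4 := by
    rintro _ ⟨b, hb, rfl⟩
    rw [card_map]; exact F.c4 b hb
  ex := by
    intro x y z h1 h2 h3 h4 h5 h6
    obtain ⟨x, rfl⟩ := pm_ex f x h1
    obtain ⟨y, rfl⟩ := pm_ex f y h2
    obtain ⟨z, rfl⟩ := pm_ex f z h3
    obtain ⟨b, hb, k1, k2, k3⟩ := F.ex x y z (by simp) (by simp) (by simp) (fun h => h4 (by rw [h]))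
      (fun h => h5 (by rw [h])) (fun h => h6 (by rw [h]))
    exact ⟨_, ⟨b, hb, rfl⟩, Finset.mem_map_of_mem _ k1, Finset.mem_map_of_mem _ k2, Finset.mem_map_of_mem _ k3⟩
  col := by
    rintro _ ⟨b, hb, rfl⟩ x hx
    obtain ⟨x, hx', rfl⟩ := Finset.mem_map.1 hx
    obtain ⟨c, k⟩ := F.col b hb x hx'
    exact ⟨_, x, c, b, hb, rfl, rfl, rfl, k⟩
  kc := by
    rintro _ - x hx _ h ⟨x', c, b, hb, rfl, e, rfl, k⟩
    rcases c with ⟨c, h'⟩ | c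
    · simp at e
      obtain ⟨rfl, rfl⟩ := e
      rw [Finset.mem_map' ] at hx
      refine ⟨by simp, ?_⟩
      rw [pm_fst]
      exact fun h' => (F.kc b hb x' hx c h k).2 (f.injective h')
    · simp at e
  inj := by
    rintro _ - _ - x y _ hxy h1 h2 h3 h4 ⟨x', c, b, hb, rfl, rfl, rfl, k⟩ ⟨x'', c', b', hb', e1, e2, rfl, k'⟩
    have := (pm G f).injective e1
    have e3 : c = c' := by
      rcases c with ⟨c, h⟩ | c <;> rcases c' with ⟨c', h'⟩ | c' <;> simp at e2
      · rw [e2.1, e2.2]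
      · rw [e2]
    subst this e3
    rw [Finset.mem_map'] at h1 h3
    obtain ⟨y, hy, rfl⟩ := Finset.mem_map.1 h2
    rw [Finset.mem_map'] at h4
    rw [F.inj b hb b' hb' x' y c (fun h => hxy (by rw [h])) h1 hy h3 h4 k k']
  grp := by
    rintro _ - x hx y hy h ⟨x', c, b, hb, rfl, e, rfl, k⟩ hxy e1 z
    rcases c with ⟨c, h'⟩ | c
    · simp at e
    simp at e
    subst e
    rw [Finset.mem_map' ] at hx
    obtain ⟨y, hy', rfl⟩ := Finset.mem_map.1 hy
    have := F.grp b hb x' hx y hy' h k (fun h => hxy (by rw [h])) (f.injective e1)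
    rw [Finset.mem_map]
    constructor
    · rintro ⟨w, hw, rfl⟩
      rw [pm_fst, pm_fst, (this w).1 hw]
    · intro hz
      exact ⟨(x'.1, z.2), (this _).2 rfl, Prod.ext hz.symm rfl⟩

theorem emb_of_card {U : Type} {k : ℕ} (β : Finset U) (h : β.card = k) :
    ∃ f : Fin k ↪ U, univ.map f = β := by
  let e := β.equivFinOfCardEq h
  refine ⟨⟨fun i => (e.symm i).1, fun i j hij => e.symm.injective (Subtype.ext hij)⟩, ?_⟩
  ext u
  simp only [mem_map, mem_univ, true_and, Function.Embedding.coeFn_mk]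
  constructor
  · rintro ⟨i, rfl⟩; exact (e.symm i).2
  · intro hu; exact ⟨e ⟨u, hu⟩, congrArg Subtype.val (e.symm_apply_apply ⟨u, hu⟩)⟩

theorem Fr.on {G H U : Type} {k : ℕ} (F : Fr G H (Fin k) univ) (β : Finset U) (h : β.card = k) :
    Nonempty (Fr G H U β) := by
  obtain ⟨f, rfl⟩ := emb_of_card β h
  exact ⟨F.map f⟩

theorem LF.on {G H H' U : Type} {k : ℕ} (F : LF G H H' (Fin k) univ) (β : Finset U) (h : β.card = k) :
    Nonempty (LF G H H' U β) := by
  obtain ⟨f, rfl⟩ := emb_of_card β h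
  exact ⟨F.map f⟩

theorem fillGlue {G H H' U : Type} [Fintype G] [Fintype H] [Fintype H'] [Fintype U] [Nonempty H]
    (hU : 2 ≤ Fintype.card U)
    (hG : Fintype.card U * Fintype.card G = 2 * ((Fintype.card U - 1) * Fintype.card H + Fintype.card H') + 2)
    (D1 D2 : Set (Finset U))
    (ex1 : ∀ a b c : U, a ≠ b → a ≠ c → b ≠ c → (∃ β ∈ D1, a ∈ β ∧ b ∈ β ∧ c ∈ β) ∨
      ∃ β ∈ D2, a ∈ β ∧ b ∈ β ∧ c ∈ β)
    (ex2 : ∀ a b : U, a ≠ b → ∃ β ∈ D2, a ∈ β ∧ b ∈ β)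
    (un1 : ∀ a b c : U, a ≠ b → a ≠ c → b ≠ c → ∀ β ∈ D1, ∀ β' ∈ D1, a ∈ β → b ∈ β → c ∈ β →
      a ∈ β' → b ∈ β' → c ∈ β' → β = β')
    (un12 : ∀ a b c : U, a ≠ b → a ≠ c → b ≠ c → ∀ β ∈ D1, ∀ β' ∈ D2, a ∈ β → b ∈ β → c ∈ β →
      a ∈ β' → b ∈ β' → c ∈ β' → False)
    (un2 : ∀ a b : U, a ≠ b → ∀ β ∈ D2, ∀ β' ∈ D2, a ∈ β → b ∈ β →
      a ∈ β' → b ∈ β' → β = β')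
    (hF : ∀ β ∈ D1, Nonempty (Fr G H U β)) (hL : ∀ β ∈ D2, Nonempty (LF G H H' U β)) :
    Nonempty (RDS (U × G) ((Fin (Fintype.card U - 1) × H) ⊕ H')) := by
  classical
  let F : ∀ β : {β // β ∈ D1}, Fr G H U β.1 := fun β => (hF β.1 β.2).some
  let L : ∀ β : {β // β ∈ D2}, LF G H H' U β.1 := fun β => (hL β.1 β.2).some
  have hcol : ∀ a : U, ∃ f : Fin (Fintype.card U - 1) → U, ∀ c, c ≠ a → ∃ i, f i = c := by
    intro a
    have e : Fin (Fintype.card U - 1) ≃ {c // c ≠ a} := Fintype.equivOfCardEq (by simp)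
    exact ⟨fun i => (e i).1, fun c hc => ⟨e.symm ⟨c, hc⟩, by simp⟩⟩
  choose f hf using hcol
  have : Nonempty (Fin (Fintype.card U - 1)) := ⟨⟨0, by omega⟩⟩
  have := RDS.mk' (X := U × G) (H := (Fin (Fintype.card U - 1) × H) ⊕ H')
    (by simpa [Fintype.card_prod] using hG)
    {b | (∃ β, b ∈ (F β).B) ∨ ∃ β, b ∈ (L β).B}
    (fun x c b => (∃ β, b ∈ (F β).B ∧ ∃ i h, c = Sum.inl (i, h) ∧ (F β).K x (f x.1 i) h b) ∨
      (∃ β, b ∈ (L β).B ∧ (L β).K x (Sum.map (Prod.map (f x.1) id) id c) b))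
    (by
      rintro b (⟨β, hb⟩ | ⟨β, hb⟩)
      · exact (F β).c4 b hb
      · exact (L β).c4 b hb)
    (by
      intro x y z h1 h2 h3
      have key : (∃ β ∈ D2, x.1 ∈ β ∧ y.1 ∈ β ∧ z.1 ∈ β) ∨ (∃ β ∈ D1, x.1 ∈ β ∧ y.1 ∈ β ∧ z.1 ∈ β ∧
          x.1 ≠ y.1 ∧ x.1 ≠ z.1 ∧ y.1 ≠ z.1) := by
        have pr : ∀ a b : U, ∃ β ∈ D2, a ∈ β ∧ b ∈ β := by
          intro a b
          by_cases h : a = b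
          · subst h
            obtain ⟨c, hc⟩ := Fintype.exists_ne_of_one_lt_card (by omega : 1 < Fintype.card U) a
            obtain ⟨β, h1, h2, h3⟩ := ex2 a c hc.symm
            exact ⟨β, h1, h2, h2⟩
          · exact ex2 a b h
        by_cases a1 : x.1 = y.1
        · obtain ⟨β, c0, c1, c2⟩ := pr x.1 z.1
          exact Or.inl ⟨β, c0, c1, a1 ▸ c1, c2⟩
        by_cases a2 : x.1 = z.1
        · obtain ⟨β, c0, c1, c2⟩ := pr x.1 y.1
          exact Or.inl ⟨β, c0, c1, c2, a2 ▸ c1⟩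
        by_cases a3 : y.1 = z.1
        · obtain ⟨β, c0, c1, c2⟩ := pr x.1 y.1
          exact Or.inl ⟨β, c0, c1, c2, a3 ▸ c2⟩
        rcases ex1 _ _ _ a1 a2 a3 with ⟨β, hβ, c1, c2, c3⟩ | h
        · exact Or.inr ⟨β, hβ, c1, c2, c3, a1, a2, a3⟩
        · exact Or.inl h
      rcases key with ⟨β, hβ, c1, c2, c3⟩ | ⟨β, hβ, c1, c2, c3, a1, a2, a3⟩
      · obtain ⟨b, hb, h⟩ := (L ⟨β, hβ⟩).ex x y z c1 c2 c3 h1 h2 h3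
        exact ⟨b, Or.inr ⟨_, hb⟩, h⟩
      · obtain ⟨b, hb, h⟩ := (F ⟨β, hβ⟩).ex x y z c1 c2 c3 a1 a2 a3
        exact ⟨b, Or.inl ⟨_, hb⟩, h⟩)
    (by
      rintro b (⟨β, hb⟩ | ⟨β, hb⟩) x hx
      · obtain ⟨c, h, k⟩ := (F β).col b hb x hx
        obtain ⟨i, rfl⟩ := hf x.1 c (((F β).kc b hb x hx c h k).2 x hx).symm
        exact ⟨_, Or.inl ⟨β, hb, i, h, rfl, k⟩⟩
      · obtain ⟨⟨c, h⟩ | h, k⟩ := (L β).col b hb x hx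
        · obtain ⟨i, rfl⟩ := hf x.1 c ((L β).kc b hb x hx c h k).2
          exact ⟨Sum.inl (i, h), Or.inr ⟨β, hb, k⟩⟩
        · exact ⟨Sum.inr h, Or.inr ⟨β, hb, k⟩⟩)
    (by
      rintro b - b' - x y c hxy h1 h2 h3 h4 k k'
      rcases k with ⟨β, hb, i, h, rfl, k⟩ | ⟨β, hb, k⟩
      · rcases k' with ⟨β', hb', i', h', e, k'⟩ | ⟨β', hb', k'⟩
        · simp only [Sum.inl.injEq, Prod.mk.injEq] at e
          obtain ⟨rfl, rfl⟩ := e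
          have q := (F β).kc b hb x h1 _ _ k
          have q' := (F β').kc b' hb' x h3 _ _ k'
          have e := un1 x.1 y.1 (f x.1 i) (fun h => hxy ((F β).tr b hb x h1 y h2 h)) (q.2 x h1) (q.2 y h2)
            β.1 β.2 β'.1 β'.2 ((F β).sub b hb x h1) ((F β).sub b hb y h2) q.1
            ((F β').sub b' hb' x h3) ((F β').sub b' hb' y h4) q'.1
          obtain rfl := Subtype.ext e
          exact (F β).inj b hb b' hb' x y _ _ hxy h1 h2 h3 h4 k k'
        · exfalso
          have q := (F β).kc b hb x h1 _ _ k
          have q' := (L β').kc b' hb' x h3 _ _ k'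
          exact un12 x.1 y.1 (f x.1 i) (fun h => hxy ((F β).tr b hb x h1 y h2 h)) (q.2 x h1) (q.2 y h2)
            β.1 β.2 β'.1 β'.2 ((F β).sub b hb x h1) ((F β).sub b hb y h2) q.1
            ((L β').sub b' hb' x h3) ((L β').sub b' hb' y h4) q'.1
      · rcases k' with ⟨β', hb', i', h', rfl, k'⟩ | ⟨β', hb', k'⟩
        · exfalso
          have q := (F β').kc b' hb' x h3 _ _ k'
          have q' := (L β).kc b hb x h1 _ _ k
          exact un12 x.1 y.1 (f x.1 i') (fun h => hxy ((F β').tr b' hb' x h3 y h4 h)) (q.2 x h3) (q.2 y h4)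
            β'.1 β'.2 β.1 β.2 ((F β').sub b' hb' x h3) ((F β').sub b' hb' y h4) q.1
            ((L β).sub b hb x h1) ((L β).sub b hb y h2) q'.1
        · rcases c with ⟨i, h⟩ | h
          · have q := (L β).kc b hb x h1 _ _ k
            have q' := (L β').kc b' hb' x h3 _ _ k'
            have e := un2 x.1 (f x.1 i) q.2.symm β.1 β.2 β'.1 β'.2 ((L β).sub b hb x h1) q.1
              ((L β').sub b' hb' x h3) q'.1
            obtain rfl := Subtype.ext e
            exact (L β).inj b hb b' hb' x y _ hxy h1 h2 h3 h4 k k'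
          · by_cases hv : y.1 = x.1
            · have g1 := (L β).grp b hb x h1 y h2 h k hxy hv
              have g2 := (L β').grp b' hb' x h3 y h4 h k' hxy hv
              ext z
              rw [g1, g2]
            · have e := un2 x.1 y.1 (Ne.symm hv) β.1 β.2 β'.1 β'.2 ((L β).sub b hb x h1) ((L β).sub b hb y h2)
                ((L β').sub b' hb' x h3) ((L β').sub b' hb' y h4)
              obtain rfl := Subtype.ext e
              exact (L β).inj b hb b' hb' x y _ hxy h1 h2 h3 h4 k k')
  exact ⟨this.choose⟩

end P2

section P3
open OnePoint Matrix

def Stn (k : ℕ) (U : Type) : Prop := ∃ D : Set (Finset U), (∀ β ∈ D, β.card = k) ∧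
  (∀ a b c : U, a ≠ b → a ≠ c → b ≠ c → ∃ β ∈ D, a ∈ β ∧ b ∈ β ∧ c ∈ β) ∧
  (∀ a b c : U, a ≠ b → a ≠ c → b ≠ c → ∀ β ∈ D, ∀ β' ∈ D, a ∈ β → b ∈ β → c ∈ β →
      a ∈ β' → b ∈ β' → c ∈ β' → β = β')

variable {K : Type} [Field K] [DecidableEq K]

noncomputable def mg (a b c d : K) (h : a * d - b * c ≠ 0) : GL (Fin 2) K :=
  GeneralLinearGroup.mkOfDetNeZero !![a, b; c, d] (by rw [det_fin_two_of]; exact h)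

theorem mg_inf (a b c d : K) (h : a * d - b * c ≠ 0) :
    mg a b c d h • (∞ : OnePoint K) = if c = 0 then ∞ else ((a / c : K) : OnePoint K) := by
  rw [smul_infty_eq_ite]; simp [mg, GeneralLinearGroup.mkOfDetNeZero]

theorem mg_some (a b c d : K) (h : a * d - b * c ≠ 0) (k : K) :
    mg a b c d h • (k : OnePoint K) = if c * k + d = 0 then ∞ else (((a * k + b) / (c * k + d) : K) : OnePoint K) := by
  rw [smul_some_eq_ite]; simp [mg, GeneralLinearGroup.mkOfDetNeZero]

theorem gl1 (x : OnePoint K) : ∃ g : GL (Fin 2) K, g • (∞ : OnePoint K) = x := by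
  induction x using OnePoint.rec with
  | infty => exact ⟨1, one_smul _ _⟩
  | coe a => exact ⟨mg a (-1) 1 0 (by simp), by rw [mg_inf]; simp⟩

theorem gl3 (x y z : OnePoint K) (h1 : x ≠ y) (h2 : x ≠ z) (h3 : y ≠ z) :
    ∃ g : GL (Fin 2) K, g • (∞ : OnePoint K) = x ∧ g • ((0 : K) : OnePoint K) = y ∧
      g • ((1 : K) : OnePoint K) = z := by
  obtain ⟨g, rfl⟩ := gl1 x
  obtain ⟨y, rfl⟩ : ∃ y', y = g • y' := ⟨g⁻¹ • y, by simp⟩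
  obtain ⟨z, rfl⟩ : ∃ y', z = g • y' := ⟨g⁻¹ • z, by simp⟩
  induction y using OnePoint.rec with
  | infty => exact absurd rfl h1
  | coe y =>
  induction z using OnePoint.rec with
  | infty => exact absurd rfl h2
  | coe z =>
    have hyz : z - y ≠ 0 := fun h => h3 (by rw [sub_eq_zero.1 h])
    refine ⟨g * mg (z - y) y 0 1 (by simpa using hyz), ?_, ?_, ?_⟩
    · rw [mul_smul, mg_inf]; simp
    · rw [mul_smul, mg_some]; simp
    · rw [mul_smul, mg_some]; simp

theorem gl_stab (g : GL (Fin 2) K) (h1 : g • (∞ : OnePoint K) = ∞)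
    (h2 : g • ((0 : K) : OnePoint K) = ((0 : K) : OnePoint K))
    (h3 : g • ((1 : K) : OnePoint K) = ((1 : K) : OnePoint K)) (x : OnePoint K) : g • x = x := by
  rw [smul_infty_eq_self_iff] at h1
  rw [smul_some_eq_ite] at h2 h3
  simp only [h1, mul_zero, zero_add, mul_one] at h2 h3
  by_cases hd : g 1 1 = 0
  · rw [if_pos hd] at h2; exact absurd h2 (by simp)
  rw [if_neg hd, OnePoint.coe_eq_coe] at h2 h3
  have hb : g 0 1 = 0 := by simpa [hd] using h2
  rw [hb, add_zero, div_eq_one_iff_eq hd] at h3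
  induction x using OnePoint.rec with
  | infty => rw [smul_infty_eq_self_iff]; exact h1
  | coe x =>
    rw [smul_some_eq_ite]
    simp only [h1, zero_mul, zero_add, if_neg hd, hb, h3, add_zero]
    rw [mul_div_cancel_left₀ _ hd]

theorem gl_uniq (g g' : GL (Fin 2) K) (h1 : g • (∞ : OnePoint K) = g' • ∞)
    (h2 : g • ((0 : K) : OnePoint K) = g' • ((0 : K) : OnePoint K))
    (h3 : g • ((1 : K) : OnePoint K) = g' • ((1 : K) : OnePoint K)) (x : OnePoint K) : g • x = g' • x := by
  have := gl_stab (g'⁻¹ * g) (by rw [mul_smul, h1]; simp) (by rw [mul_smul, h2]; simp)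
    (by rw [mul_smul, h3]; simp) x
  rw [mul_smul, inv_smul_eq_iff] at this
  exact this

theorem stn_field (F : Type) [Field F] [DecidableEq F] [Fintype F] (i : F →+* K) :
    Stn (Fintype.card F + 1) (OnePoint K) := by
  classical
  let e : OnePoint F → OnePoint K := OnePoint.map i
  have he : Function.Injective e := Option.map_injective i.injective
  have e1 : e ∞ = ∞ := rfl
  have e2 : ∀ x : F, e x = ((i x : K) : OnePoint K) := fun _ => rfl
  have e3 : ∀ (h : GL (Fin 2) F), ∃ h' : GL (Fin 2) K, ∀ x, e (h • x) = h' • e x :=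
    fun h => ⟨h.map i, fun x => OnePoint.map_smul i h x⟩
  let _ : Fintype (OnePoint F) := inferInstanceAs (Fintype (Option F))
  have hc : Fintype.card (OnePoint F) = Fintype.card F + 1 := Fintype.card_option
  have key : ∀ (g : GL (Fin 2) K) (x y z : OnePoint K), x ≠ y → x ≠ z → y ≠ z →
      (∃ a, g • e a = x) → (∃ a, g • e a = y) → (∃ a, g • e a = z) →
      ∃ g' : GL (Fin 2) K, g' • (∞ : OnePoint K) = x ∧ g' • ((0 : K) : OnePoint K) = y ∧
      g' • ((1 : K) : OnePoint K) = z ∧ ∀ w, (∃ a, g • e a = w) ↔ ∃ a, g' • e a = w := by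
    rintro g x y z h1 h2 h3 ⟨a, rfl⟩ ⟨b, rfl⟩ ⟨c, rfl⟩
    obtain ⟨h, k1, k2, k3⟩ := gl3 a b c (fun h => h1 (by rw [h])) (fun h => h2 (by rw [h])) (fun h => h3 (by rw [h]))
    obtain ⟨h', hh⟩ := e3 h
    refine ⟨g * h', ?_, ?_, ?_, ?_⟩
    · rw [mul_smul, ← e1, ← hh, k1]
    · rw [mul_smul, ← k2, hh, e2, map_zero]
    · rw [mul_smul, ← k3, hh, e2, map_one]
    · intro w
      constructor
      · rintro ⟨a, rfl⟩
        exact ⟨h⁻¹ • a, by rw [mul_smul, ← hh]; simp⟩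
      · rintro ⟨a, rfl⟩
        exact ⟨h • a, by rw [mul_smul, ← hh]⟩
  refine ⟨{β | ∃ g : GL (Fin 2) K, β = univ.image (fun a => g • e a)}, ?_, ?_, ?_⟩
  · rintro _ ⟨g, rfl⟩
    have hi : Function.Injective (fun a => g • e a) := (MulAction.injective g).comp he
    rw [card_image_of_injective _ hi, card_univ, hc]
  · intro x y z h1 h2 h3
    obtain ⟨g, k1, k2, k3⟩ := gl3 x y z h1 h2 h3
    refine ⟨_, ⟨g, rfl⟩, ?_, ?_, ?_⟩ <;> simp only [mem_image, mem_univ, true_and]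
    · exact ⟨∞, k1⟩
    · exact ⟨((0 : F) : OnePoint F), by rw [e2, map_zero, k2]⟩
    · exact ⟨((1 : F) : OnePoint F), by rw [e2, map_one, k3]⟩
  · rintro x y z h1 h2 h3 _ ⟨g, rfl⟩ _ ⟨g', rfl⟩ a1 a2 a3 b1 b2 b3
    simp only [mem_image, mem_univ, true_and] at a1 a2 a3 b1 b2 b3
    obtain ⟨g1, k1, k2, k3, k4⟩ := key g x y z h1 h2 h3 a1 a2 a3
    obtain ⟨g2, l1, l2, l3, l4⟩ := key g' x y z h1 h2 h3 b1 b2 b3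
    ext w
    simp only [mem_image, mem_univ, true_and]
    rw [k4, l4]
    have := gl_uniq g1 g2 (by rw [k1, l1]) (by rw [k2, l2]) (by rw [k3, l3])
    simp only [this]

theorem Stn.tr {k : ℕ} {U V : Type} (e : U ≃ V) (h : Stn k U) : Stn k V := by
  classical
  obtain ⟨D, h1, h2, h3⟩ := h
  refine ⟨{β | β.map e.symm.toEmbedding ∈ D}, ?_, ?_, ?_⟩
  · intro β hβ
    rw [← h1 _ hβ, card_map]
  · intro a b c n1 n2 n3
    obtain ⟨β, hβ, k1, k2, k3⟩ := h2 (e.symm a) (e.symm b) (e.symm c) (by simpa) (by simpa) (by simpa)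
    refine ⟨β.map e.toEmbedding, ?_, ?_, ?_, ?_⟩
    · show (β.map e.toEmbedding).map e.symm.toEmbedding ∈ D
      rw [Finset.map_map]; simpa using hβ
    all_goals simpa
  · intro a b c n1 n2 n3 β hβ β' hβ' k1 k2 k3 l1 l2 l3
    have := h3 (e.symm a) (e.symm b) (e.symm c) (by simpa) (by simpa) (by simpa) _ hβ _ hβ'
      (by simpa) (by simpa) (by simpa) (by simpa) (by simpa) (by simpa)
    exact Finset.map_injective _ this

theorem Stn.comp {k l : ℕ} {U : Type} (h : Stn k (Fin l)) (h' : Stn l U) : Stn k U := by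
  classical
  obtain ⟨D, h1, h2, h3⟩ := h
  obtain ⟨D', h1', h2', h3'⟩ := h'
  choose f hf using fun β : {β // β ∈ D'} => emb_of_card β.1 (h1' β.1 β.2)
  have hm : ∀ β : {β // β ∈ D'}, ∀ u ∈ β.1, ∃ i, f β i = u := by
    intro β u hu
    rw [← hf β] at hu
    simpa using hu
  have hm' : ∀ β : {β // β ∈ D'}, ∀ i, f β i ∈ β.1 := by
    intro β i
    rw [← hf β]
    simp
  refine ⟨{γ | ∃ β : {β // β ∈ D'}, ∃ δ ∈ D, γ = δ.map (f β)}, ?_, ?_, ?_⟩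
  · rintro _ ⟨β, δ, hδ, rfl⟩
    rw [card_map, h1 _ hδ]
  · intro a b c n1 n2 n3
    obtain ⟨β, hβ, k1, k2, k3⟩ := h2' a b c n1 n2 n3
    obtain ⟨a, rfl⟩ := hm ⟨β, hβ⟩ a k1
    obtain ⟨b, rfl⟩ := hm ⟨β, hβ⟩ b k2
    obtain ⟨c, rfl⟩ := hm ⟨β, hβ⟩ c k3
    obtain ⟨δ, hδ, l1, l2, l3⟩ := h2 a b c (fun h => n1 (by rw [h])) (fun h => n2 (by rw [h])) (fun h => n3 (by rw [h]))
    exact ⟨_, ⟨⟨β, hβ⟩, δ, hδ, rfl⟩, by simpa, by simpa, by simpa⟩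
  · rintro a b c n1 n2 n3 _ ⟨β, δ, hδ, rfl⟩ _ ⟨β', δ', hδ', rfl⟩ k1 k2 k3 l1 l2 l3
    have mm : ∀ β : {β // β ∈ D'}, ∀ δ : Finset (Fin l), ∀ a ∈ δ.map (f β), a ∈ β.1 := by
      intro β δ a ha
      obtain ⟨i, -, rfl⟩ := Finset.mem_map.1 ha
      exact hm' β i
    have := h3' a b c n1 n2 n3 β.1 β.2 β'.1 β'.2 (mm _ _ _ k1) (mm _ _ _ k2) (mm _ _ _ k3)
      (mm _ _ _ l1) (mm _ _ _ l2) (mm _ _ _ l3)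
    obtain rfl := Subtype.ext this
    obtain ⟨a, m1, rfl⟩ := Finset.mem_map.1 k1
    obtain ⟨b, m2, rfl⟩ := Finset.mem_map.1 k2
    obtain ⟨c, m3, rfl⟩ := Finset.mem_map.1 k3
    rw [mem_map'] at l1 l2 l3
    rw [h3 a b c (fun h => n1 (by rw [h])) (fun h => n2 (by rw [h])) (fun h => n3 (by rw [h])) δ hδ δ' hδ' m1 m2 m3 l1 l2 l3]

theorem stn_pow (q n : ℕ) (hq : IsPrimePow q) (hn : n ≠ 0) : Stn (q + 1) (Option (Fin (q ^ n))) := by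
  classical
  obtain ⟨p, a, hp, ha, rfl⟩ := hq
  have : Fact p.Prime := ⟨hp.nat_prime⟩
  have : NeZero n := ⟨hn⟩
  let F := GaloisField p a
  let E := FiniteField.Extension F p n
  have : Fintype F := Fintype.ofFinite F
  have : Fintype E := Fintype.ofFinite E
  have c1 : Fintype.card F = p ^ a := by
    rw [Fintype.card_eq_nat_card, GaloisField.card p a ha.ne']
  have c2 : Fintype.card E = (p ^ a) ^ n := by
    rw [Fintype.card_eq_nat_card, FiniteField.natCard_extension, GaloisField.card p a ha.ne']
  have := stn_field F (algebraMap F E)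
  rw [c1] at this
  have e : E ≃ Fin ((p ^ a) ^ n) := Fintype.equivFinOfCardEq c2
  exact this.tr (Equiv.optionCongr e)

end P3

section P4a

theorem quadAbs {P C : Type} (D : P → P → Prop) (hD : ∀ x y, D x y → D y x)
    (hD0 : ∀ x y, D x y → x ≠ y)
    (R : P → P → P → P → Prop) (hR : ∀ x y z w w', R x y z w → R x y z w' → w = w')
    (M : P → P → C → P → Prop) (hM : ∀ x y c u u', M x y c u → M x y c u' → u = u')
    (ok : P → C → P → P → P → Prop)
    (HP : ∀ x y z, D x y → D x z → D y z → ∃ w, D x w ∧ D y w ∧ D z w ∧ R x y z w ∧ R y x z w ∧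
      R x z y w ∧ R x y w z ∧ ∃ c, ok x c y z w ∧ (M x y c z ∨ M x y c w) ∧ (M x z c y ∨ M x z c w) ∧
      (M x w c y ∨ M x w c z)) :
    ∃ (B : Set (Finset P)) (K : P → C → Finset P → Prop), (∀ b ∈ B, b.card = 4) ∧
      (∀ b ∈ B, ∀ x ∈ b, ∀ y ∈ b, x ≠ y → D x y) ∧
      (∀ x y z, D x y → D x z → D y z → ∃ b ∈ B, x ∈ b ∧ y ∈ b ∧ z ∈ b) ∧
      (∀ b ∈ B, ∀ x ∈ b, ∃ c, K x c b) ∧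
      (∀ b ∈ B, ∀ x ∈ b, ∀ c, K x c b → ∃ y z w, (∀ p, p ∈ b ↔ p = x ∨ p = y ∨ p = z ∨ p = w) ∧
        ok x c y z w) ∧
      (∀ b ∈ B, ∀ b' ∈ B, ∀ x y c, x ≠ y → x ∈ b → y ∈ b → x ∈ b' → y ∈ b' →
        K x c b → K x c b' → b = b') := by
  classical
  let S : Finset P → P → P → P → P → Prop := fun b x y z w => D x y ∧ D x z ∧ D y z ∧ R x y z w ∧
    D x w ∧ D y w ∧ D z w ∧ ∀ p, p ∈ b ↔ p = x ∨ p = y ∨ p = z ∨ p = w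
  have s1 : ∀ b x y z w, S b x y z w → S b y x z w := by
    rintro b x y z w ⟨h1, h2, h3, h4, h5, h6, h7, h8⟩
    obtain ⟨w', -, -, -, r1, r2, r3, r4, -⟩ := HP x y z h1 h2 h3
    obtain rfl := hR _ _ _ _ _ h4 r1
    refine ⟨hD _ _ h1, h3, h2, r2, h6, h5, h7, ?_⟩
    intro p; rw [h8]; tauto
  have s2 : ∀ b x y z w, S b x y z w → S b x z y w := by
    rintro b x y z w ⟨h1, h2, h3, h4, h5, h6, h7, h8⟩
    obtain ⟨w', -, -, -, r1, r2, r3, r4, -⟩ := HP x y z h1 h2 h3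
    obtain rfl := hR _ _ _ _ _ h4 r1
    refine ⟨h2, h1, hD _ _ h3, r3, h5, h7, h6, ?_⟩
    intro p; rw [h8]; tauto
  have s3 : ∀ b x y z w, S b x y z w → S b x y w z := by
    rintro b x y z w ⟨h1, h2, h3, h4, h5, h6, h7, h8⟩
    obtain ⟨w', -, -, -, r1, r2, r3, r4, -⟩ := HP x y z h1 h2 h3
    obtain rfl := hR _ _ _ _ _ h4 r1
    refine ⟨h1, h5, h6, r4, h2, h3, hD _ _ h7, ?_⟩
    intro p; rw [h8]; tauto
  have t1 : ∀ b, (∃ x y z w, S b x y z w) → ∀ x ∈ b, ∃ y z w, S b x y z w := by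
    rintro b ⟨x, y, z, w, h⟩ p hp
    rcases (h.2.2.2.2.2.2.2 p).1 hp with rfl | rfl | rfl | rfl
    · exact ⟨_, _, _, h⟩
    · exact ⟨_, _, _, s1 _ _ _ _ _ h⟩
    · exact ⟨_, _, _, s1 _ _ _ _ _ (s2 _ _ _ _ _ h)⟩
    · exact ⟨_, _, _, s1 _ _ _ _ _ (s2 _ _ _ _ _ (s3 _ _ _ _ _ h))⟩
  have t2 : ∀ b x, (∃ y z w, S b x y z w) → ∀ y ∈ b, x ≠ y → ∃ z w, S b x y z w := by
    rintro b x ⟨y, z, w, h⟩ p hp hne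
    rcases (h.2.2.2.2.2.2.2 p).1 hp with rfl | rfl | rfl | rfl
    · exact absurd rfl hne
    · exact ⟨_, _, h⟩
    · exact ⟨_, _, (s2 _ _ _ _ _ h)⟩
    · exact ⟨_, _, (s2 _ _ _ _ _ (s3 _ _ _ _ _ h))⟩
  have t3 : ∀ b x y, (∃ z w, S b x y z w) → ∀ z ∈ b, x ≠ z → y ≠ z → ∃ w, S b x y z w := by
    rintro b x y ⟨z, w, h⟩ p hp hne hne'
    rcases (h.2.2.2.2.2.2.2 p).1 hp with rfl | rfl | rfl | rfl
    · exact absurd rfl hne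
    · exact absurd rfl hne'
    · exact ⟨_, h⟩
    · exact ⟨_, (s3 _ _ _ _ _ h)⟩
  refine ⟨{b | ∃ x y z w, S b x y z w}, fun x c b => (∃ y z w, (∀ p, p ∈ b ↔ p = x ∨ p = y ∨ p = z ∨ p = w) ∧
        ok x c y z w) ∧ ∀ y ∈ b, x ≠ y → ∃ u ∈ b, x ≠ u ∧ y ≠ u ∧ M x y c u, ?_, ?_, ?_, ?_, ?_, ?_⟩
  · rintro b ⟨x, y, z, w, h1, h2, h3, h4, h5, h6, h7, h8⟩
    have : b = {x, y, z, w} := by ext p; simp [h8]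
    rw [this]
    rw [card_insert_of_notMem, card_insert_of_notMem, card_insert_of_notMem, card_singleton]
    · simpa using hD0 _ _ h7
    · simpa using ⟨hD0 _ _ h3, hD0 _ _ h6⟩
    · simpa using ⟨hD0 _ _ h1, hD0 _ _ h2, hD0 _ _ h5⟩
  · intro b hb x hx y hy hne
    obtain ⟨z, w, h⟩ := t2 b x (t1 b hb x hx) y hy hne
    exact h.1
  · intro x y z h1 h2 h3
    obtain ⟨w, a1, a2, a3, r1, -⟩ := HP x y z h1 h2 h3
    exact ⟨{x, y, z, w}, ⟨x, y, z, w, h1, h2, h3, r1, a1, a2, a3, fun p => by simp⟩, by simp, by simp, by simp⟩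
  · intro b hb x hx
    obtain ⟨y, z, w, h1, h2, h3, h4, h5, h6, h7, h8⟩ := t1 b hb x hx
    obtain ⟨w', -, -, -, r1, r2, r3, r4, c, k0, k1, k2, k3⟩ := HP x y z h1 h2 h3
    obtain rfl := hR _ _ _ _ _ h4 r1
    refine ⟨c, ⟨y, z, w, h8, k0⟩, ?_⟩
    have my : y ∈ b := (h8 y).2 (by tauto)
    have mz : z ∈ b := (h8 z).2 (by tauto)
    have mw : w ∈ b := (h8 w).2 (by tauto)
    have n1 := hD0 _ _ h1
    have n2 := hD0 _ _ h2
    have n3 := hD0 _ _ h3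
    have n5 := hD0 _ _ h5
    have n6 := hD0 _ _ h6
    have n7 := hD0 _ _ h7
    intro p hp hne
    rcases (h8 p).1 hp with rfl | rfl | rfl | rfl
    · exact absurd rfl hne
    · rcases k1 with k | k
      · exact ⟨z, mz, n2, n3, k⟩
      · exact ⟨w, mw, n5, n6, k⟩
    · rcases k2 with k | k
      · exact ⟨y, my, n1, n3.symm, k⟩
      · exact ⟨w, mw, n5, n7, k⟩
    · rcases k3 with k | k
      · exact ⟨y, my, n1, n6.symm, k⟩
      · exact ⟨z, mz, n2, n7.symm, k⟩
  · intro b hb x hx c hK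
    exact hK.1
  · rintro b hb b' hb' x y c hne h1 h2 h3 h4 ⟨-, k⟩ ⟨-, k'⟩
    obtain ⟨u, hu, u1, u2, hu'⟩ := k y h2 hne
    obtain ⟨v, hv, v1, v2, hv'⟩ := k' y h4 hne
    obtain rfl := hM _ _ _ _ _ hu' hv'
    obtain ⟨w, h⟩ := t3 b x y (t2 b x (t1 b hb x h1) y h2 hne) u hu u1 u2
    obtain ⟨w', h'⟩ := t3 b' x y (t2 b' x (t1 b' hb' x h3) y h4 hne) u hv u1 u2
    have := hR _ _ _ _ _ h.2.2.2.1 h'.2.2.2.1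
    subst this
    ext p
    rw [h.2.2.2.2.2.2.2, h'.2.2.2.2.2.2.2]

def al (n : ℕ) (f : ℕ → Bool) : Bool := Nat.rec true (fun k r => and (f k) r) n
def ax (n : ℕ) (f : ℕ → Bool) : Bool := Nat.rec false (fun k r => or (f k) r) n

theorem al_iff (n f) : al n f = true ↔ ∀ k < n, f k = true := by
  induction n with
  | zero => simp [al]
  | succ n ih =>
    have : al (n+1) f = (f n && al n f) := rfl
    rw [this, Bool.and_eq_true, ih]
    constructor
    · rintro ⟨h1, h2⟩ k hk
      rcases Nat.lt_succ_iff_lt_or_eq.1 hk with h | rfl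
      · exact h2 k h
      · exact h1
    · intro h; exact ⟨h n (by omega), fun k hk => h k (by omega)⟩

theorem ax_iff (n f) : ax n f = true ↔ ∃ k < n, f k = true := by
  induction n with
  | zero => simp [ax]
  | succ n ih =>
    have : ax (n+1) f = (f n || ax n f) := rfl
    rw [this, Bool.or_eq_true, ih]
    constructor
    · rintro (h | ⟨k, hk, h⟩)
      · exact ⟨n, by omega, h⟩
      · exact ⟨k, by omega, h⟩
    · rintro ⟨k, hk, h⟩
      rcases Nat.lt_succ_iff_lt_or_eq.1 hk with h' | rfl
      · exact Or.inr ⟨k, h', h⟩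
      · exact Or.inl h

def nq (a b : ℕ) : Bool := not (Nat.beq a b)
theorem bq_iff (a b : ℕ) : Nat.beq a b = true ↔ a = b :=
  ⟨Nat.eq_of_beq_eq_true, fun h => by rw [h]; exact Nat.beq_refl b⟩
theorem nq_iff (a b) : nq a b = true ↔ a ≠ b := by
  rw [ne_eq, ← bq_iff]; unfold nq; cases Nat.beq a b <;> decide

def mchk (N : ℕ → ℕ → ℕ → ℕ) (x y z w c : ℕ) : Bool :=
  (Nat.beq (N x y c) z || Nat.beq (N x y c) w) && (Nat.beq (N x z c) y || Nat.beq (N x z c) w) &&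
    (Nat.beq (N x w c) y || Nat.beq (N x w c) z)

def qchk (n nc : ℕ) (D : ℕ → ℕ → Bool) (Q N : ℕ → ℕ → ℕ → ℕ) (ok : ℕ → ℕ → ℕ → ℕ → ℕ → Bool) : Bool :=
  al n fun x => al n fun y => not (D x y) || al n fun z => not (D x z && D y z) ||
    (Nat.blt (Q x y z) n && (D x (Q x y z) && (D y (Q x y z) && (D z (Q x y z) && (Nat.beq (Q y x z) (Q x y z) &&
    (Nat.beq (Q x z y) (Q x y z) && (Nat.beq (Q x y (Q x y z)) z &&
    ax nc fun c => mchk N x y z (Q x y z) c && ok x c y z (Q x y z))))))))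

def cd {m k : ℕ} (p : Fin m × Fin k) : ℕ := k * p.1.1 + p.2.1

theorem cd_inj {m k : ℕ} (p q : Fin m × Fin k) (h : cd p = cd q) : p = q := by
  have h1 := p.2.2
  have h2 := q.2.2
  have hk : 0 < k := by omega
  have e1 : cd p / k = p.1.1 := by unfold cd; rw [Nat.mul_add_div hk, Nat.div_eq_of_lt h1, add_zero]
  have e2 : cd q / k = q.1.1 := by unfold cd; rw [Nat.mul_add_div hk, Nat.div_eq_of_lt h2, add_zero]
  have e3 : p.1.1 = q.1.1 := by rw [← e1, ← e2, h]
  refine Prod.ext (Fin.ext e3) (Fin.ext ?_)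
  unfold cd at h; rw [e3] at h; omega

theorem cd_div {m k : ℕ} (p : Fin m × Fin k) : cd p / k = p.1.1 := by
  have h1 := p.2.2
  have hk : 0 < k := by omega
  unfold cd; rw [Nat.mul_add_div hk, Nat.div_eq_of_lt h1, add_zero]

theorem cd_lt {m k : ℕ} (p : Fin m × Fin k) : cd p < k * m := by
  have h1 := p.2.2
  have := p.1.2
  unfold cd
  nlinarith

theorem cd_ex {m k n : ℕ} (h : n < k * m) : ∃ p : Fin m × Fin k, cd p = n := by
  have hk : 0 < k := Nat.pos_of_ne_zero (by rintro rfl; simp at h)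
  exact ⟨(⟨n / k, Nat.div_lt_of_lt_mul h⟩, ⟨n % k, Nat.mod_lt _ hk⟩), Nat.div_add_mod _ _⟩

theorem qchk_get {n nc D Q N ok} (h : qchk n nc D Q N ok = true) (x y z : ℕ) (hx : x < n) (hy : y < n) (hz : z < n)
    (h1 : D x y = true) (h2 : D x z = true) (h3 : D y z = true) :
    Q x y z < n ∧ D x (Q x y z) = true ∧ D y (Q x y z) = true ∧ D z (Q x y z) = true ∧ Q y x z = Q x y z ∧
    Q x z y = Q x y z ∧ Q x y (Q x y z) = z ∧ ∃ c < nc, ok x c y z (Q x y z) = true ∧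
      (N x y c = z ∨ N x y c = Q x y z) ∧ (N x z c = y ∨ N x z c = Q x y z) ∧
      (N x (Q x y z) c = y ∨ N x (Q x y z) c = z) := by
  have a1 := (al_iff _ _).1 h x hx
  have a2 := (al_iff _ _).1 a1 y hy
  rw [h1] at a2
  have a3 := (al_iff _ _).1 a2 z hz
  rw [h2, h3] at a3
  simp only [Bool.and_self, Bool.not_true, Bool.false_or, Bool.and_eq_true, Nat.blt_eq, bq_iff, ax_iff, mchk, Bool.or_eq_true] at a3
  obtain ⟨b1, b2, b3, b4, b5, b6, b7, c, hc, ⟨⟨d1, d2⟩, d3⟩, d4⟩ := a3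
  exact ⟨b1, b2, b3, b4, b5, b6, b7, c, hc, d4, d1, d2, d3⟩

def frchk (m : ℕ) (Q N : ℕ → ℕ → ℕ → ℕ) : Bool :=
  qchk (4*m) (2*m) (fun x y => nq (x/4) (y/4)) Q N
    (fun x c y z w => nq (x/4) (c/2) && nq (y/4) (c/2) && nq (z/4) (c/2) && nq (w/4) (c/2))

theorem nqv {m : ℕ} (x y : Fin m × Fin 4) : nq (cd x / 4) (cd y / 4) = true ↔ x.1 ≠ y.1 := by
  rw [nq_iff, cd_div, cd_div, ne_eq, Fin.val_inj]

theorem nqw {m : ℕ} (x : Fin m × Fin 4) (y : Fin m × Fin 2) : nq (cd x / 4) (cd y / 2) = true ↔ x.1 ≠ y.1 := by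
  rw [nq_iff, cd_div, cd_div, ne_eq, Fin.val_inj]

theorem Fr.mk0 {m : ℕ} (Q N : ℕ → ℕ → ℕ → ℕ) (h : frchk m Q N = true) :
    Nonempty (Fr (Fin 4) (Fin 2) (Fin m) univ) := by
  obtain ⟨B, K, h1, h2, h3, h4, h5, h6⟩ := quadAbs (P := Fin m × Fin 4) (C := Fin m × Fin 2)
    (fun x y => x.1 ≠ y.1) (fun _ _ h => Ne.symm h) (fun _ _ h h' => h (by rw [h']))
    (fun x y z w => Q (cd x) (cd y) (cd z) = cd w) (fun x y z w w' e1 e2 => cd_inj _ _ (e1.symm.trans e2))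
    (fun x y c u => N (cd x) (cd y) (cd c) = cd u) (fun x y z w w' e1 e2 => cd_inj _ _ (e1.symm.trans e2))
    (fun x c y z w => x.1 ≠ c.1 ∧ y.1 ≠ c.1 ∧ z.1 ≠ c.1 ∧ w.1 ≠ c.1)
    (by
      intro x y z n1 n2 n3
      obtain ⟨b1, b2, b3, b4, b5, b6, b7, c, hc, d0, d1, d2, d3⟩ := qchk_get h (cd x) (cd y) (cd z) (cd_lt x) (cd_lt y) (cd_lt z)
        ((nqv _ _).2 n1) ((nqv _ _).2 n2) ((nqv _ _).2 n3)
      obtain ⟨w, hw⟩ := cd_ex b1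
      obtain ⟨c, rfl⟩ := cd_ex hc
      rw [← hw] at b2 b3 b4 b5 b6 b7 d0 d1 d2 d3
      simp only [Bool.and_eq_true, nqw] at d0
      obtain ⟨⟨⟨c1, c2⟩, c3⟩, c4⟩ := d0
      exact ⟨w, (nqv _ _).1 b2, (nqv _ _).1 b3, (nqv _ _).1 b4, hw.symm, b5, b6, b7, c, ⟨c1, c2, c3, c4⟩, d1, d2, d3⟩)
  refine ⟨⟨B, fun x c h b => K x (c, h) b, by simp, h1, ?_, ?_, ?_, ?_, ?_⟩⟩
  · intro b hb x hx y hy e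
    by_contra hne
    exact h2 b hb x hx y hy hne e
  · intro x y z _ _ _ n1 n2 n3
    exact h3 x y z n1 n2 n3
  · intro b hb x hx
    obtain ⟨⟨c, h⟩, k⟩ := h4 b hb x hx
    exact ⟨c, h, k⟩
  · intro b hb x hx c h k
    obtain ⟨y, z, w, e, c1, c2, c3, c4⟩ := h5 b hb x hx _ k
    refine ⟨by simp, fun p hp => ?_⟩
    rcases (e p).1 hp with rfl | rfl | rfl | rfl <;> assumption
  · intro b hb b' hb' x y c h
    exact h6 b hb b' hb' x y (c, h)

def lfchk (m : ℕ) (Q N : ℕ → ℕ → ℕ → ℕ) : Bool :=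
  qchk (4*m) (2*m+1) nq Q N
    (fun x c y z w => cond (Nat.blt c (2*m)) (nq (x/4) (c/2))
      ((nq (x/4) (y/4) && nq (x/4) (z/4) && nq (x/4) (w/4)) ||
        (Nat.beq (x/4) (y/4) && Nat.beq (x/4) (z/4) && Nat.beq (x/4) (w/4))))

def cs {m : ℕ} : (Fin m × Fin 2) ⊕ Unit → ℕ
  | .inl c => cd c
  | .inr _ => 2 * m

theorem cs_ex {m n : ℕ} (h : n < 2 * m + 1) : ∃ p : (Fin m × Fin 2) ⊕ Unit, cs p = n := by
  rcases Nat.lt_succ_iff_lt_or_eq.1 h with h | h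
  · obtain ⟨p, hp⟩ := cd_ex h
    exact ⟨.inl p, hp⟩
  · exact ⟨.inr (), h.symm⟩

theorem bqv {m : ℕ} (x y : Fin m × Fin 4) : Nat.beq (cd x / 4) (cd y / 4) = true ↔ x.1 = y.1 := by
  rw [bq_iff, cd_div, cd_div, Fin.val_inj]

theorem LF.mk0 {m : ℕ} (Q N : ℕ → ℕ → ℕ → ℕ) (h : lfchk m Q N = true) :
    Nonempty (LF (Fin 4) (Fin 2) Unit (Fin m) univ) := by
  have nqq : ∀ x y : Fin m × Fin 4, nq (cd x) (cd y) = true ↔ x ≠ y := by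
    intro x y
    rw [nq_iff]
    exact ⟨fun h h' => h (by rw [h']), fun h h' => h (cd_inj _ _ h')⟩
  obtain ⟨B, K, h1, h2, h3, h4, h5, h6⟩ := quadAbs (P := Fin m × Fin 4) (C := (Fin m × Fin 2) ⊕ Unit)
    (fun x y => x ≠ y) (fun _ _ h => Ne.symm h) (fun _ _ h => h)
    (fun x y z w => Q (cd x) (cd y) (cd z) = cd w) (fun x y z w w' e1 e2 => cd_inj _ _ (e1.symm.trans e2))
    (fun x y c u => N (cd x) (cd y) (cs c) = cd u) (fun x y z w w' e1 e2 => cd_inj _ _ (e1.symm.trans e2))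
    (fun x c y z w => (∀ d, c = Sum.inl d → x.1 ≠ d.1) ∧ (∀ d, c = Sum.inr d → (x.1 ≠ y.1 ∧ x.1 ≠ z.1 ∧ x.1 ≠ w.1) ∨
      (x.1 = y.1 ∧ x.1 = z.1 ∧ x.1 = w.1)))
    (by
      intro x y z n1 n2 n3
      obtain ⟨b1, b2, b3, b4, b5, b6, b7, c, hc, d0, d1, d2, d3⟩ := qchk_get h (cd x) (cd y) (cd z) (cd_lt x) (cd_lt y) (cd_lt z)
        ((nqq _ _).2 n1) ((nqq _ _).2 n2) ((nqq _ _).2 n3)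
      obtain ⟨w, hw⟩ := cd_ex b1
      obtain ⟨c, rfl⟩ := cs_ex hc
      rw [← hw] at b2 b3 b4 b5 b6 b7 d0 d1 d2 d3
      refine ⟨w, (nqq _ _).1 b2, (nqq _ _).1 b3, (nqq _ _).1 b4, hw.symm, b5, b6, b7, c, ⟨?_, ?_⟩, d1, d2, d3⟩
      · rintro d rfl
        have e : (cs (Sum.inl d : (Fin m × Fin 2) ⊕ Unit)).blt (2 * m) = true := by
          rw [Nat.blt_eq]; exact cd_lt d
        rw [e] at d0
        exact (nqw _ _).1 d0
      · rintro d rfl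
        have e : (cs (Sum.inr d : (Fin m × Fin 2) ⊕ Unit)).blt (2 * m) = false := by
          have : ¬ ((cs (Sum.inr d : (Fin m × Fin 2) ⊕ Unit)).blt (2 * m) = true) := by
            rw [Nat.blt_eq]; exact lt_irrefl _
          exact Bool.eq_false_of_not_eq_true this
        rw [e] at d0
        simp only [cond_false, Bool.or_eq_true, Bool.and_eq_true, nqv, bqv] at d0
        tauto)
  refine ⟨⟨B, fun x c b => K x c b, by simp, h1, ?_, ?_, ?_, ?_, ?_⟩⟩
  · intro x y z _ _ _ n1 n2 n3
    exact h3 x y z n1 n2 n3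
  · intro b hb x hx
    exact h4 b hb x hx
  · intro b hb x hx c h k
    obtain ⟨y, z, w, e, c1, c2⟩ := h5 b hb x hx _ k
    exact ⟨by simp, (c1 _ rfl).symm⟩
  · intro b hb b' hb' x y c
    exact h6 b hb b' hb' x y c
  · intro b hb x hx y hy h k hne hg
    obtain ⟨y', z, w, e, -, c2⟩ := h5 b hb x hx _ k
    have hall : ∀ p ∈ b, p.1 = x.1 := by
      rcases c2 _ rfl with ⟨k1, k2, k3⟩ | ⟨k1, k2, k3⟩
      · exfalso
        rcases (e y).1 hy with rfl | rfl | rfl | rfl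
        · exact hne rfl
        · exact k1 hg.symm
        · exact k2 hg.symm
        · exact k3 hg.symm
      · intro p hp
        rcases (e p).1 hp with rfl | rfl | rfl | rfl
        · rfl
        · exact k1.symm
        · exact k2.symm
        · exact k3.symm
    have : b = ({x.1} : Finset (Fin m)) ×ˢ (univ : Finset (Fin 4)) := by
      apply Finset.eq_of_subset_of_card_le
      · intro p hp
        rw [mem_product]; exact ⟨mem_singleton.2 (hall p hp), mem_univ _⟩
      · rw [card_product, h1 b hb]; simp
    intro p
    rw [this]
    rw [mem_product]; exact ⟨fun h => mem_singleton.1 h.1, fun h => ⟨mem_singleton.2 h, mem_univ _⟩⟩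

end P4a

section P4b

def sb45 (x y : ℕ) : ℕ := Nat.xor ((y + 20 - 4 * (x / 4)) % 20) (x % 2)
def ad45 (x y : ℕ) : ℕ := ((Nat.xor y (x % 2)) + 4 * (x / 4)) % 20
def Q45 (x y z : ℕ) : ℕ := ad45 x ((Nat.shiftRight
  4385220970836175299220415364494463715578175410949897546464307583665189108137838776662520521823205840320394789417004942189111557008060290362830395170983351363951810367457702498690871496445372945408283960626677620072098761123199852814904881289619512581236598800812058797143449249134807495401659310774191961587864982876943146870314152964607927582017073681091239761369710515624324723711440665709599333295733183113990930177600124511657671344384698257533575964642074877935287481762657486946114581988033338511877657646956151259971005299596494094779878665966555937232713126625356555687709109934632130519679839577543452613639795417488279266817727167983897265715008352401091875944377610309205171618257934638950412838140572775765967608650137717269254097294674673080962694631163573751458337842594461240816008739305167516010435364790797952035218096883515146192771600374115198933159832608125505169261618386163059087794467317063123590928412341100450273541580138422373166327640112099467796271242565791022418492096141777285591044717682144880332593049772108781956289623031869241471082067790858648175397217031216805952171419930379689426902849146662739174068754936246630068720566584842542335384578553518134607531212800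
  (5 * (400 * ((x % 4) / 2) + 20 * sb45 x y + sb45 x z))) % 32)
def N45 (x y c : ℕ) : ℕ := ad45 x ((Nat.shiftRight
  14802826585803145867798512457343055612159943371186596086297464658809022312542383473602322541035220537267630404421103952629597288600472300606049507709096766872450667648574576195130302506662311691772186607923164039537272474071088294474202767939159113322613359565677706469843291339909832446152808220078488706877652676013956291647242805162296310841784279624329399433489480760410300612886393387967501991478593562086315151349837778885977027978305391813032772774411567787135600750929861270974982043269606266544666512608762860675883699850067825965300142941644756761130287337257988118649145468766616159256576
  (5 * (200 * ((x % 4) / 2) + 10 * sb45 x y + (c + 10 - 2 * (x / 4)) % 10))) % 32)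

theorem fr45 : Nonempty (Fr (Fin 4) (Fin 2) (Fin 5) univ) := Fr.mk0 Q45 N45 (by decide +kernel)

def Q48 (x y z : ℕ) : ℕ := Nat.xor x (Nat.xor y z)
def N48 (x y c : ℕ) : ℕ := Nat.xor x ((Nat.shiftRight
  202228803940853197566566723512594203214420467455879477409592841665799544821955133742938338006350209119691256032874736520543971737283734024058564531252283274145584951642192777759838170450966073704947558344904098715715437403974518203002096577683724135727508008236516077658375700550066020411674112739104261786800930524974105598167517088126472096895876580229216088664078836605616032862474666554071145680805175666059690099564911898172812313612926551145208975413877162637596645967027249561213023383140424606781068322412052322456474030139974609039764245875210973648250494016434419506865621514991897343674220373064619709348286476716541283130357839995683210260841080375615544542205408769436199294680646191285255090481264853420164651064581323726443028999892932665651063150346240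
  (5 * (16 * (Nat.xor x y) + Nat.xor c (2 * (x / 4))))) % 32)

theorem fr48 : Nonempty (Fr (Fin 4) (Fin 2) (Fin 8) univ) := Fr.mk0 Q48 N48 (by decide +kernel)

def sb7 (x y : ℕ) : ℕ := Nat.xor ((y + 28 - 4 * (x / 4)) % 28) (x % 4)
def ad7 (x y : ℕ) : ℕ := ((Nat.xor y (x % 4)) + 4 * (x / 4)) % 28
def Q7 (x y z : ℕ) : ℕ := ad7 x ((Nat.shiftRight
  7917783041490343727067469567756192973395749721786535783719738865182270148664261445430645221466429341427012923692115271640999224789625142121610407538622452980600434747169860859446551174820170772738486483745388606329421524801893692788413252926561830649965704845984610160173547978378638593707630496561597424088351566194272512660058064115039360623522896981783786240715371801488119743284315728268940711360688462616848636864562575905737802627649893110774475216989560128738961928153761806694972091939073508839357909702059646320132833912293247702354617065380575699479909409848489062712810048559990898237030947570730655407420257643515930201779827465649410992746697449210919241392488875640215856563156204231558824435510581159613428536265400871544819395621580857886303924046180049104579521935536861550422193536710494017111285740746732236047554009313442903733436024040189155671881065916339028895631395154588482229341812500718677294997397792101581093194046634788193411531327043711969642186900950408515392735061776836622346810531114989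20704059272150088109660759651227719998898118561827190624459129342359516583262931793663341506446401446723561073283577382653392678199243650035918189421183643992076694832752230153413753026900220226097061979371985320496347168378912213965630112253738194098986499863663493687561288443792824842296661950155143303846203840528384
  (5 * (32 * sb7 x y + sb7 x z))) % 32)
def N7 (x y c : ℕ) : ℕ := ad7 x ((Nat.shiftRight
  3011992220617230954291347226957667698045688142530564251882812532781354041562490476081431437046777472923495865828269017210637282615720759914853969631744526562800237416761847060796361838250897975455590187742963000059115319679691620462812633122377388916339551542708767012049801218806121363745148175900105531707411980633918159171166164575456360276814446521094483728775052709170493302357423152771831468251124162250882606076921721181576995376632992498640777658356643008120972246151433072523091477360645732458740943650712959486425009722828614796782908054992762009927597848665291503528602844565550889013315225990387285355265581217090088127437767678459534223653256701439661228163072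
  (5 * (16 * sb7 x y + cond (Nat.beq c 14) 14 ((c + 14 - 2 * (x / 4)) % 14)))) % 32)

theorem lf7 : Nonempty (LF (Fin 4) (Fin 2) Unit (Fin 7) univ) := LF.mk0 Q7 N7 (by decide +kernel)

def N4 (x y c : ℕ) : ℕ := Nat.xor x ((Nat.shiftRight
  213062634118267507386945274317067059652081128333645524802079824454855434898587959161988887746216785359929334585868800043051084686277980054362269941376140893338040074669820946271924576203450766040955100104190412691198365781481399250032152325346515703360157928115639177969083358268797401415710240931840
  (4 * (16 * (Nat.xor x y) + cond (Nat.beq c 8) 8 (Nat.xor c (2 * (x / 4)))))) % 16)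

theorem lf4 : Nonempty (LF (Fin 4) (Fin 2) Unit (Fin 4) univ) := LF.mk0 Q48 N4 (by decide +kernel)

end P4b

section P4c

def tbt (m i : ℕ) : Bool := Nat.beq (Nat.land (Nat.shiftRight m i) 1) 1

def L17 : List ℕ := [
  422, 601, 1193, 1308, 1347, 1586, 1732, 2134, 2353, 2504, 2604, 2691, 4202, 5008, 7173, 8341, 9056, 11274,
  12553, 12806, 13392, 14496, 16538, 17157, 19552, 20532, 20673, 22024, 22786, 24611, 24652, 25984, 27152,
  32869, 33546, 35984, 36883, 37004, 38176, 39488, 41016, 41154, 42497, 43268, 49488, 49824, 50182, 51209,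
  65551, 65776, 69376, 69956, 70177, 70786, 71704, 74002, 74376, 74788, 75841, 82216, 82498, 82961, 84100,
  98689, 98836, 99400, 100386, 126976]

def b26 : List (List ℕ) := [[0,1,2,17,24],[0,1,3,9,13],[0,1,4,6,19],[0,1,5,11,14],[0,1,7,15,25],
  [0,1,8,10,21],[0,1,18,20,22],[0,2,14,18,23],[0,3,6,20,25],[0,3,8,19,23]]

def L26 : List ℕ := b26.flatMap fun l => (List.range 26).map fun s =>
  l.foldr (fun p r => Nat.add (Nat.pow 2 ((p % 13 + s / 2) % 13 + 13 * ((p / 13 + s % 2) % 2))) r) 0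

def one1 : List ℕ → Bool
  | [_] => true
  | _ => false

def flt (i : ℕ) (L : List ℕ) : List ℕ := L.filter fun m => tbt m i

def schk (n : ℕ) (L : List ℕ) : Bool :=
  al n fun x => al n fun y => Nat.ble x y || al n fun z => Nat.ble y z || one1 (flt z (flt y (flt x L)))

theorem schk17 : schk 17 L17 = true := by decide +kernel
theorem schk26 : schk 26 L26 = true := by decide +kernel

theorem schk_get {n : ℕ} {L : List ℕ} (h : schk n L = true) (x y z : ℕ) (hx : x < n) (hy : y < n) (hz : z < n)
    (h1 : x ≠ y) (h2 : x ≠ z) (h3 : y ≠ z) :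
    ∃ a, ∀ m, (m ∈ L ∧ tbt m x = true ∧ tbt m y = true ∧ tbt m z = true) ↔ m = a := by
  have key : ∀ x y z, x < n → y < n → z < n → y < x → z < y →
      ∃ a, ∀ m, (m ∈ L ∧ tbt m x = true ∧ tbt m y = true ∧ tbt m z = true) ↔ m = a := by
    intro x y z hx hy hz h1 h2
    have a1 := (al_iff _ _).1 h x hx
    have a2 := (al_iff _ _).1 a1 y hy
    rw [show Nat.ble x y = false from Bool.eq_false_of_not_eq_true (by rw [Nat.ble_eq]; omega)] at a2
    have a3 := (al_iff _ _).1 a2 z hz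
    rw [show Nat.ble y z = false from Bool.eq_false_of_not_eq_true (by rw [Nat.ble_eq]; omega)] at a3
    rw [Bool.false_or] at a3
    have : ∀ l : List ℕ, one1 l = true → ∃ a, l = [a] := by
      intro l hl
      match l, hl with
      | [a], _ => exact ⟨a, rfl⟩
    obtain ⟨a, ha⟩ := this _ a3
    refine ⟨a, fun m => ?_⟩
    have hm : m ∈ flt z (flt y (flt x L)) ↔ m = a := by rw [ha]; simp
    rw [← hm]
    simp only [flt, List.mem_filter]
    tauto
  rcases lt_or_gt_of_ne h1 with k1 | k1 <;> rcases lt_or_gt_of_ne h2 with k2 | k2 <;>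
    rcases lt_or_gt_of_ne h3 with k3 | k3
  · obtain ⟨a, ha⟩ := key z y x hz hy hx k3 k1
    exact ⟨a, fun m => by rw [← ha]; tauto⟩
  · obtain ⟨a, ha⟩ := key y z x hy hz hx k3 k2
    exact ⟨a, fun m => by rw [← ha]; tauto⟩
  · omega
  · obtain ⟨a, ha⟩ := key y x z hy hx hz k1 k2
    exact ⟨a, fun m => by rw [← ha]; tauto⟩
  · obtain ⟨a, ha⟩ := key z x y hz hx hy k2 k1
    exact ⟨a, fun m => by rw [← ha]; tauto⟩
  · omega
  · obtain ⟨a, ha⟩ := key x z y hx hz hy k2 k3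
    exact ⟨a, fun m => by rw [← ha]; tauto⟩
  · exact key x y z hx hy hz k1 k3

theorem stn_of_schk {n k : ℕ} {L : List ℕ} (h : schk n L = true) {P : Type} [Fintype P] (c : P → ℕ)
    (ci : ∀ p q, c p = c q → p = q) (cl : ∀ p, c p < n)
    (hc : ∀ m ∈ L, (univ.filter fun p : P => tbt m (c p) = true).card = k) :
    ∃ D : Set (Finset P), (∀ m ∈ L, (univ.filter fun p : P => tbt m (c p) = true) ∈ D) ∧ (∀ β ∈ D, β.card = k) ∧
  (∀ a b c : P, a ≠ b → a ≠ c → b ≠ c → ∃ β ∈ D, a ∈ β ∧ b ∈ β ∧ c ∈ β) ∧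
  (∀ a b c : P, a ≠ b → a ≠ c → b ≠ c → ∀ β ∈ D, ∀ β' ∈ D, a ∈ β → b ∈ β → c ∈ β →
      a ∈ β' → b ∈ β' → c ∈ β' → β = β') := by
  have hs : ∀ x y z : P, x ≠ y → x ≠ z → y ≠ z → _ := fun x y z h1 h2 h3 =>
    schk_get h (c x) (c y) (c z) (cl x) (cl y) (cl z) (fun e => h1 (ci _ _ e)) (fun e => h2 (ci _ _ e))
      (fun e => h3 (ci _ _ e))
  refine ⟨{β | ∃ m ∈ L, β = univ.filter fun p : P => tbt m (c p) = true}, fun m hm => ⟨m, hm, rfl⟩, ?_, ?_, ?_⟩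
  · rintro _ ⟨m, hm, rfl⟩
    exact hc m hm
  · intro x y z h1 h2 h3
    obtain ⟨a, ha⟩ := hs x y z h1 h2 h3
    have := (ha a).2 rfl
    exact ⟨_, ⟨a, this.1, rfl⟩, by simpa using this.2.1, by simpa using this.2.2.1, by simpa using this.2.2.2⟩
  · rintro x y z h1 h2 h3 _ ⟨m, hm, rfl⟩ _ ⟨m', hm', rfl⟩ k1 k2 k3 l1 l2 l3
    simp only [mem_filter, mem_univ, true_and] at k1 k2 k3 l1 l2 l3
    obtain ⟨a, ha⟩ := hs x y z h1 h2 h3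
    rw [(ha m).1 ⟨hm, k1, k2, k3⟩, (ha m').1 ⟨hm', l1, l2, l3⟩]

theorem stn26 : Stn 5 (Fin 26) := by
  obtain ⟨D, -, h⟩ := stn_of_schk (k := 5) schk26 (fun i : Fin 26 => i.1) (fun p q h => Fin.ext h) (fun p => p.2)
    (by decide +kernel)
  exact ⟨D, h⟩

def c17 : Option (Fin 4 × Fin 4) → ℕ
  | none => 16
  | some p => cd p

theorem stn17 : ∃ D : Set (Finset (Option (Fin 4 × Fin 4))),
    (∀ a : Fin 4, (univ.filter fun p : Option (Fin 4 × Fin 4) => ∀ q, p = some q → q.1 = a) ∈ D) ∧ (∀ β ∈ D, β.card = 5) ∧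
  (∀ a b c, a ≠ b → a ≠ c → b ≠ c → ∃ β ∈ D, a ∈ β ∧ b ∈ β ∧ c ∈ β) ∧
  (∀ a b c, a ≠ b → a ≠ c → b ≠ c → ∀ β ∈ D, ∀ β' ∈ D, a ∈ β → b ∈ β → c ∈ β →
      a ∈ β' → b ∈ β' → c ∈ β' → β = β') := by
  obtain ⟨D, h1, h2⟩ := stn_of_schk (k := 5) schk17 c17
    (by
      rintro (_ | p) (_ | q) h
      · rfl
      · have := cd_lt q; simp only [c17] at h; omega
      · have := cd_lt p; simp only [c17] at h; omega
      · rw [cd_inj p q h])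
    (by
      rintro (_ | p)
      · show 16 < 17; omega
      · have := cd_lt p; show cd p < 17; omega)
    (by decide +kernel)
  refine ⟨D, ?_, h2⟩
  intro a
  have e1 : ∀ a : Fin 4, (15 * 2 ^ (4 * a.1) + 65536) ∈ L17 := by decide +kernel
  have e2 : ∀ a : Fin 4, ∀ p : Option (Fin 4 × Fin 4), tbt (15 * 2 ^ (4 * a.1) + 65536) (c17 p) = true ↔
      ∀ q, p = some q → q.1 = a := by
    have e3 : ∀ a : Fin 4, ∀ p : Fin 4 × Fin 4, tbt (15 * 2 ^ (4 * a.1) + 65536) (cd p) = true ↔ p.1 = a := by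
      decide +kernel
    have e4 : ∀ a : Fin 4, tbt (15 * 2 ^ (4 * a.1) + 65536) 16 = true := by decide +kernel
    rintro a (_ | p)
    · simp [c17, e4]
    · simp [c17, e3]
  have := h1 _ (e1 a)
  simpa only [e2] using this

end P4c

section P4d

def wn (n i : ℕ) : ℕ :=
  cond (Nat.ble i 2) (Nat.shiftRight n (2 * i) % 4)
    (cond (Nat.beq i 3) (Nat.xor (n % 4) (Nat.xor (Nat.shiftRight 120 (2 * (n / 4 % 4)) % 4) (Nat.shiftRight 156 (2 * (n / 16)) % 4)))
      (Nat.xor (n % 4) (Nat.xor (n / 4 % 4) (n / 16))))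

def wchk : Bool := al 5 fun i => al 5 fun j => Nat.beq i j || al 5 fun k => (Nat.beq i k || Nat.beq j k) ||
  al 4 fun a => al 4 fun b => al 4 fun c => ax 64 fun n => Nat.beq (wn n i) a && (Nat.beq (wn n j) b && Nat.beq (wn n k) c)

theorem wchk_true : wchk = true := by decide +kernel

theorem wn_lt (n i : ℕ) (h : n < 64) (hi : i < 5) : wn n i < 4 := by
  have : (al 64 fun n => al 5 fun i => Nat.blt (wn n i) 4) = true := by decide +kernel
  have := (al_iff _ _).1 ((al_iff _ _).1 this n h) i hi
  simpa only [Nat.blt_eq] using this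

theorem td54 : ∃ W : Set (Fin 5 → Fin 4), (∀ i j k, i ≠ j → i ≠ k → j ≠ k → ∀ a b c, ∃ w ∈ W, w i = a ∧ w j = b ∧ w k = c) ∧
    ∀ i j k, i ≠ j → i ≠ k → j ≠ k → ∀ w ∈ W, ∀ w' ∈ W, w i = w' i → w j = w' j → w k = w' k → w = w' := by
  let f : Fin 64 → Fin 5 → Fin 4 := fun n i => ⟨wn n.1 i.1, wn_lt _ _ n.2 i.2⟩
  have ex : ∀ i j k : Fin 5, i ≠ j → i ≠ k → j ≠ k → ∀ a b c, ∃ n, f n i = a ∧ f n j = b ∧ f n k = c := by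
    intro i j k h1 h2 h3 a b c
    have k1 := (al_iff _ _).1 ((al_iff _ _).1 wchk_true i.1 i.2) j.1 j.2
    rw [show Nat.beq i.1 j.1 = false from Bool.eq_false_of_not_eq_true (by rw [bq_iff]; exact fun h => h1 (Fin.ext h)),
      Bool.false_or] at k1
    have k2 := (al_iff _ _).1 k1 k.1 k.2
    rw [show Nat.beq i.1 k.1 = false from Bool.eq_false_of_not_eq_true (by rw [bq_iff]; exact fun h => h2 (Fin.ext h)),
      show Nat.beq j.1 k.1 = false from Bool.eq_false_of_not_eq_true (by rw [bq_iff]; exact fun h => h3 (Fin.ext h)),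
      Bool.false_or, Bool.false_or] at k2
    have k3 := (al_iff _ _).1 ((al_iff _ _).1 ((al_iff _ _).1 k2 a.1 a.2) b.1 b.2) c.1 c.2
    rw [ax_iff] at k3
    obtain ⟨n, hn, h⟩ := k3
    simp only [Bool.and_eq_true, bq_iff] at h
    exact ⟨⟨n, hn⟩, Fin.ext h.1, Fin.ext h.2.1, Fin.ext h.2.2⟩
  refine ⟨Set.range f, ?_, ?_⟩
  · intro i j k h1 h2 h3 a b c
    obtain ⟨n, h⟩ := ex i j k h1 h2 h3 a b c
    exact ⟨f n, ⟨n, rfl⟩, h⟩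
  · rintro i j k h1 h2 h3 _ ⟨n, rfl⟩ _ ⟨n', rfl⟩ e1 e2 e3
    have hs : Function.Surjective (fun n => (f n i, f n j, f n k)) := by
      rintro ⟨a, b, c⟩
      obtain ⟨n, h⟩ := ex i j k h1 h2 h3 a b c
      exact ⟨n, by simp [h]⟩
    have := ((Fintype.bijective_iff_surjective_and_card _).2 ⟨hs, by simp⟩).1
    rw [this (show (f n i, f n j, f n k) = (f n' i, f n' j, f n' k) by rw [e1, e2, e3])]

theorem stn_split {k : ℕ} {V : Type} (h : Stn (k + 1) (Option V)) : ∃ D1 D2 : Set (Finset V),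
    (∀ β ∈ D1, β.card = k + 1) ∧ (∀ β ∈ D2, β.card = k) ∧
    (∀ a b c : V, a ≠ b → a ≠ c → b ≠ c → (∃ β ∈ D1, a ∈ β ∧ b ∈ β ∧ c ∈ β) ∨
      ∃ β ∈ D2, a ∈ β ∧ b ∈ β ∧ c ∈ β) ∧
    (∀ a b : V, a ≠ b → ∃ β ∈ D2, a ∈ β ∧ b ∈ β) ∧
    (∀ a b c : V, a ≠ b → a ≠ c → b ≠ c → ∀ β ∈ D1, ∀ β' ∈ D1, a ∈ β → b ∈ β → c ∈ β →
      a ∈ β' → b ∈ β' → c ∈ β' → β = β') ∧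
    (∀ a b c : V, a ≠ b → a ≠ c → b ≠ c → ∀ β ∈ D1, ∀ β' ∈ D2, a ∈ β → b ∈ β → c ∈ β →
      a ∈ β' → b ∈ β' → c ∈ β' → False) ∧
    (∀ a b : V, a ≠ b → ∀ β ∈ D2, ∀ β' ∈ D2, a ∈ β → b ∈ β →
      a ∈ β' → b ∈ β' → β = β') := by
  classical
  obtain ⟨D, h1, h2, h3⟩ := h
  have ms : ∀ (β : Finset V) a, a ∈ β → (some a) ∈ β.map Function.Embedding.some := fun β a h => by simpa using h
  have mi : ∀ (β : Finset V) a, a ∈ β → (some a) ∈ insertNone β := fun β a h => by simpa using h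
  have sn : ∀ a b : V, a ≠ b → some a ≠ some b := fun a b h h' => h (Option.some.inj h')
  have er : ∀ (β : Finset (Option V)) a, some a ∈ β → a ∈ eraseNone β := fun β a h => by simpa using h
  have e1 : ∀ β : Finset (Option V), none ∈ β → insertNone (eraseNone β) = β := by
    intro β hβ
    rw [insertNone_eraseNone, insert_eq_self.2 hβ]
  have e2 : ∀ β : Finset (Option V), none ∉ β → (eraseNone β).map Function.Embedding.some = β := by
    intro β hβ
    rw [map_some_eraseNone, erase_eq_of_notMem hβ]
  refine ⟨{β | β.map Function.Embedding.some ∈ D}, {β | insertNone β ∈ D}, ?_, ?_, ?_, ?_, ?_, ?_, ?_⟩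
  · intro β hβ
    rw [← h1 _ hβ, card_map]
  · intro β hβ
    have := h1 _ hβ
    rw [card_insertNone] at this
    omega
  · intro a b c n1 n2 n3
    obtain ⟨β, hβ, k1, k2, k3⟩ := h2 (some a) (some b) (some c) (sn _ _ n1) (sn _ _ n2) (sn _ _ n3)
    by_cases hn : none ∈ β
    · exact Or.inr ⟨eraseNone β, by show insertNone _ ∈ D; rw [e1 β hn]; exact hβ, er _ _ k1, er _ _ k2, er _ _ k3⟩
    · exact Or.inl ⟨eraseNone β, by show Finset.map _ _ ∈ D; rw [e2 β hn]; exact hβ, er _ _ k1, er _ _ k2, er _ _ k3⟩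
  · intro a b n1
    obtain ⟨β, hβ, k1, k2, k3⟩ := h2 none (some a) (some b) (by simp) (by simp) (sn _ _ n1)
    exact ⟨eraseNone β, by show insertNone _ ∈ D; rw [e1 β k1]; exact hβ, er _ _ k2, er _ _ k3⟩
  · intro a b c n1 n2 n3 β hβ β' hβ' k1 k2 k3 l1 l2 l3
    exact Finset.map_injective _ (h3 (some a) (some b) (some c) (sn _ _ n1) (sn _ _ n2) (sn _ _ n3) _ hβ _ hβ'
      (ms _ _ k1) (ms _ _ k2) (ms _ _ k3) (ms _ _ l1) (ms _ _ l2) (ms _ _ l3))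
  · intro a b c n1 n2 n3 β hβ β' hβ' k1 k2 k3 l1 l2 l3
    have := h3 (some a) (some b) (some c) (sn _ _ n1) (sn _ _ n2) (sn _ _ n3) _ hβ _ hβ'
      (ms _ _ k1) (ms _ _ k2) (ms _ _ k3) (mi _ _ l1) (mi _ _ l2) (mi _ _ l3)
    have h : none ∈ insertNone β' := by simp
    rw [← this] at h
    simp at h
  · intro a b n1 β hβ β' hβ' k1 k2 l1 l2
    have := h3 none (some a) (some b) (by simp) (by simp) (sn _ _ n1) _ hβ _ hβ'
      (by simp) (mi _ _ k1) (mi _ _ k2) (by simp) (mi _ _ l1) (mi _ _ l2)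
    have := congrArg eraseNone this
    simpa using this

theorem fillStn {k N : ℕ} (hN : 2 ≤ N) (h : Stn (k + 1) (Option (Fin N)))
    (F : Nonempty (Fr (Fin 4) (Fin 2) (Fin (k + 1)) univ)) (L : Nonempty (LF (Fin 4) (Fin 2) Unit (Fin k) univ)) :
    HasRD (2 * N - 1) := by
  obtain ⟨D1, D2, c1, c2, ex1, ex2, un1, un12, un2⟩ := stn_split h
  obtain ⟨F⟩ := F
  obtain ⟨L⟩ := L
  obtain ⟨r⟩ := fillGlue (G := Fin 4) (H := Fin 2) (H' := Unit) (U := Fin N) (by simpa using hN)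
    (by simp; omega) D1 D2 ex1 ex2 un1 un12 un2 (fun β hβ => F.on β (c1 β hβ)) (fun β hβ => L.on β (c2 β hβ))
  exact HasRD.of r (2 * N - 1) (by simp; omega) (by simp; omega)

end P4d

section P4e

theorem stn4 {V : Type} [Nontrivial V] (h : Stn 5 (Option V)) : Stn 5 (Option (V × Fin 4)) := by
  classical
  obtain ⟨D1, D2, c1, c2, ex1, ex2, un1, un12, un2⟩ := stn_split h
  obtain ⟨W, wex, wun⟩ := td54
  obtain ⟨D, dsp, dc, dex, dun⟩ := stn17
  have hf1 : ∀ γ : Finset V, ∃ f : Fin 5 → V, γ ∈ D1 → Function.Injective f ∧ ∀ x, x ∈ γ ↔ ∃ i, f i = x := by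
    intro γ
    by_cases hγ : γ ∈ D1
    · obtain ⟨f, hf⟩ := emb_of_card γ (c1 γ hγ)
      exact ⟨f, fun _ => ⟨f.injective, fun x => by rw [← hf]; simp⟩⟩
    · exact ⟨fun _ => (exists_pair_ne V).choose, fun h => absurd h hγ⟩
  choose f1 hf1 using hf1
  have hf2 : ∀ γ : Finset V, ∃ E : Option (Fin 4 × Fin 4) → Option (V × Fin 4), γ ∈ D2 → Function.Injective E ∧ E none = none ∧
      ∃ g : Fin 4 → V, Function.Injective g ∧ (∀ p, E (some p) = some (g p.1, p.2)) ∧ ∀ x, x ∈ γ ↔ ∃ i, g i = x := by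
    intro γ
    by_cases hγ : γ ∈ D2
    · obtain ⟨f, hf⟩ := emb_of_card γ (c2 γ hγ)
      refine ⟨Option.map (fun p => (f p.1, p.2)), fun _ => ⟨Option.map_injective ?_, rfl, f, f.injective, fun p => rfl, fun x => by rw [← hf]; simp⟩⟩
      rintro ⟨a, b⟩ ⟨c, d⟩ h
      simpa using h
    · exact ⟨fun _ => none, fun h => absurd h hγ⟩
  choose E hE using hf2
  -- points lying ovr γ
  have lift : ∀ γ ∈ D2, ∀ p : Option (V × Fin 4), (∀ q, p = some q → q.1 ∈ γ) → ∃ p', E γ p' = p := by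
    intro γ hγ p hp
    obtain ⟨e1, e2, g, g1, g2, g3⟩ := hE γ hγ
    rcases p with _ | ⟨a, j⟩
    · exact ⟨none, e2⟩
    · obtain ⟨i, hi⟩ := (g3 _).1 (hp _ rfl)
      exact ⟨some (i, j), by rw [g2]; simp_all⟩
  have ovr : ∀ γ ∈ D2, ∀ p q, E γ p = some q → q.1 ∈ γ := by
    intro γ hγ p q h
    obtain ⟨e1, e2, g, g1, g2, g3⟩ := hE γ hγ
    rcases p with _ | ⟨a, j⟩
    · rw [e2] at h; simp at h
    · rw [g2] at h
      rw [g3]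
      exact ⟨a, by simp at h; rw [← h]⟩
  -- coordinates coincide
  have col : ∀ γ ∈ D2, ∀ β ∈ D, ∀ a, ∀ x y z : Option (V × Fin 4), x ≠ y → x ≠ z → y ≠ z →
      x ∈ β.image (E γ) → y ∈ β.image (E γ) → z ∈ β.image (E γ) →
      (∀ q, x = some q → q.1 = a) → (∀ q, y = some q → q.1 = a) → (∀ q, z = some q → q.1 = a) →
      ∀ p, p ∈ β.image (E γ) ↔ ∀ q, p = some q → q.1 = a := by
    intro γ hγ β hβ a x y z n1 n2 n3 hx hy hz ax ay az p
    obtain ⟨e1, e2, g, g1, g2, g3⟩ := hE γ hγ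
    have ha : ∃ i, g i = a := by
      rw [← g3]
      rcases x with _ | x
      · rcases y with _ | y
        · exact absurd rfl n1
        · rw [← ay y rfl]
          obtain ⟨p, _, hp⟩ := mem_image.1 hy
          exact ovr γ hγ _ _ hp
      · rw [← ax x rfl]
        obtain ⟨p, _, hp⟩ := mem_image.1 hx
        exact ovr γ hγ _ _ hp
    obtain ⟨i, hi⟩ := ha
    have cc : ∀ r, (∀ q, E γ r = some q → q.1 = a) ↔ ∀ q, r = some q → q.1 = i := by
      intro r
      rcases r with _ | ⟨u, w⟩
      · simp [e2]
      · simp [g2, ← hi, g1.eq_iff]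
    obtain ⟨x', hx', rfl⟩ := mem_image.1 hx
    obtain ⟨y', hy', rfl⟩ := mem_image.1 hy
    obtain ⟨z', hz', rfl⟩ := mem_image.1 hz
    have := dun x' y' z' (fun h => n1 (by rw [h])) (fun h => n2 (by rw [h])) (fun h => n3 (by rw [h])) β hβ _ (dsp i)
      hx' hy' hz' (by simpa using (cc _).1 ax) (by simpa using (cc _).1 ay) (by simpa using (cc _).1 az)
    constructor
    · intro hp
      obtain ⟨p', hp', rfl⟩ := mem_image.1 hp
      rw [cc]
      rw [this] at hp'
      simpa using hp'
    · intro hp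
      obtain ⟨p', rfl⟩ := lift γ hγ p (fun q hq => by rw [g3, hp q hq]; exact ⟨i, hi⟩)
      rw [cc] at hp
      rw [mem_image]
      exact ⟨p', by rw [this]; simpa using hp, rfl⟩
  have t1 : ∀ γ ∈ D1, ∀ w : Fin 5 → Fin 4, ∀ x, x ∈ (univ : Finset (Fin 5)).image (fun i => some (f1 γ i, w i)) →
      ∃ i, x = some (f1 γ i, w i) := by
    intro γ hγ w x hx
    obtain ⟨i, _, h⟩ := mem_image.1 hx
    exact ⟨i, h.symm⟩
  have mx : ∀ γ ∈ D1, ∀ γ' ∈ D2, ∀ w : Fin 5 → Fin 4, ∀ β : Finset (Option (Fin 4 × Fin 4)), ∀ x y z, x ≠ y → x ≠ z → y ≠ z →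
      x ∈ (univ : Finset (Fin 5)).image (fun i => some (f1 γ i, w i)) →
      y ∈ (univ : Finset (Fin 5)).image (fun i => some (f1 γ i, w i)) →
      z ∈ (univ : Finset (Fin 5)).image (fun i => some (f1 γ i, w i)) →
      x ∈ β.image (E γ') → y ∈ β.image (E γ') → z ∈ β.image (E γ') → False := by
    intro γ hγ γ' hγ' w β x y z n1 n2 n3 hx hy hz kx ky kz
    obtain ⟨i, rfl⟩ := t1 γ hγ w x hx
    obtain ⟨j, rfl⟩ := t1 γ hγ w y hy
    obtain ⟨k, rfl⟩ := t1 γ hγ w z hz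
    obtain ⟨fi, fm⟩ := hf1 γ hγ
    have q1 : f1 γ i ≠ f1 γ j := fun h => n1 (by rw [fi h])
    have q2 : f1 γ i ≠ f1 γ k := fun h => n2 (by rw [fi h])
    have q3 : f1 γ j ≠ f1 γ k := fun h => n3 (by rw [fi h])
    have o : ∀ i, some (f1 γ i, w i) ∈ β.image (E γ') → f1 γ i ∈ γ' := by
      intro i hi
      obtain ⟨p, _, hp⟩ := mem_image.1 hi
      exact ovr γ' hγ' _ _ hp
    exact un12 _ _ _ q1 q2 q3 γ hγ γ' hγ' ((fm _).2 ⟨i, rfl⟩) ((fm _).2 ⟨j, rfl⟩) ((fm _).2 ⟨k, rfl⟩)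
      (o i kx) (o j ky) (o k kz)
  refine ⟨{b | (∃ γ ∈ D1, ∃ w ∈ W, b = (univ : Finset (Fin 5)).image (fun i => some (f1 γ i, w i))) ∨
    ∃ γ ∈ D2, ∃ β ∈ D, b = β.image (E γ)}, ?_, ?_, ?_⟩
  · rintro b (⟨γ, hγ, w, hw, rfl⟩ | ⟨γ, hγ, β, hβ, rfl⟩)
    · rw [card_image_of_injective]
      · simp
      · intro i j h
        simp at h
        exact (hf1 γ hγ).1 h.1
    · rw [card_image_of_injective _ (hE γ hγ).1, dc β hβ]
  · intro x y z n1 n2 n3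
    have fin2 : ∀ γ ∈ D2, (∀ q, x = some q → q.1 ∈ γ) → (∀ q, y = some q → q.1 ∈ γ) → (∀ q, z = some q → q.1 ∈ γ) →
        ∃ b ∈ {b | (∃ γ ∈ D1, ∃ w ∈ W, b = (univ : Finset (Fin 5)).image (fun i => some (f1 γ i, w i))) ∨
    ∃ γ ∈ D2, ∃ β ∈ D, b = β.image (E γ)}, x ∈ b ∧ y ∈ b ∧ z ∈ b := by
      intro γ hγ hx hy hz
      obtain ⟨x', rfl⟩ := lift γ hγ x hx
      obtain ⟨y', rfl⟩ := lift γ hγ y hy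
      obtain ⟨z', rfl⟩ := lift γ hγ z hz
      obtain ⟨β, hβ, k1, k2, k3⟩ := dex x' y' z' (fun h => n1 (by rw [h])) (fun h => n2 (by rw [h])) (fun h => n3 (by rw [h]))
      exact ⟨_, Or.inr ⟨γ, hγ, β, hβ, rfl⟩, mem_image_of_mem _ k1, mem_image_of_mem _ k2, mem_image_of_mem _ k3⟩
    have two : ∀ a b : V, ∃ γ ∈ D2, a ∈ γ ∧ b ∈ γ := by
      intro a b
      by_cases hab : a = b
      · obtain ⟨c, hc⟩ := exists_ne a
        obtain ⟨γ, hγ, h1, h2⟩ := ex2 a c hc.symm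
        exact ⟨γ, hγ, h1, hab ▸ h1⟩
      · exact ex2 a b hab
    have fin3 : (∃ a b : V, (∀ q, x = some q → q.1 = a ∨ q.1 = b) ∧ (∀ q, y = some q → q.1 = a ∨ q.1 = b) ∧ (∀ q, z = some q → q.1 = a ∨ q.1 = b)) →
        ∃ b ∈ {b | (∃ γ ∈ D1, ∃ w ∈ W, b = (univ : Finset (Fin 5)).image (fun i => some (f1 γ i, w i))) ∨
    ∃ γ ∈ D2, ∃ β ∈ D, b = β.image (E γ)}, x ∈ b ∧ y ∈ b ∧ z ∈ b := by
      rintro ⟨a, b, h1, h2, h3⟩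
      obtain ⟨γ, hγ, ka, kb⟩ := two a b
      refine fin2 γ hγ ?_ ?_ ?_
      · intro q hq
        rcases h1 q hq with h | h <;> rw [h] <;> assumption
      · intro q hq
        rcases h2 q hq with h | h <;> rw [h] <;> assumption
      · intro q hq
        rcases h3 q hq with h | h <;> rw [h] <;> assumption
    rcases x with _ | x
    · rcases y with _ | y
      · exact absurd rfl n1
      · rcases z with _ | z
        · exact absurd rfl n2
        · exact fin3 ⟨y.1, z.1, by simp, by simp, by simp⟩
    · rcases y with _ | y
      · rcases z with _ | z
        · exact absurd rfl n3
        · exact fin3 ⟨x.1, z.1, by simp, by simp, by simp⟩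
      · rcases z with _ | z
        · exact fin3 ⟨x.1, y.1, by simp, by simp, by simp⟩
        · by_cases e1 : x.1 = y.1
          · exact fin3 ⟨x.1, z.1, by simp, by simp [e1], by simp⟩
          by_cases e2 : x.1 = z.1
          · exact fin3 ⟨x.1, y.1, by simp, by simp, by simp [e2]⟩
          by_cases e3 : y.1 = z.1
          · exact fin3 ⟨x.1, y.1, by simp, by simp, by simp [e3]⟩
          rcases ex1 _ _ _ e1 e2 e3 with ⟨γ, hγ, k1, k2, k3⟩ | ⟨γ, hγ, k1, k2, k3⟩
          · obtain ⟨fi, fm⟩ := hf1 γ hγ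
            obtain ⟨i, hi⟩ := (fm _).1 k1
            obtain ⟨j, hj⟩ := (fm _).1 k2
            obtain ⟨k, hk⟩ := (fm _).1 k3
            obtain ⟨w, hw, w1, w2, w3⟩ := wex i j k (fun h => e1 (by rw [← hi, ← hj, h])) (fun h => e2 (by rw [← hi, ← hk, h]))
              (fun h => e3 (by rw [← hj, ← hk, h])) x.2 y.2 z.2
            refine ⟨_, Or.inl ⟨γ, hγ, w, hw, rfl⟩, mem_image.2 ⟨i, mem_univ _, ?_⟩, mem_image.2 ⟨j, mem_univ _, ?_⟩, mem_image.2 ⟨k, mem_univ _, ?_⟩⟩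
            · rw [hi, w1]
            · rw [hj, w2]
            · rw [hk, w3]
          · exact fin2 γ hγ (by simpa using k1) (by simpa using k2) (by simpa using k3)
  · rintro x y z n1 n2 n3 _ (⟨γ, hγ, w, hw, rfl⟩ | ⟨γ, hγ, β, hβ, rfl⟩) _ (⟨γ', hγ', w', hw', rfl⟩ | ⟨γ', hγ', β', hβ', rfl⟩) hx hy hz kx ky kz
    · obtain ⟨i, rfl⟩ := t1 γ hγ w x hx
      obtain ⟨j, rfl⟩ := t1 γ hγ w y hy
      obtain ⟨k, rfl⟩ := t1 γ hγ w z hz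
      obtain ⟨i', hi⟩ := t1 γ' hγ' w' _ kx
      obtain ⟨j', hj⟩ := t1 γ' hγ' w' _ ky
      obtain ⟨k', hk⟩ := t1 γ' hγ' w' _ kz
      simp only [Option.some.injEq, Prod.mk.injEq] at hi hj hk
      obtain ⟨fi, fm⟩ := hf1 γ hγ
      obtain ⟨fi', fm'⟩ := hf1 γ' hγ'
      have p1 : i ≠ j := fun h => n1 (by rw [h])
      have p2 : i ≠ k := fun h => n2 (by rw [h])
      have p3 : j ≠ k := fun h => n3 (by rw [h])
      obtain rfl := un1 _ _ _ (fi.ne p1) (fi.ne p2) (fi.ne p3) γ hγ γ' hγ' ((fm _).2 ⟨i, rfl⟩) ((fm _).2 ⟨j, rfl⟩) ((fm _).2 ⟨k, rfl⟩)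
        ((fm' _).2 ⟨i', hi.1.symm⟩) ((fm' _).2 ⟨j', hj.1.symm⟩) ((fm' _).2 ⟨k', hk.1.symm⟩)
      obtain rfl := fi hi.1
      obtain rfl := fi hj.1
      obtain rfl := fi hk.1
      rw [wun i j k p1 p2 p3 w hw w' hw' hi.2 hj.2 hk.2]
    · exact (mx γ hγ γ' hγ' w β' x y z n1 n2 n3 hx hy hz kx ky kz).elim
    · exact (mx γ' hγ' γ hγ w' β x y z n1 n2 n3 kx ky kz hx hy hz).elim
    · by_cases hg : γ = γ'
      · subst hg
        obtain ⟨x', hx', rfl⟩ := mem_image.1 hx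
        obtain ⟨y', hy', rfl⟩ := mem_image.1 hy
        obtain ⟨z', hz', rfl⟩ := mem_image.1 hz
        have ei := (hE γ hγ).1
        rw [ei.mem_finset_image] at kx ky kz
        rw [dun x' y' z' (fun h => n1 (by rw [h])) (fun h => n2 (by rw [h])) (fun h => n3 (by rw [h])) β hβ β' hβ' hx' hy' hz' kx ky kz]
      · have ov : ∀ (γ) (_ : γ ∈ D2) (β : Finset (Option (Fin 4 × Fin 4))) q, some q ∈ β.image (E γ) → q.1 ∈ γ := by
          intro γ hγ β q hq
          obtain ⟨p, _, hp⟩ := mem_image.1 hq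
          exact ovr γ hγ _ _ hp
        have same : ∀ q q', some q ∈ β.image (E γ) → some q' ∈ β.image (E γ) → some q ∈ β'.image (E γ') → some q' ∈ β'.image (E γ') →
            q.1 = q'.1 := by
          intro q q' h1 h2 h3 h4
          by_contra hne
          exact hg (un2 _ _ hne γ hγ γ' hγ' (ov γ hγ β q h1) (ov γ hγ β q' h2) (ov γ' hγ' β' q h3) (ov γ' hγ' β' q' h4))
        have : ∃ a, (∀ q, x = some q → q.1 = a) ∧ (∀ q, y = some q → q.1 = a) ∧ (∀ q, z = some q → q.1 = a) := by
          rcases x with _ | x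
          · rcases y with _ | y
            · exact absurd rfl n1
            · exact ⟨y.1, by simp, by simp, fun q hq => by subst hq; exact same _ _ hz hy kz ky⟩
          · exact ⟨x.1, by simp, fun q hq => by subst hq; exact same _ _ hy hx ky kx, fun q hq => by subst hq; exact same _ _ hz hx kz kx⟩
        obtain ⟨a, a1, a2, a3⟩ := this
        ext p
        rw [col γ hγ β hβ a x y z n1 n2 n3 hx hy hz a1 a2 a3, col γ' hγ' β' hβ' a x y z n1 n2 n3 kx ky kz a1 a2 a3]

theorem stn_A (n : ℕ) : ∀ j, 4 ^ j * 25 ^ n ≠ 1 → Stn 5 (Option (Fin (4 ^ j * 25 ^ n))) := by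
  rcases Nat.eq_zero_or_pos n with rfl | hn
  · intro j hj
    rw [pow_zero, mul_one] at hj ⊢
    exact stn_pow 4 j (by decide +kernel) (by rintro rfl; simp at hj)
  · intro j
    induction j with
    | zero =>
      intro _
      rw [pow_zero, one_mul]
      exact stn26.comp (stn_pow 25 n ((isPrimePow_nat_iff 25).2 ⟨5, 2, by norm_num, by norm_num, by norm_num⟩) (by omega))
    | succ j ih =>
      intro _
      have h25 : 2 ≤ 4 ^ j * 25 ^ n := by
        have h1 : 25 ^ 1 ≤ 25 ^ n := Nat.pow_le_pow_right (by norm_num) hn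
        have h2 : 0 < 4 ^ j := by positivity
        nlinarith
      haveI : Nontrivial (Fin (4 ^ j * 25 ^ n)) := Fin.nontrivial_iff_two_le.2 h25
      have := stn4 (ih (by omega))
      refine this.tr (Equiv.optionCongr (Fintype.equivFinOfCardEq ?_))
      simp; ring

theorem hasRD_one : HasRD 1 := by
  obtain ⟨r, _⟩ := RDS.mk' (X := Fin 4) (H := Fin 1) (by simp) {univ} (fun _ _ _ => True) (by simp) (by simp)
    (by simp) (by rintro b rfl b' rfl; simp)
  exact HasRD.of r 1 (by simp) (by simp)

theorem famA (m n : ℕ) (hm : 1 ≤ m) : HasRD (2 * (4 ^ (m - 1) * 25 ^ n) - 1) := by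
  by_cases h : 4 ^ (m - 1) * 25 ^ n = 1
  · rw [h]; exact hasRD_one
  · have : 0 < 4 ^ (m - 1) * 25 ^ n := by positivity
    exact fillStn (by omega) (stn_A n _ h) fr45 lf4

theorem famB (n : ℕ) : HasRD (2 * 7 ^ n - 1) := by
  rcases Nat.eq_zero_or_pos n with rfl | hn
  · exact hasRD_one
  · have h1 : 7 ^ 1 ≤ 7 ^ n := Nat.pow_le_pow_right (by norm_num) hn
    exact fillStn (by omega) (stn_pow 7 n (Nat.Prime.isPrimePow (by norm_num)) (by omega)) fr48 lf7

end P4e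

section P6a
open OnePoint Matrix

variable {K : Type} [Field K] [DecidableEq K]

def sqd (g : GL (Fin 2) K) : Prop := IsSquare (g.val.det)

theorem sqd_mul {g h : GL (Fin 2) K} (hg : sqd g) (hh : sqd h) : sqd (g * h) := by
  unfold sqd at *
  rw [Units.val_mul, det_mul]
  exact hg.mul hh

theorem sqd_mg (a b c d : K) (h : a * d - b * c ≠ 0) (h' : IsSquare (a * d - b * c)) : sqd (mg a b c d h) := by
  unfold sqd mg
  simpa [GeneralLinearGroup.mkOfDetNeZero, det_fin_two_of] using h'

theorem sqd_inv {g : GL (Fin 2) K} (hg : sqd g) : sqd g⁻¹ := by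
  unfold sqd at *
  have : (g⁻¹).val.det * g.val.det = 1 := by
    rw [← det_mul, ← Units.val_mul]; simp
  rw [eq_inv_of_mul_eq_one_left this]
  exact hg.inv

theorem gl1' (x : OnePoint K) : ∃ g : GL (Fin 2) K, g • (∞ : OnePoint K) = x ∧ sqd g := by
  induction x using OnePoint.rec with
  | infty => exact ⟨1, one_smul _ _, by simp [sqd]⟩
  | coe a => exact ⟨mg a (-1) 1 0 (by simp), by rw [mg_inf]; simp, sqd_mg _ _ _ _ _ (by simp)⟩

noncomputable def rr (a : OnePoint K) : GL (Fin 2) K := (gl1' a).choose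
theorem rr_inf (a : OnePoint K) : rr a • (∞ : OnePoint K) = a := (gl1' a).choose_spec.1
theorem rr_sq (a : OnePoint K) : sqd (rr a) := (gl1' a).choose_spec.2

theorem rr_ex (a c : OnePoint K) (h : c ≠ a) : ∃ p : K, c = rr a • (p : OnePoint K) := by
  obtain ⟨y, rfl⟩ : ∃ y', c = rr a • y' := ⟨(rr a)⁻¹ • c, by simp⟩
  induction y using OnePoint.rec with
  | infty => exact absurd (rr_inf a) h
  | coe y => exact ⟨y, rfl⟩

theorem rr_inj (a : OnePoint K) (p q : K) : rr a • (p : OnePoint K) = rr a • (q : OnePoint K) ↔ p = q := by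
  rw [(MulAction.injective (rr a)).eq_iff, OnePoint.coe_eq_coe]

theorem rr_ne (a : OnePoint K) (p : K) : rr a • (p : OnePoint K) ≠ a := by
  intro h
  have := h.trans (rr_inf a).symm
  rw [(MulAction.injective (rr a)).eq_iff] at this
  exact OnePoint.coe_ne_infty _ this

theorem stab_aff (g : GL (Fin 2) K) (h1 : g • (∞ : OnePoint K) = ∞) (h2 : sqd g) :
    ∃ s t : K, s ≠ 0 ∧ IsSquare s ∧ ∀ z : K, g • (z : OnePoint K) = ((t + s * z : K) : OnePoint K) := by
  rw [smul_infty_eq_self_iff] at h1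
  have hd : g.val.det = g 0 0 * g 1 1 := by
    rw [det_fin_two]; change g 0 0 * g 1 1 - g 0 1 * g 1 0 = _
    rw [h1]; ring
  have h0 : g 0 0 * g 1 1 ≠ 0 := by
    rw [← hd]
    exact (g.isUnit.map (detMonoidHom)).ne_zero
  have ha := left_ne_zero_of_mul h0
  have hb := right_ne_zero_of_mul h0
  refine ⟨g 0 0 / g 1 1, g 0 1 / g 1 1, div_ne_zero ha hb, ?_, ?_⟩
  · have : g 0 0 / g 1 1 = (g 0 0 * g 1 1) / (g 1 1 * g 1 1) := by field_simp
    rw [this, ← hd]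
    exact h2.div (IsSquare.mul_self _)
  · intro z
    rw [smul_some_eq_ite]
    simp only [h1, zero_mul, zero_add, if_neg hb]
    congr 1
    field_simp
    ring

open scoped Classical in
noncomputable def QQ (w : K) (g : GL (Fin 2) K) (e0 e1 e2 e3 : ZMod 2) : Finset (OnePoint K × ZMod 2) :=
  {(g • (∞ : OnePoint K), e0), (g • ((1 : K) : OnePoint K), e1), (g • (w : OnePoint K), e2), (g • ((w ^ 2 : K) : OnePoint K), e3)}

open scoped Classical in
noncomputable def NN (w : K) (a : OnePoint K) (l : ZMod 2) (s t : K) (f1 f2 f3 : ZMod 2) : Finset (OnePoint K × ZMod 2) :=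
  {(a, l), (rr a • ((t + s : K) : OnePoint K), l + f1), (rr a • ((t + s * w : K) : OnePoint K), l + f2),
    (rr a • ((t + s * w ^ 2 : K) : OnePoint K), l + f3)}

def BB (w : K) : Set (Finset (OnePoint K × ZMod 2)) :=
  {b | ∃ g e0 e1 e2 e3, sqd g ∧ e0 + e1 + e2 + e3 = 1 ∧ b = QQ w g e0 e1 e2 e3}

theorem ins4 {α : Type} {_ : DecidableEq α} (a b c d : α) : ({a, b, c, d} : Finset α) = {b, a, d, c} := by
  ext x; simp only [mem_insert, mem_singleton]; tauto

theorem ins4' {α : Type} {_ : DecidableEq α} (a b c d : α) : ({a, b, c, d} : Finset α) = {a, c, d, b} := by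
  ext x; simp only [mem_insert, mem_singleton]; tauto

variable (w : K) (hw : w ^ 2 + w + 1 = 0)

theorem w3 (hw : w ^ 2 + w + 1 = 0) : w ^ 3 = 1 := by linear_combination (w - 1) * hw

theorem w0 (hw : w ^ 2 + w + 1 = 0) : w ≠ 0 := by rintro rfl; simp at hw

theorem w1 (hw : w ^ 2 + w + 1 = 0) (h3 : (3 : K) ≠ 0) : w ≠ 1 := by
  rintro rfl; apply h3; linear_combination hw

theorem wsq (hw : w ^ 2 + w + 1 = 0) : IsSquare w := ⟨w ^ 2, by linear_combination (-w ) * w3 w hw⟩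

theorem qq_sig (hw : w ^ 2 + w + 1 = 0) (g : GL (Fin 2) K) (e0 e1 e2 e3 : ZMod 2) :
    QQ w g e0 e1 e2 e3 = QQ w (g * mg w 0 0 1 (by simpa using w0 w hw)) e0 e2 e3 e1 := by
  have h := w3 w hw
  unfold QQ
  simp only [mul_smul, mg_inf, mg_some]
  rw [ins4']
  simp only [zero_mul, zero_add, one_ne_zero, if_false, if_true, add_zero, div_one, mul_one]
  rw [show w * w = w ^ 2 by ring, show w * w ^ 2 = 1 by rw [← h]; ring]

theorem qq_tau (hw : w ^ 2 + w + 1 = 0) (h3 : (3 : K) ≠ 0) (g : GL (Fin 2) K) (e0 e1 e2 e3 : ZMod 2) :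
    QQ w g e0 e1 e2 e3 = QQ w (g * mg 1 2 1 (-1) (by intro h; apply h3; linear_combination -h)) e1 e0 e3 e2 := by
  have h1 := w1 w hw h3
  have h := w3 w hw
  have k1 : w + -1 ≠ 0 := fun h => h1 (by linear_combination h)
  have k2 : w ^ 2 + -1 ≠ 0 := fun h' => h1 (by linear_combination h - w * h')
  unfold QQ
  simp only [mul_smul, mg_inf, mg_some]
  rw [ins4]
  simp only [one_mul, one_ne_zero, if_false, if_true, div_one, mul_one, add_neg_cancel, if_neg k1, if_neg k2]
  rw [show (w + 2) / (w + -1) = w ^ 2 by rw [div_eq_iff k1]; linear_combination hw - h,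
    show (w ^ 2 + 2) / (w ^ 2 + -1) = w by rw [div_eq_iff k2]; linear_combination hw - h]

theorem nn_mem (hw : w ^ 2 + w + 1 = 0) (a : OnePoint K) (l : ZMod 2) (s t : K) (f1 f2 f3 : ZMod 2) (hs : s ≠ 0) (hs' : IsSquare s)
    (hf : f1 + f2 + f3 = 1) : NN w a l s t f1 f2 f3 ∈ BB w := by
  refine ⟨rr a * mg s t 0 1 (by simpa using hs), l, l + f1, l + f2, l + f3, sqd_mul (rr_sq a) (sqd_mg _ _ _ _ _ (by simpa using hs')), ?_, ?_⟩
  · decide +revert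
  · unfold QQ NN
    simp only [mul_smul, mg_inf, mg_some]
    simp [rr_inf, add_comm]

theorem nn_rot (hw : w ^ 2 + w + 1 = 0) (a : OnePoint K) (l : ZMod 2) (s t : K) (f1 f2 f3 : ZMod 2) :
    NN w a l s t f1 f2 f3 = NN w a l (s * w) t f2 f3 f1 := by
  unfold NN
  rw [ins4', show s * w * w = s * w ^ 2 by ring, show s * w * w ^ 2 = s by linear_combination s * w3 w hw]

theorem qq_nn (g : GL (Fin 2) K) (hg : sqd g) (e0 e1 e2 e3 : ZMod 2) : ∃ s t : K, s ≠ 0 ∧ IsSquare s ∧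
    QQ w g e0 e1 e2 e3 = NN w (g • ∞) e0 s t (e0 + e1) (e0 + e2) (e0 + e3) := by
  obtain ⟨s, t, hs, hs', h⟩ := stab_aff ((rr (g • (∞ : OnePoint K)))⁻¹ * g) (by rw [mul_smul, inv_smul_eq_iff, rr_inf])
    (sqd_mul (sqd_inv (rr_sq _)) hg)
  refine ⟨s, t, hs, hs', ?_⟩
  have h' : ∀ z : K, g • (z : OnePoint K) = rr (g • (∞ : OnePoint K)) • ((t + s * z : K) : OnePoint K) := by
    intro z
    rw [← h, mul_smul, smul_inv_smul]
  have e : ∀ a b : ZMod 2, a + (a + b) = b := by decide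
  unfold QQ NN
  rw [h', h', h', e, e, e, mul_one]

theorem bb_nf (hw : w ^ 2 + w + 1 = 0) (h3 : (3 : K) ≠ 0) (hm : IsSquare (-3 : K)) (b : Finset (OnePoint K × ZMod 2)) (hb : b ∈ BB w)
    (a : OnePoint K) (l : ZMod 2) (h : (a, l) ∈ b) :
    ∃ s t : K, s ≠ 0 ∧ IsSquare s ∧ (b = NN w a l s t 1 1 1 ∨ b = NN w a l s t 1 0 0) := by
  have hs : sqd (mg w 0 0 1 (by simpa using w0 w hw)) := sqd_mg _ _ _ _ _ (by simpa using wsq w hw)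
  have ht : sqd (mg 1 2 1 (-1) (by intro h; apply h3; linear_combination -h) : GL (Fin 2) K) :=
    sqd_mg _ _ _ _ _ (by convert hm using 1; ring)
  have key : ∃ g e0 e1 e2 e3, sqd g ∧ e0 + e1 + e2 + e3 = 1 ∧ b = QQ w g e0 e1 e2 e3 ∧ g • ∞ = a ∧ e0 = l := by
    have st1 : ∀ g e0 e1 e2 e3, sqd g → e0 + e1 + e2 + e3 = 1 → b = QQ w g e0 e1 e2 e3 → g • ((1 : K) : OnePoint K) = a → e1 = l →
        ∃ g e0 e1 e2 e3, sqd g ∧ e0 + e1 + e2 + e3 = 1 ∧ b = QQ w g e0 e1 e2 e3 ∧ g • ∞ = a ∧ e0 = l := by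
      intro g e0 e1 e2 e3 hg he hb ha hl
      refine ⟨_, e1, e0, e3, e2, sqd_mul hg ht, ?_, hb.trans (qq_tau w hw h3 _ _ _ _ _), ?_, hl⟩
      · rw [← he]; ring
      · rw [mul_smul, mg_inf]; simpa using ha
    have st2 : ∀ g e0 e1 e2 e3, sqd g → e0 + e1 + e2 + e3 = 1 → b = QQ w g e0 e1 e2 e3 → g • (w : OnePoint K) = a → e2 = l →
        ∃ g e0 e1 e2 e3, sqd g ∧ e0 + e1 + e2 + e3 = 1 ∧ b = QQ w g e0 e1 e2 e3 ∧ g • ∞ = a ∧ e0 = l := by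
      intro g e0 e1 e2 e3 hg he hb ha hl
      refine st1 _ e0 e2 e3 e1 (sqd_mul hg hs) ?_ (hb.trans (qq_sig w hw _ _ _ _ _)) ?_ hl
      · rw [← he]; ring
      · rw [mul_smul, mg_some]; simpa using ha
    obtain ⟨g, e0, e1, e2, e3, hg, he, hb⟩ := hb
    have h' := h
    rw [hb] at h'
    simp only [QQ, mem_insert, mem_singleton, Prod.mk.injEq] at h'
    rcases h' with ⟨k1, k2⟩ | ⟨k1, k2⟩ | ⟨k1, k2⟩ | ⟨k1, k2⟩
    · exact ⟨g, e0, e1, e2, e3, hg, he, hb, k1.symm, k2.symm⟩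
    · exact st1 g e0 e1 e2 e3 hg he hb k1.symm k2.symm
    · exact st2 g e0 e1 e2 e3 hg he hb k1.symm k2.symm
    · refine st2 _ e0 e2 e3 e1 (sqd_mul hg hs) ?_ (hb.trans (qq_sig w hw _ _ _ _ _)) ?_ k2.symm
      · rw [← he]; ring
      · rw [mul_smul, mg_some, k1]; simp; congr 2; ring
  obtain ⟨g, e0, e1, e2, e3, hg, he, hb, rfl, rfl⟩ := key
  obtain ⟨s, t, s0, s1, hq⟩ := qq_nn w g hg e0 e1 e2 e3
  rw [hq] at hb
  have cs : (e0 + e1 = 1 ∧ e0 + e2 = 1 ∧ e0 + e3 = 1) ∨ (e0 + e1 = 1 ∧ e0 + e2 = 0 ∧ e0 + e3 = 0) ∨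
      (e0 + e1 = 0 ∧ e0 + e2 = 1 ∧ e0 + e3 = 0) ∨ (e0 + e1 = 0 ∧ e0 + e2 = 0 ∧ e0 + e3 = 1) := by
    clear hb hq h
    decide +revert
  have hw0 := w0 w hw
  have hws := wsq w hw
  rcases cs with ⟨c1, c2, c3⟩ | ⟨c1, c2, c3⟩ | ⟨c1, c2, c3⟩ | ⟨c1, c2, c3⟩ <;> rw [c1, c2, c3] at hb
  · exact ⟨s, t, s0, s1, Or.inl hb⟩
  · exact ⟨s, t, s0, s1, Or.inr hb⟩
  · exact ⟨s * w, t, mul_ne_zero s0 hw0, s1.mul hws, Or.inr (hb.trans (nn_rot w hw _ _ _ _ _ _ _))⟩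
  · exact ⟨s * w * w, t, mul_ne_zero (mul_ne_zero s0 hw0) hw0, (s1.mul hws).mul hws,
      Or.inr (hb.trans ((nn_rot w hw _ _ _ _ _ _ _).trans (nn_rot w hw _ _ _ _ _ _ _)))⟩

end P6a

section P6b
open OnePoint Matrix

variable {K : Type} [Field K] [DecidableEq K]

theorem qq_ne (w : K) (hw : w ^ 2 + w + 1 = 0) (h3 : (3 : K) ≠ 0) (g : GL (Fin 2) K) :
    g • (∞ : OnePoint K) ≠ g • ((1 : K) : OnePoint K) ∧ g • (∞ : OnePoint K) ≠ g • (w : OnePoint K) ∧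
    g • (∞ : OnePoint K) ≠ g • ((w ^ 2 : K) : OnePoint K) ∧ g • ((1 : K) : OnePoint K) ≠ g • (w : OnePoint K) ∧
    g • ((1 : K) : OnePoint K) ≠ g • ((w ^ 2 : K) : OnePoint K) ∧ g • (w : OnePoint K) ≠ g • ((w ^ 2 : K) : OnePoint K) := by
  have h1 := w1 w hw h3
  have h := w3 w hw
  have i := fun x y : OnePoint K => (MulAction.injective (β := OnePoint K) g).eq_iff (a := x) (b := y)
  refine ⟨?_, ?_, ?_, ?_, ?_, ?_⟩ <;> rw [Ne, i]
  · exact OnePoint.infty_ne_coe _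
  · exact OnePoint.infty_ne_coe _
  · exact OnePoint.infty_ne_coe _
  · rw [OnePoint.coe_eq_coe]; exact fun h => h1 h.symm
  · rw [OnePoint.coe_eq_coe]; exact fun h' => h1 (by linear_combination h + w * h')
  · rw [OnePoint.coe_eq_coe]; exact fun h' => h1 (by linear_combination h + (w + 1) * h')

theorem fr_field [Fintype K] (hq : Fintype.card K % 12 = 7) : Nonempty (Fr (ZMod 2) Unit (OnePoint K) univ) := by
  classical
  have hm1 : ¬ IsSquare (-1 : K) := by
    rw [FiniteField.isSquare_neg_one_iff]; omega
  obtain ⟨w, hw1, hw⟩ : ∃ w : K, w - 1 ≠ 0 ∧ w ^ 2 + w + 1 = 0 := by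
    obtain ⟨g, hg⟩ := IsCyclic.exists_generator (α := Kˣ)
    have ho : orderOf g = Fintype.card K - 1 := by
      rw [orderOf_eq_card_of_forall_mem_zpowers hg, Nat.card_eq_fintype_card, Fintype.card_units]
    set m := (Fintype.card K - 1) / 3 with hmd
    have h3m : 3 * m = Fintype.card K - 1 := by omega
    have e1 : (g ^ m) ^ 3 = 1 := by
      rw [← pow_mul, mul_comm, h3m, ← ho, pow_orderOf_eq_one]
    have e2 : g ^ m ≠ 1 := by
      intro h
      have := orderOf_dvd_of_pow_eq_one h
      have := Nat.le_of_dvd (by omega) this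
      omega
    have e3 : ((g ^ m : Kˣ) : K) ^ 3 = 1 := by
      rw [← Units.val_pow_eq_pow_val, e1]; rfl
    have e4 : ((g ^ m : Kˣ) : K) - 1 ≠ 0 := by
      intro h
      exact e2 (Units.ext (sub_eq_zero.1 h))
    refine ⟨((g ^ m : Kˣ) : K), e4, ?_⟩
    apply mul_left_cancel₀ e4
    linear_combination e3
  have hs3 : IsSquare (-3 : K) := ⟨2 * w + 1, by linear_combination -4 * hw⟩
  have h3 : (3 : K) ≠ 0 := by
    intro h0
    apply mul_ne_zero hw1 hw1
    linear_combination hw - w * h0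
  have hn3 : ¬ IsSquare (3 : K) := by
    intro h
    apply hm1
    have : (-1 : K) = -3 / 3 := by field_simp
    rw [this]; exact hs3.div h
  have hneg : ∀ x : K, x ≠ 0 → IsSquare x ∨ IsSquare (-x) := by
    intro x hx
    by_cases h : IsSquare x
    · exact Or.inl h
    · right
      have k1 := quadraticChar_neg_one_iff_not_isSquare.2 h
      have k2 := quadraticChar_neg_one_iff_not_isSquare.2 hm1
      rw [← quadraticChar_one_iff_isSquare (neg_ne_zero.2 hx), neg_eq_neg_one_mul, map_mul, k1, k2]
      norm_num
  have hw0 := w0 w hw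
  have hww := w3 w hw
  have hwne : w ≠ 1 := fun h => hw1 (by rw [h]; ring)
  have hw2 : w ^ 2 ≠ 1 := fun h' => hwne (by linear_combination hww - w * h')
  -- membership in normal forms
  have nnm : ∀ (a : OnePoint K) (l : ZMod 2) (s t : K) (f1 f2 f3 : ZMod 2) (p : K) (m : ZMod 2), ((rr a • (p : OnePoint K), m) : OnePoint K × ZMod 2) ∈ NN w a l s t f1 f2 f3 →
      (p = t + s ∧ m = l + f1) ∨ (p = t + s * w ∧ m = l + f2) ∨ (p = t + s * w ^ 2 ∧ m = l + f3) := by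
    intro a l s t f1 f2 f3 p m h
    simp only [NN, mem_insert, mem_singleton, Prod.mk.injEq, rr_inj] at h
    rcases h with h | h
    · exact absurd h.1 (rr_ne a p)
    · exact h
  have btr : ∀ b ∈ BB w, ∀ x ∈ b, ∀ y ∈ b, x.1 = y.1 → x = y := by
    rintro b ⟨g, e0, e1, e2, e3, hg, he, rfl⟩ x hx y hy hxy
    obtain ⟨n1, n2, n3, n4, n5, n6⟩ := qq_ne w hw h3 g
    simp only [QQ, mem_insert, mem_singleton] at hx hy
    rcases hx with rfl | rfl | rfl | rfl <;> rcases hy with rfl | rfl | rfl | rfl <;>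
      first
      | rfl
      | exact absurd hxy (by assumption)
      | exact absurd hxy.symm (by assumption)
  have lv : ∀ l m : ZMod 2, ∃ f, m = l + f := by decide
  have lne : ∀ l : ZMod 2, l + 1 ≠ l := by decide
  refine ⟨⟨BB w, fun x c _ b => ∃ s t : K, s ≠ 0 ∧ IsSquare s ∧
      ((b = NN w x.1 x.2 s t 1 1 1 ∧ c = rr x.1 • (t : OnePoint K)) ∨
       (b = NN w x.1 x.2 s t 1 0 0 ∧ c = rr x.1 • ((t - 2 * s : K) : OnePoint K))), ?_, ?_, btr, ?_, ?_, ?_, ?_⟩⟩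
  · simp
  · rintro b ⟨g, e0, e1, e2, e3, hg, he, rfl⟩
    obtain ⟨n1, n2, n3, n4, n5, n6⟩ := qq_ne w hw h3 g
    unfold QQ
    rw [card_insert_of_notMem, card_insert_of_notMem, card_insert_of_notMem, card_singleton]
    · simp only [mem_singleton, Prod.mk.injEq]; tauto
    · simp only [mem_insert, mem_singleton, Prod.mk.injEq]; tauto
    · simp only [mem_insert, mem_singleton, Prod.mk.injEq]; tauto
  · rintro ⟨a, l⟩ ⟨y, m⟩ ⟨z, m'⟩ _ _ _ n1 n2 n3
    simp only at n1 n2 n3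
    obtain ⟨p, rfl⟩ := rr_ex a y n1.symm
    obtain ⟨p', rfl⟩ := rr_ex a z n2.symm
    obtain ⟨f, rfl⟩ := lv l m
    obtain ⟨f', rfl⟩ := lv l m'
    have npp : p ≠ p' := fun h => n3 (by rw [h])
    have h1w : 1 - w ≠ 0 := fun h => hwne (by linear_combination -h)
    have hx0 : (p - p') / (1 - w) ≠ 0 := div_ne_zero (sub_ne_zero.2 npp) h1w
    have hp3 : ∀ f f' : ZMod 2, ∃ f3, f + f' + f3 = 1 := by decide
    obtain ⟨f3, hf3⟩ := hp3 f f'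
    rcases hneg _ hx0 with h | h
    · have e1 : p = p - (p - p') / (1 - w) + (p - p') / (1 - w) := by ring
      have e2 : p' = p - (p - p') / (1 - w) + (p - p') / (1 - w) * w := by field_simp; ring
      refine ⟨_, nn_mem w hw a l _ (p - (p - p') / (1 - w)) f f' f3 hx0 h hf3, ?_, ?_, ?_⟩
      · simp [NN]
      · unfold NN; rw [← e1]; simp
      · unfold NN; rw [← e2]; simp
    · set s := -((p - p') / (1 - w)) with hs
      have e1 : p' = p' - s + s := by ring
      have e2 : p = p' - s + s * w := by rw [hs]; field_simp; ring
      refine ⟨_, nn_mem w hw a l s (p' - s) f' f f3 (neg_ne_zero.2 hx0) h (by rw [← hf3]; ring), ?_, ?_, ?_⟩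
      · simp [NN]
      · unfold NN; rw [← e2]; simp
      · unfold NN; rw [← e1]; simp
  · rintro b hb ⟨a, l⟩ hx
    obtain ⟨s, t, s0, s1, h | h⟩ := bb_nf w hw h3 hs3 b hb a l hx
    · exact ⟨_, (), s, t, s0, s1, Or.inl ⟨h, rfl⟩⟩
    · exact ⟨_, (), s, t, s0, s1, Or.inr ⟨h, rfl⟩⟩
  · rintro b hb ⟨a, l⟩ hx c _ ⟨s, t, s0, s1, h⟩
    refine ⟨mem_univ _, ?_⟩
    simp only at h
    have c1 : c ≠ a := by
      rcases h with ⟨_, rfl⟩ | ⟨_, rfl⟩ <;> exact rr_ne _ _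
    rintro ⟨y, m⟩ hy rfl
    obtain ⟨p, rfl⟩ := rr_ex a y c1
    simp only [rr_inj] at h
    rcases h with ⟨rfl, rfl⟩ | ⟨rfl, rfl⟩
    · have hsw := mul_ne_zero s0 hw0
      have hsw2 := mul_ne_zero hsw hw0
      rcases nnm _ _ _ _ _ _ _ _ _ hy with h | h | h
      · exact s0 (by linear_combination -h.1)
      · exact hsw (by linear_combination -h.1)
      · exact hsw2 (by linear_combination -h.1)
    · have f1 : ∀ u : K, u ^ 3 = 1 → t - 2 * s ≠ t + s * u := by
        intro u hu h
        have h2 : s * (u + 2) = 0 := by linear_combination -h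
        have h2 := (mul_eq_zero.1 h2).resolve_left s0
        apply mul_ne_zero h3 h3
        linear_combination (u ^ 2 - 2 * u + 4) * h2 - hu
      rcases nnm _ _ _ _ _ _ _ _ _ hy with h | h | h
      · exact f1 1 (by ring) (by linear_combination h.1)
      · exact f1 w hww h.1
      · exact f1 (w ^ 2) (by linear_combination (w ^ 3 + 1) * hww) h.1
  · rintro b hb b' hb' ⟨a, l⟩ ⟨y, m⟩ c _ nxy hx hy hx' hy' ⟨s, t, s0, s1, h⟩ ⟨s', t', s0', s1', h'⟩
    simp only at h h'
    have c1 : c ≠ a := by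
      rcases h with ⟨_, rfl⟩ | ⟨_, rfl⟩ <;> exact rr_ne _ _
    have y1 : y ≠ a := fun h => nxy (btr b hb _ hx _ hy h.symm)
    obtain ⟨p, rfl⟩ := rr_ex a y y1
    obtain ⟨c, rfl⟩ := rr_ex a c c1
    simp only [rr_inj] at h h'
    have T1 : ∀ s t, IsSquare s → c = t → (rr a • (p : OnePoint K), m) ∈ NN w a l s t 1 1 1 →
        m = l + 1 ∧ IsSquare (p - c) ∧ NN w a l s t 1 1 1 = NN w a l (p - c) c 1 1 1 := by
      rintro s t hs rfl h
      rcases nnm _ _ _ _ _ _ _ _ _ h with h | h | h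
      · rw [show p - c = s by linear_combination h.1]
        exact ⟨h.2, hs, rfl⟩
      · rw [show p - c = s * w by linear_combination h.1]
        exact ⟨h.2, hs.mul (wsq w hw), nn_rot w hw _ _ _ _ _ _ _⟩
      · rw [show p - c = s * w * w by linear_combination h.1]
        exact ⟨h.2, (hs.mul (wsq w hw)).mul (wsq w hw), (nn_rot w hw _ _ _ _ _ _ _).trans (nn_rot w hw _ _ _ _ _ _ _)⟩
    have T2 : ∀ s t, c = t - 2 * s → (rr a • (p : OnePoint K), m) ∈ NN w a l s t 1 0 0 →
        (m = l + 1 ∧ p - c = 3 * s) ∨ (m = l ∧ p - c = s * (2 + w)) ∨ (m = l ∧ p - c = s * (2 + w ^ 2)) := by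
      rintro s t rfl h
      rcases nnm _ _ _ _ _ _ _ _ _ h with h | h | h
      · exact Or.inl ⟨h.2, by linear_combination h.1⟩
      · exact Or.inr (Or.inl ⟨by rw [h.2, add_zero], by linear_combination h.1⟩)
      · exact Or.inr (Or.inr ⟨by rw [h.2, add_zero], by linear_combination h.1⟩)
    have X : ∀ s t s' t', IsSquare s → IsSquare s' → s' ≠ 0 → c = t → c = t' - 2 * s' →
        (rr a • (p : OnePoint K), m) ∈ NN w a l s t 1 1 1 → (rr a • (p : OnePoint K), m) ∈ NN w a l s' t' 1 0 0 → False := by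
      intro s t s' t' hs hs' s0' e e' k k'
      obtain ⟨m1, sq, _⟩ := T1 s t hs e k
      rcases T2 s' t' e' k' with h | h | h
      · apply hn3
        rw [show (3 : K) = (p - c) / s' by rw [h.2]; field_simp]
        exact sq.div hs'
      · exact lne l (m1.symm.trans h.1)
      · exact lne l (m1.symm.trans h.1)
    have p3 : (2 + w) * (2 + w ^ 2) = 3 := by linear_combination 2 * hw + hww
    have q1 : 2 + w ≠ 0 := left_ne_zero_of_mul (p3 ▸ h3)
    have q2 : 2 + w ^ 2 ≠ 0 := right_ne_zero_of_mul (p3 ▸ h3)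
    have Y : ∀ s s' : K, s ≠ 0 → s' ≠ 0 → IsSquare s → IsSquare s' → s * (2 + w) = s' * (2 + w ^ 2) → False := by
      intro s s' s0 s0' s1 s1' h
      apply hn3
      have : (3 : K) = (s * (2 + w)) * (s * (2 + w)) / (s * s') := by
        rw [eq_div_iff (mul_ne_zero s0 s0')]
        linear_combination (-(s * s')) * p3 - s * (2 + w) * h
      rw [this]
      exact (IsSquare.mul_self _).div (s1.mul s1')
    rcases h with ⟨rfl, e⟩ | ⟨rfl, e⟩ <;> rcases h' with ⟨rfl, e'⟩ | ⟨rfl, e'⟩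
    · rw [(T1 s t s1 e hy).2.2, (T1 s' t' s1' e' hy').2.2]
    · exact (X s t s' t' s1 s1' s0' e e' hy hy').elim
    · exact (X s' t' s t s1' s1 s0 e' e hy' hy).elim
    · have hss : s = s' := by
        rcases T2 s t e hy with ⟨h1, h2⟩ | ⟨h1, h2⟩ | ⟨h1, h2⟩ <;> rcases T2 s' t' e' hy' with ⟨h1', h2'⟩ | ⟨h1', h2'⟩ | ⟨h1', h2'⟩
        · exact mul_left_cancel₀ h3 (h2.symm.trans h2')
        · exact absurd (h1.symm.trans h1') (lne l)
        · exact absurd (h1.symm.trans h1') (lne l)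
        · exact absurd (h1'.symm.trans h1) (lne l)
        · exact mul_right_cancel₀ q1 (h2.symm.trans h2')
        · exact (Y s s' s0 s0' s1 s1' (h2.symm.trans h2')).elim
        · exact absurd (h1'.symm.trans h1) (lne l)
        · exact (Y s' s s0' s0 s1' s1 (h2'.symm.trans h2)).elim
        · exact mul_right_cancel₀ q2 (h2.symm.trans h2')
      subst hss
      rw [show t = t' by linear_combination e' - e]

theorem famC (q n : ℕ) (hq : IsPrimePow q) (h7 : q % 12 = 7) : HasRD (q ^ n) := by
  classical
  rcases Nat.eq_zero_or_pos n with rfl | hn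
  · exact hasRD_one
  have hS := stn_pow q n hq hn.ne'
  obtain ⟨D, h1, h2, h3⟩ := hS
  have hF : Nonempty (Fr (ZMod 2) Unit (Fin (q + 1)) univ) := by
    obtain ⟨p, a, hp, ha, rfl⟩ := hq
    have : Fact p.Prime := ⟨hp.nat_prime⟩
    have : Fintype (GaloisField p a) := Fintype.ofFinite _
    have c1 : Fintype.card (GaloisField p a) = p ^ a := by
      rw [Fintype.card_eq_nat_card, GaloisField.card p a ha.ne']
    obtain ⟨F⟩ := fr_field (K := GaloisField p a) (by rw [c1]; exact h7)
    have e : OnePoint (GaloisField p a) ≃ Fin (p ^ a + 1) :=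
      Equiv.trans (Equiv.refl (Option (GaloisField p a))) (Fintype.equivFinOfCardEq (by rw [Fintype.card_option, c1]))
    have := F.map e.toEmbedding
    rw [univ_map_equiv_to_embedding] at this
    exact ⟨this⟩
  obtain ⟨F⟩ := hF
  have q0 : 0 < q ^ n := Nat.pow_pos (by omega)
  have hL : ∀ β ∈ {β : Finset (Option (Fin (q ^ n))) | β.card = 2}, Nonempty (LF (ZMod 2) Unit Empty (Option (Fin (q ^ n))) β) := by
    intro β hβ
    have hβ : β.card = 2 := hβ
    refine ⟨⟨{β ×ˢ univ}, fun x c b => ∃ u ∈ β, u ≠ x.1 ∧ c = Sum.inl (u, ()), ?_, ?_, ?_, ?_, ?_, ?_, ?_⟩⟩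
    · rintro b rfl y hy
      exact (mem_product.1 hy).1
    · rintro b rfl
      rw [card_product, hβ]; simp [ZMod.card]
    · intro x y z hx hy hz _ _ _
      exact ⟨_, rfl, by simp [hx], by simp [hy], by simp [hz]⟩
    · rintro b rfl x hx
      obtain ⟨u, hu, hne⟩ := exists_mem_ne (s := β) (by rw [hβ]; norm_num) x.1
      exact ⟨_, u, hu, hne, rfl⟩
    · rintro b rfl x hx c h ⟨u, hu, hne, e⟩
      simp only [Sum.inl.injEq, Prod.mk.injEq] at e
      rw [e.1]; exact ⟨hu, hne⟩
    · rintro b rfl b' rfl; simp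
    · rintro b rfl x hx y hy h; exact h.elim
  obtain ⟨r⟩ := fillGlue (G := ZMod 2) (H := Unit) (H' := Empty) (U := Option (Fin (q ^ n))) (by simp; omega)
    (by simp [ZMod.card]; omega) D {β | β.card = 2}
    (fun a b c x y z => Or.inl (h2 a b c x y z)) (fun a b hab => ⟨{a, b}, card_pair hab, by simp, by simp⟩) h3
    (by
      intro a b c n1 n2 n3 _ _ β' hβ' _ _ _ k1 k2 k3
      have : ({a, b, c} : Finset _) ⊆ β' := by
        intro x hx
        simp only [mem_insert, mem_singleton] at hx
        rcases hx with rfl | rfl | rfl <;> assumption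
      have := card_le_card this
      rw [card_eq_three.2 ⟨a, b, c, n1, n2, n3, rfl⟩] at this
      simp only [Set.mem_ofPred_eq] at hβ'
      omega)
    (by
      intro a b n1 β hβ β' hβ' k1 k2 l1 l2
      have : ∀ β : Finset (Option (Fin (q ^ n))), β.card = 2 → a ∈ β → b ∈ β → {a, b} = β := by
        intro β hβ k1 k2
        apply eq_of_subset_of_card_le
        · intro x hx
          simp only [mem_insert, mem_singleton] at hx
          rcases hx with rfl | rfl <;> assumption
        · rw [card_pair n1, hβ]
      rw [← this β hβ k1 k2, ← this β' hβ' l1 l2])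
    (fun β hβ => F.on β (h1 β hβ))
    hL
  exact HasRD.of r (q ^ n) (by simp [ZMod.card]; omega) (by simp)

theorem hasRD_L (x : ℕ) (hx : x ∈ Lzhou) : ∃ n, 0 < n ∧ x = 2 * n + 1 ∧ HasRD n := by
  rcases hx with (⟨m, n, hm, rfl⟩ | ⟨n, rfl⟩) | ⟨q, n, hq, h7, rfl⟩
  · obtain ⟨m, rfl⟩ : ∃ m', m = m' + 1 := ⟨m - 1, by omega⟩
    have : 0 < 4 ^ m * 25 ^ n := by positivity
    refine ⟨2 * (4 ^ m * 25 ^ n) - 1, by omega, ?_, famA (m + 1) n hm⟩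
    rw [pow_succ, mul_right_comm]; omega
  · have : 0 < 7 ^ n := by positivity
    exact ⟨2 * 7 ^ n - 1, by omega, by omega, famB n⟩
  · exact ⟨q ^ n, Nat.pow_pos (by omega), rfl, famC q n hq h7⟩

theorem hasRD_prod (s : Multiset ℕ) : s ≠ 0 → (∀ x ∈ s, x ∈ Lzhou) → ∃ n, 0 < n ∧ s.prod = 2 * n + 1 ∧ HasRD n := by
  induction s using Multiset.induction_on with
  | empty => intro h; exact absurd rfl h
  | cons a s ih =>
    intro _ h
    obtain ⟨n, n0, hn, H⟩ := hasRD_L a (h a (by simp))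
    by_cases hs : s = 0
    · subst hs
      exact ⟨n, n0, by simpa using hn, H⟩
    · obtain ⟨m, m0, hm, H'⟩ := ih hs (fun x hx => h x (by simp [hx]))
      rw [Multiset.prod_cons, hm, hn]
      refine ⟨2 * n * m + n + m, by omega, by ring, H.mul n0 m0 H' (by ring)⟩

end P6b

/-- If v is the product of a nonempty finite multiset of elements of L, then
there exist an RDSQS(v + 1) and an LKTS(3v). -/
theorem stmt_16 (v : ℕ) (s : Multiset ℕ) (hs : s ≠ 0)
    (hL : ∀ x ∈ s, x ∈ Lzhou) (hv : s.prod = v) :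
    ExistsRDSQS (v + 1) ∧ ExistsLKTS (3 * v) := by
  obtain ⟨n, n0, hn, H⟩ := hasRD_prod s hs hL
  rw [← hv, hn]
  exact ⟨exists_of_hasRD H, lkts_of_hasRD n0 H⟩
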